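/- Let f(X_1,...,X_n) = \sum_{1\le i\le j\le n} a_{ij}X_iX_j with a_{ij} \in \mathbb{Z} be a positive definite integral quadratic form in n \ge 5 variables. If f is almost universal (there exists N such that every integer a \ge N equals f(x) for some x \in \mathbb{Z}^n), then f is almost primitively universal (there exists N' such that every integer a \ge N' equals f(x) for some x \in \mathbb{Z}^n with gcd(x_1,...,x_n) = 1). -/

import Mathlib

section
structure IsQ {M : Type} [AddCommGroup M] (q : M → ℤ) (b : M → M → ℤ) : Prop where
  add : ∀ x y, q (x + y) = q x + q y + b x y
  smul : ∀ (t : ℤ) x, q (t • x) = t ^ 2 * q x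
  badd : ∀ x y z, b (x + y) z = b x z + b y z

namespace IsQ
variable {M : Type} [AddCommGroup M] {q : M → ℤ} {b : M → M → ℤ}
theorem symm (h : IsQ q b) (x y : M) : b x y = b y x := by
  have h1 := h.add x y
  have h2 := h.add y x
  rw [add_comm y x] at h2
  linarith
theorem addb (h : IsQ q b) (x y z : M) : b x (y + z) = b x y + b x z := by
  rw [h.symm, h.badd, h.symm y, h.symm z]
theorem bsmul (h : IsQ q b) (t : ℤ) (x y : M) : b (t • x) y = t * b x y := by
  let f : M →+ ℤ := AddMonoidHom.mk' (fun x => b x y) (fun a c => h.badd a c y)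
  have := map_zsmul f t x
  simpa [f] using this
theorem smulb (h : IsQ q b) (t : ℤ) (x y : M) : b x (t • y) = t * b x y := by
  rw [h.symm, h.bsmul, h.symm]
theorem self (h : IsQ q b) (x : M) : b x x = 2 * q x := by
  have h1 := h.add x x
  have h2 := h.smul 2 x
  rw [two_smul] at h2
  linarith
theorem zero (h : IsQ q b) : q 0 = 0 := by
  have := h.smul 0 0
  simpa using this
theorem neg (h : IsQ q b) (x : M) : q (-x) = q x := by
  have := h.smul (-1) x
  simpa using this
theorem bneg (h : IsQ q b) (x y : M) : b (-x) y = - b x y := by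
  have := h.bsmul (-1) x y
  simpa using this
theorem sub (h : IsQ q b) (x y : M) : q (x - y) = q x + q y - b x y := by
  rw [sub_eq_add_neg, h.add, h.neg, h.symm, h.bneg, h.symm]; ring
theorem line (h : IsQ q b) (x y : M) (r : ℤ) : q (x + r • y) = q x + r ^ 2 * q y + r * b x y := by
  rw [h.add, h.smul, h.smulb]
end IsQ

theorem loc_hensel {p : ℕ} (hp : p.Prime) {α β : ℤ} (hα : ¬ (p : ℤ) ∣ α) (hβ : (p : ℤ) ∣ β)
    (c : ℤ) (E : ℕ) : ∃ r : ℤ, (p : ℤ) ^ E ∣ α * r + β * r ^ 2 - c := by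
  induction E with
  | zero => exact ⟨0, by simp⟩
  | succ E ih =>
    obtain ⟨r, u, hu⟩ := ih
    obtain ⟨β', rfl⟩ := hβ
    have hcop : IsCoprime α (p : ℤ) := by
      rw [isCoprime_comm]
      exact (Nat.prime_iff_prime_int.mp hp).coprime_iff_not_dvd.mpr hα
    obtain ⟨s, t, hst⟩ := hcop
    refine ⟨r + (p : ℤ) ^ E * (- u * s), ?_⟩
    have : α * (r + (p : ℤ) ^ E * (- u * s)) + p * β' * (r + (p : ℤ) ^ E * (- u * s)) ^ 2 - c
      = (p : ℤ) ^ E * p * (t * u + β' * (- u * s) * (2 * r + (p : ℤ) ^ E * (- u * s))) := by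
      have e : s * α = 1 - t * p := by linarith
      linear_combination hu - (p : ℤ) ^ E * u * e
    rw [this, pow_succ]
    exact Dvd.intro _ rfl

theorem loc_sqrt {s : ℤ} (hs : (8 : ℤ) ∣ s - 1) (E : ℕ) :
    ∃ t : ℤ, ¬ (2 : ℤ) ∣ t ∧ (2 : ℤ) ^ E ∣ t ^ 2 - s := by
  obtain ⟨c, hc⟩ := hs
  obtain ⟨r, u, hu⟩ := loc_hensel Nat.prime_two (α := 1) (β := 2) (by decide) (by simp) c E
  refine ⟨1 + 4 * r, by omega, 8 * u, ?_⟩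
  push_cast at hu
  linear_combination 8 * hu - hc

theorem loc_chev {p : ℕ} [Fact p.Prime] (A B C D E F : ZMod p) :
    ∃ x y z : ZMod p, (x ≠ 0 ∨ y ≠ 0 ∨ z ≠ 0) ∧
      A * x ^ 2 + B * y ^ 2 + C * z ^ 2 + D * (x * y) + E * (x * z) + F * (y * z) = 0 := by
  classical
  by_contra hcon
  push Not at hcon
  let f : MvPolynomial (Fin 3) (ZMod p) :=
    MvPolynomial.C A * (MvPolynomial.X 0) ^ 2 + MvPolynomial.C B * (MvPolynomial.X 1) ^ 2
    + MvPolynomial.C C * (MvPolynomial.X 2) ^ 2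
    + MvPolynomial.C D * (MvPolynomial.X 0 * MvPolynomial.X 1)
    + MvPolynomial.C E * (MvPolynomial.X 0 * MvPolynomial.X 2)
    + MvPolynomial.C F * (MvPolynomial.X 1 * MvPolynomial.X 2)
  have hXX : ∀ (a : ZMod p) (i j : Fin 3), (MvPolynomial.C a * (MvPolynomial.X i * MvPolynomial.X j) :
      MvPolynomial (Fin 3) (ZMod p)).totalDegree ≤ 2 := by
    intro a i j
    refine (MvPolynomial.totalDegree_mul _ _).trans ?_
    rw [MvPolynomial.totalDegree_C]
    have := MvPolynomial.totalDegree_mul (MvPolynomial.X i : MvPolynomial (Fin 3) (ZMod p)) (MvPolynomial.X j)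
    simp only [MvPolynomial.totalDegree_X] at this
    omega
  have hdeg : f.totalDegree ≤ 2 := by
    simp only [f, pow_two]
    refine (MvPolynomial.totalDegree_add _ _).trans (max_le ?_ (hXX _ _ _))
    refine (MvPolynomial.totalDegree_add _ _).trans (max_le ?_ (hXX _ _ _))
    refine (MvPolynomial.totalDegree_add _ _).trans (max_le ?_ (hXX _ _ _))
    refine (MvPolynomial.totalDegree_add _ _).trans (max_le ?_ (hXX _ _ _))
    refine (MvPolynomial.totalDegree_add _ _).trans (max_le (hXX _ _ _) (hXX _ _ _))
  have hch := char_dvd_card_solutions (p := p) (f := f) (by simp; omega)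
  have : Fintype.card {x : Fin 3 → ZMod p // MvPolynomial.eval x f = 0} = 1 := by
    rw [Fintype.card_eq_one_iff]
    refine ⟨⟨0, by simp [f]⟩, ?_⟩
    rintro ⟨x, hx⟩
    have h1 := hcon (x 0) (x 1) (x 2)
    simp only [f, map_add, map_mul, map_pow, MvPolynomial.eval_C, MvPolynomial.eval_X] at hx
    by_cases h0 : x 0 ≠ 0 ∨ x 1 ≠ 0 ∨ x 2 ≠ 0
    · exact absurd hx (h1 h0)
    · push Not at h0
      ext i
      fin_cases i <;> simp [h0]
  rw [this] at hch
  exact (Fact.out : p.Prime).one_lt.ne' (Nat.dvd_one.mp hch)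
end

section
structure IsQF (p : ℕ) {U : Type} [AddCommGroup U] [Module (ZMod p) U] (q : U → ZMod p)
    (b : U →+ U →+ ZMod p) : Prop where
  add : ∀ x y, q (x + y) = q x + q y + b x y
  smul : ∀ (t : ZMod p) x, q (t • x) = t ^ 2 * q x

theorem IsQF.symm {p : ℕ} {U : Type} [AddCommGroup U] [Module (ZMod p) U] {q : U → ZMod p}
    {b : U →+ U →+ ZMod p} (h : IsQF p q b) (x y : U) : b x y = b y x := by
  have h1 := h.add x y
  have h2 := h.add y x
  rw [add_comm y x] at h2
  linear_combination h2 - h1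

theorem IsQF.self {p : ℕ} {U : Type} [AddCommGroup U] [Module (ZMod p) U] {q : U → ZMod p}
    {b : U →+ U →+ ZMod p} (h : IsQF p q b) (x : U) : b x x = 2 * q x := by
  have h1 := h.add x x
  have h2 := h.smul 2 x
  rw [two_smul] at h2
  linear_combination h2 - h1

theorem IsQF.zero {p : ℕ} {U : Type} [AddCommGroup U] [Module (ZMod p) U] {q : U → ZMod p}
    {b : U →+ U →+ ZMod p} (h : IsQF p q b) : q 0 = 0 := by
  have h2 := h.smul 0 0
  simpa using h2

theorem IsQ.chev {p : ℕ} [Fact p.Prime] {M : Type} [AddCommGroup M] {q : M → ℤ} {b : M → M → ℤ}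
    (h : IsQ q b) (x y z : M) : ∃ r s t : ℤ,
      ((r : ZMod p) ≠ 0 ∨ (s : ZMod p) ≠ 0 ∨ (t : ZMod p) ≠ 0) ∧
      (p : ℤ) ∣ q (r • x + s • y + t • z) := by
  obtain ⟨r, s, t, h1, h2⟩ := loc_chev (p := p) (q x : ZMod p) (q y) (q z) (b x y) (b x z) (b y z)
  obtain ⟨r, rfl⟩ := ZMod.intCast_surjective r
  obtain ⟨s, rfl⟩ := ZMod.intCast_surjective s
  obtain ⟨t, rfl⟩ := ZMod.intCast_surjective t
  refine ⟨r, s, t, h1, ?_⟩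
  rw [← ZMod.intCast_zmod_eq_zero_iff_dvd]
  rw [h.add, h.add, h.smul, h.smul, h.smul, h.badd, h.bsmul, h.smulb, h.bsmul, h.smulb, h.bsmul,
    h.smulb]
  push_cast
  linear_combination h2

theorem loc_dim {K V : Type} [Field K] [AddCommGroup V] [Module K V] [FiniteDimensional K V]
    (A B : Submodule K V)
    (h : ∀ x ∈ A, ∀ y ∈ A, ∀ z ∈ A, ∃ r s t : K, (r ≠ 0 ∨ s ≠ 0 ∨ t ≠ 0) ∧
      r • x + s • y + t • z ∈ B) : Module.finrank K A ≤ Module.finrank K B + 2 := by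
  by_contra hcon
  push Not at hcon
  let C := B.comap A.subtype
  have h1 := Submodule.finrank_quotient_add_finrank C
  have h2 : Module.finrank K C ≤ Module.finrank K B := by
    apply LinearMap.finrank_le_finrank_of_injective
      (f := (A.subtype.restrict (p := C) (q := B) (fun x hx => hx)))
    intro x y hxy
    apply Subtype.ext
    apply Subtype.ext
    have := congrArg (Subtype.val : B → V) hxy
    simpa using this
  have h3 : 3 ≤ Module.finrank K (A ⧸ C) := by omega
  obtain ⟨f, hf⟩ := exists_linearIndependent_of_le_finrank h3
  obtain ⟨x, hx⟩ := C.mkQ_surjective (f 0)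
  obtain ⟨y, hy⟩ := C.mkQ_surjective (f 1)
  obtain ⟨z, hz⟩ := C.mkQ_surjective (f 2)
  obtain ⟨r, s, t, h4, h5⟩ := h x x.2 y y.2 z z.2
  have h6 : r • x + s • y + t • z ∈ C := h5
  rw [← Submodule.Quotient.mk_eq_zero] at h6
  change C.mkQ _ = 0 at h6
  rw [map_add, map_add, map_smul, map_smul, map_smul, hx, hy, hz] at h6
  rw [Fintype.linearIndependent_iff] at hf
  have := hf ![r, s, t] (by simpa [Fin.sum_univ_three] using h6)
  have a0 := this 0
  have a1 := this 1
  have a2 := this 2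
  simp at a0 a1 a2
  simp_all

theorem loc_red (p : ℕ) [Fact p.Prime] {M : Type} [AddCommGroup M] [Module.Free ℤ M]
    [Module.Finite ℤ M] {q : M → ℤ} {b : M → M → ℤ} (h : IsQ q b) {n : ℕ}
    (hn : Module.finrank ℤ M = n) :
    ∃ π : M →+ (Fin n → ZMod p), Function.Surjective π ∧
      (∀ x, π x = 0 ↔ ∃ y, x = (p : ℤ) • y) ∧
      ∃ (Q : (Fin n → ZMod p) → ZMod p) (B : (Fin n → ZMod p) →+ (Fin n → ZMod p) →+ ZMod p),
        IsQF p Q B ∧ (∀ x, Q (π x) = q x) ∧ ∀ x y, B (π x) (π y) = b x y := by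
  let e := (Module.finBasisOfFinrankEq ℤ M hn).equivFun
  let c : (Fin n → ℤ) →+ (Fin n → ZMod p) := (Int.castAddHom (ZMod p)).compLeft (Fin n)
  let π : M →+ (Fin n → ZMod p) := c.comp e.toLinearMap.toAddMonoidHom
  have hπ : ∀ x i, π x i = (e x i : ZMod p) := fun x i => rfl
  have hs : Function.Surjective π := by
    intro u
    choose v hv using fun i => ZMod.intCast_surjective (u i)
    refine ⟨e.symm v, ?_⟩
    ext i
    rw [hπ, LinearEquiv.apply_symm_apply, hv]
  have hk : ∀ x, π x = 0 ↔ ∃ y, x = (p : ℤ) • y := by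
    intro x
    constructor
    · intro hx
      have : ∀ i, ∃ k, e x i = p * k := by
        intro i
        have := congrFun hx i
        rw [hπ, Pi.zero_apply, ZMod.intCast_zmod_eq_zero_iff_dvd] at this
        exact this
      choose k hk using this
      refine ⟨e.symm k, ?_⟩
      apply e.injective
      rw [map_smul, LinearEquiv.apply_symm_apply]
      ext i
      simp [hk]
    · rintro ⟨y, rfl⟩
      ext i
      simp [hπ]
  have hkb : ∀ x x', π x = π x' → ∃ y, x = x' + (p : ℤ) • y := by
    intro x x' hx
    obtain ⟨y, hy⟩ := (hk (x - x')).1 (by rw [map_sub, hx, sub_self])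
    exact ⟨y, by rw [← hy]; abel⟩
  let σ := Function.surjInv hs
  have hσ : ∀ u, π (σ u) = u := Function.surjInv_eq hs
  have hQ : ∀ x, (q (σ (π x)) : ZMod p) = q x := by
    intro x
    obtain ⟨y, hy⟩ := hkb _ _ (hσ (π x))
    rw [hy, h.line]
    push_cast
    simp
  have hB : ∀ x y, (b (σ (π x)) (σ (π y)) : ZMod p) = b x y := by
    intro x y
    obtain ⟨z, hz⟩ := hkb _ _ (hσ (π x))
    obtain ⟨w, hw⟩ := hkb _ _ (hσ (π y))
    rw [hz, hw, h.addb, h.smulb, h.badd, h.bsmul]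
    push_cast
    simp
  refine ⟨π, hs, hk, fun u => q (σ u), AddMonoidHom.mk' (fun u => AddMonoidHom.mk'
    (fun v => (b (σ u) (σ v) : ZMod p)) ?_) ?_, ⟨?_, ?_⟩, hQ, ?_⟩
  · intro v w
    obtain ⟨v, rfl⟩ := hs v
    obtain ⟨w, rfl⟩ := hs w
    obtain ⟨u, rfl⟩ := hs u
    rw [← map_add, hB, hB, hB, h.addb]; push_cast; rfl
  · intro v w
    refine AddMonoidHom.ext fun x => ?_
    obtain ⟨v, rfl⟩ := hs v
    obtain ⟨w, rfl⟩ := hs w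
    obtain ⟨x, rfl⟩ := hs x
    change (b (σ (π v + π w)) (σ (π x)) : ZMod p) = b (σ (π v)) (σ (π x)) + b (σ (π w)) (σ (π x))
    rw [← map_add, hB, hB, hB, h.badd]; push_cast; rfl
  · intro v w
    obtain ⟨v, rfl⟩ := hs v
    obtain ⟨w, rfl⟩ := hs w
    change (q (σ (π v + π w)) : ZMod p) = q (σ (π v)) + q (σ (π w)) + b (σ (π v)) (σ (π w))
    rw [← map_add, hB, hQ, hQ, hQ, h.add]; push_cast; rfl
  · intro t v
    obtain ⟨v, rfl⟩ := hs v
    obtain ⟨t, rfl⟩ := ZMod.intCast_surjective t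
    change (q (σ ((t : ZMod p) • π v)) : ZMod p) = t ^ 2 * q (σ (π v))
    have : (t : ZMod p) • π v = π (t • v) := by
      rw [map_zsmul, Int.cast_smul_eq_zsmul]
    rw [this, hQ, hQ, h.smul]; push_cast; rfl
  · intro x y
    exact hB x y

theorem loc_orth {p n : ℕ} [Fact p.Prime] (B : (Fin n → ZMod p) →+ (Fin n → ZMod p) →+ ZMod p)
    (P : Submodule (ZMod p) (Fin n → ZMod p)) (k l : Fin n → ZMod p)
    (hP : Module.finrank (ZMod p) P + 2 < n) : ∃ c, c ∉ P ∧ B k c = 0 ∧ B l c = 0 := by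
  let f : (Fin n → ZMod p) →+ (Fin 2 → ZMod p) := AddMonoidHom.mk' (fun c => ![B k c, B l c]) (by
    intro a b
    ext i
    fin_cases i <;> simp)
  let g := f.toZModLinearMap p
  have h1 := LinearMap.finrank_range_add_finrank_ker g
  have h2 : Module.finrank (ZMod p) (LinearMap.range g) ≤ 2 := by
    simpa using Submodule.finrank_le (LinearMap.range g)
  simp only [Module.finrank_fintype_fun_eq_card, Fintype.card_fin] at h1
  by_contra hcon
  push Not at hcon
  have h3 : LinearMap.ker g ≤ P := by
    intro c hc
    by_contra hcP
    rw [LinearMap.mem_ker] at hc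
    have h4 : f c = 0 := hc
    have h5 := congrFun h4 0
    have h6 := congrFun h4 1
    exact hcon c hcP h5 h6
  have := Submodule.finrank_mono h3
  omega
end

section
structure LBase (p : ℕ) {L0 L1 L2 : Type} [AddCommGroup L0] [AddCommGroup L1] [AddCommGroup L2]
    (q0 : L0 → ℤ) (b0 : L0 → L0 → ℤ) (q1 : L1 → ℤ) (b1 : L1 → L1 → ℤ)
    (q2 : L2 → ℤ) (b2 : L2 → L2 → ℤ)
    (i : L2 →+ L1) (μ : L1 →+ L2) (ν : L0 →+ L2) : Prop where
  h0 : IsQ q0 b0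
  h1 : IsQ q1 b1
  h2 : IsQ q2 b2
  mi : ∀ x, μ (i x) = (p : ℤ) • x
  im : ∀ z, i (μ z) = (p : ℤ) • z
  qm : ∀ z, q2 (μ z) = p * q1 z
  bm : ∀ z x, b2 (μ z) x = b1 z (i x)
  dv : ∀ z x, (p : ℤ) ∣ b1 z (i x)
  qi : ∀ x, q1 (i x) = p * q2 x
  an1 : ∀ z, (p : ℤ) ∣ q1 z → ∃ x, z = i x
  qn : ∀ y, q2 (ν y) = q0 y
  an0 : ∀ y, (p : ℤ) ∣ q0 y → ∃ z, ν y = μ z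
  mn : ∀ z, ∃ y, μ z = ν y
  univ : ∀ (a : ℤ) (E : ℕ), ∃ y, (p : ℤ) ^ E ∣ q0 y - a

structure LU (p n : ℕ) {L0 L1 L2 : Type} [AddCommGroup L0] [AddCommGroup L1] [AddCommGroup L2]
    (q2 : L2 → ℤ) (b2 : L2 → L2 → ℤ) (μ : L1 →+ L2) (ν : L0 →+ L2)
    (π : L2 →+ (Fin n → ZMod p)) (Q : (Fin n → ZMod p) → ZMod p)
    (B : (Fin n → ZMod p) →+ (Fin n → ZMod p) →+ ZMod p)
    (P N : Submodule (ZMod p) (Fin n → ZMod p)) : Prop where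
  hs : Function.Surjective π
  hk : ∀ x, π x = 0 ↔ ∃ y, x = (p : ℤ) • y
  hQ : IsQF p Q B
  Qp : ∀ x, Q (π x) = q2 x
  Bp : ∀ x y, B (π x) (π y) = b2 x y
  memP : ∀ x, π x ∈ P ↔ ∃ z, x = μ z
  memN : ∀ x, π x ∈ N ↔ ∃ y, x = ν y
  PN : P ≤ N
  radP : ∀ x ∈ P, ∀ y, B x y = 0
  Q0P : ∀ x ∈ P, Q x = 0
  anN : ∀ x ∈ N, Q x = 0 → x ∈ P
  dimP : Module.finrank (ZMod p) P ≤ 2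
  dimN : Module.finrank (ZMod p) N ≤ Module.finrank (ZMod p) P + 2
  unN : ∀ e : ZMod p, e ≠ 0 → ∃ x ∈ N, Q x = e

theorem LBase.toLU {p : ℕ} [Fact p.Prime] {L0 L1 L2 : Type} [AddCommGroup L0] [AddCommGroup L1]
    [AddCommGroup L2] [Module.Free ℤ L2] [Module.Finite ℤ L2]
    {q0 : L0 → ℤ} {b0 : L0 → L0 → ℤ} {q1 : L1 → ℤ} {b1 : L1 → L1 → ℤ}
    {q2 : L2 → ℤ} {b2 : L2 → L2 → ℤ}
    {i : L2 →+ L1} {μ : L1 →+ L2} {ν : L0 →+ L2} (h : LBase p q0 b0 q1 b1 q2 b2 i μ ν)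
    {n : ℕ} (hn : Module.finrank ℤ L2 = n) : ∃ π Q B P N, LU p n q2 b2 μ ν π Q B P N := by
  obtain ⟨π, hs, hk, Q, B, hQ, Qp, Bp⟩ := loc_red p h.h2 hn
  let P := AddSubgroup.toZModSubmodule p ((AddMonoidHom.range μ).map π)
  let N := AddSubgroup.toZModSubmodule p ((AddMonoidHom.range ν).map π)
  have memP : ∀ x, π x ∈ P ↔ ∃ z, x = μ z := by
    intro x
    constructor
    · rintro ⟨y, ⟨z, rfl⟩, hy⟩
      obtain ⟨w, hw⟩ := (hk (x - μ z)).1 (by rw [map_sub, hy, sub_self])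
      refine ⟨z + i w, ?_⟩
      rw [map_add, h.mi, ← hw]; abel
    · rintro ⟨z, rfl⟩
      exact ⟨_, ⟨z, rfl⟩, rfl⟩
  have memN : ∀ x, π x ∈ N ↔ ∃ z, x = ν z := by
    intro x
    constructor
    · rintro ⟨y, ⟨z, rfl⟩, hy⟩
      obtain ⟨w, hw⟩ := (hk (x - ν z)).1 (by rw [map_sub, hy, sub_self])
      obtain ⟨y, hy⟩ := h.mn (i w)
      refine ⟨z + y, ?_⟩
      rw [map_add, ← hy, h.mi, ← hw]; abel
    · rintro ⟨z, rfl⟩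
      exact ⟨_, ⟨z, rfl⟩, rfl⟩
  have hz : ∀ z, Q (π (μ z)) = 0 := by
    intro z
    rw [Qp, h.qm]; push_cast; simp
  have hc : ∀ (r s t : ℤ) x y z, π (r • x + s • y + t • z) = (r : ZMod p) • π x + (s : ZMod p) • π y
      + (t : ZMod p) • π z := by
    intro r s t x y z
    simp only [map_add, map_zsmul, Int.cast_smul_eq_zsmul]
  refine ⟨π, Q, B, P, N, hs, hk, hQ, Qp, Bp, memP, memN, ?_, ?_, ?_, ?_, ?_, ?_, ?_⟩
  · rintro _ ⟨_, ⟨z, rfl⟩, rfl⟩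
    obtain ⟨y, hy⟩ := h.mn z
    rw [hy]
    exact ⟨_, ⟨y, rfl⟩, rfl⟩
  · rintro _ ⟨_, ⟨z, rfl⟩, rfl⟩ y
    obtain ⟨y, rfl⟩ := hs y
    rw [Bp, h.bm, ZMod.intCast_zmod_eq_zero_iff_dvd]
    exact h.dv z y
  · rintro _ ⟨_, ⟨z, rfl⟩, rfl⟩
    exact hz z
  · rintro _ ⟨_, ⟨y, rfl⟩, rfl⟩ h0
    rw [memP]
    apply h.an0
    rw [Qp, h.qn, ZMod.intCast_zmod_eq_zero_iff_dvd] at h0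
    exact h0
  · have := loc_dim P ⊥ ?_
    · simpa using this
    rintro _ ⟨_, ⟨x, rfl⟩, rfl⟩ _ ⟨_, ⟨y, rfl⟩, rfl⟩ _ ⟨_, ⟨z, rfl⟩, rfl⟩
    obtain ⟨r, s, t, hr, hq⟩ := h.h1.chev (p := p) x y z
    obtain ⟨w, hw⟩ := h.an1 _ hq
    refine ⟨r, s, t, hr, ?_⟩
    rw [Submodule.mem_bot, ← hc, ← map_zsmul, ← map_zsmul, ← map_zsmul, ← map_add, ← map_add,
      hw, h.mi]
    rw [hk]
    exact ⟨w, rfl⟩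
  · apply loc_dim
    rintro _ ⟨_, ⟨x, rfl⟩, rfl⟩ _ ⟨_, ⟨y, rfl⟩, rfl⟩ _ ⟨_, ⟨z, rfl⟩, rfl⟩
    obtain ⟨r, s, t, hr, hq⟩ := h.h0.chev (p := p) x y z
    obtain ⟨w, hw⟩ := h.an0 _ hq
    refine ⟨r, s, t, hr, ?_⟩
    rw [← hc, ← map_zsmul, ← map_zsmul, ← map_zsmul, ← map_add, ← map_add, memP]
    exact ⟨w, hw⟩
  · intro e he
    obtain ⟨e, rfl⟩ := ZMod.intCast_surjective e
    obtain ⟨y, hy⟩ := h.univ e 1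
    refine ⟨π (ν y), ⟨_, ⟨y, rfl⟩, rfl⟩, ?_⟩
    rw [Qp, h.qn]
    rw [pow_one, ← ZMod.intCast_zmod_eq_zero_iff_dvd] at hy
    push_cast at hy
    exact sub_eq_zero.1 hy

theorem LBase.lift {p : ℕ} [Fact p.Prime] {L2 : Type} [AddCommGroup L2]
    {q2 : L2 → ℤ} {b2 : L2 → L2 → ℤ} (h : IsQ q2 b2) {n : ℕ}
    {π : L2 →+ (Fin n → ZMod p)} {Q : (Fin n → ZMod p) → ZMod p}
    {B : (Fin n → ZMod p) →+ (Fin n → ZMod p) →+ ZMod p}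
    (hs : Function.Surjective π)
    (hk : ∀ x, π x = 0 ↔ ∃ y, x = (p : ℤ) • y)
    (Qp : ∀ x, Q (π x) = q2 x)
    (Bp : ∀ x y, B (π x) (π y) = b2 x y) (e : ℤ) (E : ℕ) (v w : Fin n → ZMod p)
    (hv : Q v = e) (hw : B v w ≠ 0) : ∃ x, π x = v ∧ (p : ℤ) ^ E ∣ q2 x - e := by
  obtain ⟨v, rfl⟩ := hs v
  obtain ⟨w, rfl⟩ := hs w
  rw [Bp, Ne, ZMod.intCast_zmod_eq_zero_iff_dvd] at hw
  rw [Qp, ← sub_eq_zero] at hv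
  norm_cast at hv
  rw [ZMod.intCast_zmod_eq_zero_iff_dvd] at hv
  obtain ⟨u, hu⟩ := hv
  obtain ⟨r, k, hr⟩ := loc_hensel (Fact.out : p.Prime) (α := b2 v w) (β := p * q2 w) hw
    (Dvd.intro _ rfl) (-u) E
  refine ⟨v + ((p : ℤ) * r) • w, ?_, p * k, ?_⟩
  · rw [map_add, (hk ((p * r : ℤ) • w)).2 ⟨r • w, by rw [smul_smul]⟩, add_zero]
  · rw [h.line]
    linear_combination hu + p * hr

theorem LBase.odd {p : ℕ} [Fact p.Prime] (hp2 : p ≠ 2) {L0 L1 L2 : Type} [AddCommGroup L0]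
    [AddCommGroup L1]
    [AddCommGroup L2] [Module.Free ℤ L2] [Module.Finite ℤ L2]
    {q0 : L0 → ℤ} {b0 : L0 → L0 → ℤ} {q1 : L1 → ℤ} {b1 : L1 → L1 → ℤ}
    {q2 : L2 → ℤ} {b2 : L2 → L2 → ℤ}
    {i : L2 →+ L1} {μ : L1 →+ L2} {ν : L0 →+ L2} (h : LBase p q0 b0 q1 b1 q2 b2 i μ ν)
    (hn : 5 ≤ Module.finrank ℤ L2) (e : ℤ) (he : ¬ (p : ℤ) ∣ e) (E : ℕ) :
    ∃ v, (¬ ∃ y, v = ν y) ∧ (p : ℤ) ^ E ∣ q2 v - e := by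
  obtain ⟨π, Q, B, P, N, g⟩ := h.toLU rfl
  generalize Module.finrank ℤ L2 = n at *
  have two : (2 : ZMod p) ≠ 0 := by
    intro h2
    have : ((2 : ℕ) : ZMod p) = 0 := by exact_mod_cast h2
    rw [ZMod.natCast_eq_zero_iff] at this
    exact hp2 ((Nat.prime_dvd_prime_iff_eq Fact.out Nat.prime_two).1 this)
  have he' : (e : ZMod p) ≠ 0 := by rwa [Ne, ZMod.intCast_zmod_eq_zero_iff_dvd]
  suffices hh : ∃ v, v ∉ N ∧ Q v = e by
    obtain ⟨v, hv, hq⟩ := hh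
    obtain ⟨x, hx, hx2⟩ := LBase.lift h.h2 g.hs g.hk g.Qp g.Bp e E v v hq
      (by rw [g.hQ.self, hq]; exact mul_ne_zero two he')
    refine ⟨x, ?_, hx2⟩
    rwa [← g.memN, hx]
  have hc : ∃ c, c ∉ P ∧ ∀ x ∈ N, B x c = 0 := by
    by_contra hcon
    push Not at hcon
    have key : ∀ k ∈ N, ∀ l ∈ N, ∃ x ∈ N, ∃ c, c ∉ P ∧ B k c = 0 ∧ B l c = 0 ∧ B x c ≠ 0 := by
      intro k hk l hl
      obtain ⟨c, hcP, h1, h2⟩ := loc_orth B P k l (by have := g.dimP; omega)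
      obtain ⟨x, hx, hx2⟩ := hcon c hcP
      exact ⟨x, hx, c, hcP, h1, h2, hx2⟩
    obtain ⟨k, hk, c1, -, -, -, hk1⟩ := key 0 N.zero_mem 0 N.zero_mem
    obtain ⟨l, hl, c2, -, hkc2, -, hl2⟩ := key k hk k hk
    obtain ⟨m, hm, c3, -, hkc3, hlc3, hm3⟩ := key k hk l hl
    have hd := g.dimN
    have hdi : Module.finrank (ZMod p) P + 3 ≤ Module.finrank (ZMod p) N := by
      let f : (Fin n → ZMod p) →ₗ[ZMod p] (Fin 3 → ZMod p) := AddMonoidHom.toZModLinearMap p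
        (AddMonoidHom.mk' (fun x => ![B x c1, B x c2, B x c3]) (by
          intro a b
          ext i
          fin_cases i <;> simp))
      have hf : ∀ x, f x = ![B x c1, B x c2, B x c3] := fun x => rfl
      let f' := f.domRestrict N
      have h1 := LinearMap.finrank_range_add_finrank_ker f'
      have h2 : LinearMap.range f' = ⊤ := by
        have hsm : ∀ (r : ZMod p) x y, B (r • x) y = r * B x y := by
          intro r x y
          have := ((B.flip y).toZModLinearMap p).map_smul r x
          exact this
        rw [LinearMap.range_eq_top]
        intro u
        let t := (u 2) / B m c3
        let s := (u 1 - t * B m c2) / B l c2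
        have hs : s * B l c2 = u 1 - t * B m c2 := div_mul_cancel₀ _ hl2
        have ht : t * B m c3 = u 2 := div_mul_cancel₀ _ hm3
        let r := (u 0 - s * B l c1 - t * B m c1) / B k c1
        have hr : r * B k c1 = u 0 - s * B l c1 - t * B m c1 := div_mul_cancel₀ _ hk1
        refine ⟨⟨r • k + s • l + t • m, N.add_mem (N.add_mem (N.smul_mem _ hk) (N.smul_mem _ hl))
          (N.smul_mem _ hm)⟩, ?_⟩
        change f (r • k + s • l + t • m) = u
        rw [hf]
        ext j
        simp only [map_add, AddMonoidHom.add_apply, hsm]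
        fin_cases j
        · simp only [hr]; simp; ring
        · simp [hs, hkc2]
        · simp [ht, hkc3, hlc3]
      rw [h2, finrank_top] at h1
      simp only [Module.finrank_fintype_fun_eq_card, Fintype.card_fin] at h1
      have h3 : Module.finrank (ZMod p) P ≤ Module.finrank (ZMod p) (LinearMap.ker f') := by
        let j : P →ₗ[ZMod p] LinearMap.ker f' := LinearMap.codRestrict _ (Submodule.inclusion g.PN) (by
          intro x
          rw [LinearMap.mem_ker]
          change f x = 0
          rw [hf]
          ext j
          fin_cases j <;> simp [g.radP x x.2])
        apply LinearMap.finrank_le_finrank_of_injective (f := j)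
        intro x y hxy
        have := congrArg (fun z : LinearMap.ker f' => ((z : N) : Fin n → ZMod p)) hxy
        exact Subtype.ext this
      omega
    omega
  obtain ⟨c, hcP, hc⟩ := hc
  have hcN : c ∉ N := by
    intro hcN
    have := hc c hcN
    rw [g.hQ.self] at this
    exact hcP (g.anN c hcN ((mul_eq_zero.1 this).resolve_left two))
  by_cases h1 : Q c = e
  · exact ⟨c, hcN, h1⟩
  · obtain ⟨k, hk, hk2⟩ := g.unN (e - Q c) (fun hh => h1 (sub_eq_zero.1 hh).symm)
    refine ⟨k + c, ?_, ?_⟩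
    · intro hh
      apply hcN
      have := N.sub_mem hh hk
      simpa using this
    · rw [g.hQ.add, hk2, hc k hk]; ring
end

section
theorem z2 (x : ZMod 2) : x = 0 ∨ x = 1 := by revert x; decide

theorem z2ne {x : ZMod 2} (h : x ≠ 0) : x = 1 := (z2 x).resolve_left h

theorem z2odd {x : ℤ} : (x : ZMod 2) = 1 ↔ ¬ (2 : ℤ) ∣ x := by
  have := ZMod.intCast_zmod_eq_zero_iff_dvd x 2
  push_cast at this
  rw [← this]
  constructor
  · intro h; rw [h]; decide
  · exact z2ne

theorem z2even {x : ℤ} : (x : ZMod 2) = 0 ↔ (2 : ℤ) ∣ x := by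
  have := ZMod.intCast_zmod_eq_zero_iff_dvd x 2
  push_cast at this
  exact this

theorem LBase.caseA_aux {L1 L2 : Type} [AddCommGroup L1] [AddCommGroup L2]
    {q1 : L1 → ℤ} {b1 : L1 → L1 → ℤ}
    {q2 : L2 → ℤ} {b2 : L2 → L2 → ℤ} (h1 : IsQ q1 b1) (h2 : IsQ q2 b2)
    {i : L2 →+ L1} {μ : L1 →+ L2}
    (mi : ∀ x, μ (i x) = (2 : ℤ) • x)
    (qm : ∀ z, q2 (μ z) = 2 * q1 z)
    (bm : ∀ z x, b2 (μ z) x = b1 z (i x))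
    (dv : ∀ z x, (2 : ℤ) ∣ b1 z (i x))
    (qi : ∀ x, q1 (i x) = 2 * q2 x)
    (c f w : L2) (hc : ¬ (2 : ℤ) ∣ q2 c) (hrad : ∀ x, (2 : ℤ) ∣ b2 c x)
    (hf : (2 : ℤ) ∣ q2 f) (hfw : ¬ (2 : ℤ) ∣ b2 f w)
    (t t' : L1) (ht : ¬ (2 : ℤ) ∣ q1 t) (ht' : ¬ (2 : ℤ) ∣ q1 t') (htt : ¬ (2 : ℤ) ∣ b1 t t')
    (hlt : (4 : ℤ) ∣ b1 (i c) t) (hlt' : (4 : ℤ) ∣ b1 (i c) t')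
    (e : ℤ) (he : ¬ (2 : ℤ) ∣ e) (E : ℕ) : ∃ z : L1, (2 : ℤ) ^ E ∣ q2 (c + μ z) - e := by
  obtain ⟨d, hd⟩ : ∃ d, e - q2 c = 2 * d := ⟨(e - q2 c) / 2, by omega⟩
  have base : ∀ z, q2 (c + μ z) - e = 2 * (q1 z + b1 (i c) z / 2 - d) := by
    intro z
    have := dv z c
    rw [h1.symm] at this
    rw [h2.add, qm, h2.symm, bm, h1.symm]
    have : b1 (i c) z = 2 * (b1 (i c) z / 2) := by omega
    linarith
  have hl : ∀ x, (4 : ℤ) ∣ b1 (i c) (i x) := by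
    intro x
    obtain ⟨k, hk⟩ := hrad x
    rw [← bm, mi, h2.bsmul, hk]
    exact ⟨k, by ring⟩
  by_cases hd2 : (2 : ℤ) ∣ d
  ·
    obtain ⟨d', rfl⟩ := hd2
    have hic : ∀ x, b1 (i c) (i x) / 2 = 2 * (b1 (i c) (i x) / 4) := by
      intro x
      have := hl x
      omega
    have main : ∃ x, (2 : ℤ) ^ E ∣ q2 x + b1 (i c) (i x) / 4 - d' := by
      obtain ⟨lw, hlw⟩ := hl w
      obtain ⟨lf, hlf⟩ := hl f
      obtain ⟨s, hs⟩ : ∃ s : ℤ, ¬ (2 : ℤ) ∣ s * b2 w f + lf := by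
        rw [h2.symm] at hfw
        by_cases hh : (2 : ℤ) ∣ lf
        · exact ⟨1, by omega⟩
        · exact ⟨0, by omega⟩
      obtain ⟨r, hr⟩ := loc_hensel Nat.prime_two (α := s * b2 w f + lf) (β := q2 f)
        (by exact_mod_cast hs) (by exact_mod_cast hf) (d' - s ^ 2 * q2 w - s * lw) E
      refine ⟨s • w + r • f, ?_⟩
      have e1 : b1 (i c) (i (s • w + r • f)) / 4 = s * lw + r * lf := by
        rw [map_add, map_zsmul, map_zsmul, h1.addb, h1.smulb, h1.smulb, hlw, hlf]
        have : s * (4 * lw) + r * (4 * lf) = 4 * (s * lw + r * lf) := by ring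
        rw [this]; omega
      rw [e1, h2.line, h2.smul, h2.bsmul]
      obtain ⟨k, hr⟩ := hr
      refine ⟨k, ?_⟩
      push_cast at hr
      linear_combination hr
    obtain ⟨x, k, hx⟩ := main
    refine ⟨i x, 4 * k, ?_⟩
    rw [base, hic, qi]
    linear_combination 4 * hx
  · obtain ⟨l, hl1⟩ := hlt
    obtain ⟨l', hl1'⟩ := hlt'
    obtain ⟨u, hu⟩ : ∃ u, q1 t + 2 * l - d = 2 * u := ⟨(q1 t + 2 * l - d) / 2, by omega⟩
    obtain ⟨r, k, hr⟩ := loc_hensel Nat.prime_two (α := b1 t t' + 2 * l') (β := 2 * q1 t')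
      (by push_cast; omega) (by push_cast; omega) (-u) E
    refine ⟨t + (2 * r) • t', 4 * k, ?_⟩
    rw [base, h1.line, h1.addb, h1.smulb, hl1, hl1']
    have : (4 * l + 2 * r * (4 * l')) / 2 = 2 * l + 4 * (r * l') := by
      have : 4 * l + 2 * r * (4 * l') = 2 * (2 * l + 4 * (r * l')) := by ring
      rw [this]; omega
    rw [this]
    push_cast at hr
    linear_combination 4 * hr + 2 * hu

theorem LBase.caseA {L0 L1 L2 : Type} [AddCommGroup L0]
    [AddCommGroup L1]
    [AddCommGroup L2]
    {q0 : L0 → ℤ} {b0 : L0 → L0 → ℤ} {q1 : L1 → ℤ} {b1 : L1 → L1 → ℤ}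
    {q2 : L2 → ℤ} {b2 : L2 → L2 → ℤ}
    {i : L2 →+ L1} {μ : L1 →+ L2} {ν : L0 →+ L2} (h : LBase 2 q0 b0 q1 b1 q2 b2 i μ ν)
    {n : ℕ} (hn : 5 ≤ n) {π Q B P N} (g : LU 2 n q2 b2 μ ν π Q B P N) (e : ℤ)
    (he : ¬ (2 : ℤ) ∣ e) (E : ℕ)
    (hN : ∃ k ∈ N, ∃ l ∈ N, B k l ≠ 0) :
    ∃ v, (¬ ∃ y, v = ν y) ∧ (2 : ℤ) ^ E ∣ q2 v - e := by
  obtain ⟨k, hk, l, hl, hkl⟩ := hN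
  have hQ := g.hQ
  have he1 : (e : ZMod 2) = 1 := z2odd.2 he
  have fin : ∀ v w, v ∉ N → Q v = 1 → B v w ≠ 0 →
      ∃ v, (¬ ∃ y, v = ν y) ∧ (2 : ℤ) ^ E ∣ q2 v - e := by
    intro v w hv hq hw
    obtain ⟨x, hx, hx2⟩ := LBase.lift h.h2 g.hs g.hk g.Qp g.Bp e E v w (by rw [hq, he1]) hw
    refine ⟨x, ?_, hx2⟩
    rwa [← g.memN, hx]
  by_contra hcon
  have hkQ : Q k = 1 := by
    apply z2ne
    intro h0
    exact hkl (g.radP k (g.anN k hk h0) l)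
  have hNn : ∀ c, c ∉ P → B k c = 0 → B l c = 0 → c ∉ N := by
    intro c hcP hkc hlc hcN
    have hc1 : Q c = 1 := z2ne fun h0 => hcP (g.anN c hcN h0)
    have h1 : k + c ∈ P := by
      apply g.anN _ (N.add_mem hk hcN)
      rw [hQ.add, hkQ, hc1, hkc]; decide
    have h2 := g.radP _ h1 l
    rw [map_add, AddMonoidHom.add_apply, hQ.symm c l, hlc, add_zero] at h2
    exact hkl h2
  have hall : ∀ c, c ∉ P → B k c = 0 → B l c = 0 → Q c = 1 ∧ ∀ w, B c w = 0 := by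
    intro c hcP hkc hlc
    have hcN := hNn c hcP hkc hlc
    have hc1 : Q c = 1 := by
      apply z2ne
      intro h0
      refine hcon (fin (k + c) l ?_ ?_ ?_)
      · intro hh
        apply hcN
        simpa using N.sub_mem hh hk
      · rw [hQ.add, hkQ, h0, hkc]; decide
      · rw [map_add, AddMonoidHom.add_apply, hQ.symm c l, hlc, add_zero]; exact hkl
    refine ⟨hc1, fun w => ?_⟩
    by_contra hw
    exact hcon (fin c w hcN hc1 hw)
  obtain ⟨c, hcP, hkc, hlc⟩ := loc_orth B P k l (by have := g.dimP; omega)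
  obtain ⟨hc1, hcr⟩ := hall c hcP hkc hlc
  have hcN := hNn c hcP hkc hlc
  have hdim : 2 ≤ Module.finrank (ZMod 2) P := by
    by_contra hlt
    have h1 := Submodule.finrank_add_le_finrank_add_finrank P (Submodule.span (ZMod 2) {c})
    have h2 : Module.finrank (ZMod 2) (Submodule.span (ZMod 2) {c}) ≤ 1 := by
      simpa using finrank_span_le_card (R := ZMod 2) ({c} : Set (Fin n → ZMod 2))
    obtain ⟨d, hdP, hkd, hld⟩ := loc_orth B (P ⊔ Submodule.span (ZMod 2) {c}) k l (by omega)
    have hd1 := hall d (fun hh => hdP (Submodule.mem_sup_left hh)) hkd hld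
    have hcd := hall (d + c) (by
      intro hh
      apply hdP
      have := Submodule.sub_mem _ (Submodule.mem_sup_left (T := Submodule.span (ZMod 2) {c}) hh)
        (Submodule.mem_sup_right (S := P) (Submodule.mem_span_singleton_self c))
      simpa using this) (by rw [map_add, hkd, hkc, add_zero]) (by rw [map_add, hld, hlc, add_zero])
    have := hcd.1
    rw [hQ.add, hd1.1, hc1, hd1.2 c] at this
    revert this
    decide
  obtain ⟨t, t', ht, ht', htt'⟩ : ∃ t t' : L1, ¬ (2 : ℤ) ∣ q1 t ∧ ¬ (2 : ℤ) ∣ q1 t' ∧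
      ¬ (2 : ℤ) ∣ b1 t t' := by
    obtain ⟨f, hf⟩ := exists_linearIndependent_of_le_finrank hdim
    rw [Fintype.linearIndependent_iff] at hf
    obtain ⟨x, hx⟩ := g.hs (f 0)
    obtain ⟨y, hy⟩ := g.hs (f 1)
    obtain ⟨t, rfl⟩ := (g.memP x).1 (by rw [hx]; exact (f 0).2)
    obtain ⟨t', rfl⟩ := (g.memP y).1 (by rw [hy]; exact (f 1).2)
    have key : ∀ z, (2 : ℤ) ∣ q1 z → π (μ z) = 0 := by
      intro z hz
      obtain ⟨x, rfl⟩ := h.an1 z hz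
      rw [h.mi, g.hk]
      exact ⟨x, rfl⟩
    have k1 : ¬ (2 : ℤ) ∣ q1 t := by
      intro hh
      have h1 := key _ hh
      rw [hx] at h1
      have := hf ![1, 0] (by simpa using h1) 0
      simp at this
    have k2 : ¬ (2 : ℤ) ∣ q1 t' := by
      intro hh
      have h1 := key _ hh
      rw [hy] at h1
      have := hf ![0, 1] (by simpa using h1) 1
      simp at this
    have k3 : ¬ (2 : ℤ) ∣ q1 (t + t') := by
      intro hh
      have h1 := key _ hh
      rw [map_add, map_add, hx, hy] at h1
      have := hf ![1, 1] (by simp; exact Subtype.ext h1) 0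
      simp at this
    refine ⟨t, t', k1, k2, ?_⟩
    rw [h.h1.add] at k3
    omega
  obtain ⟨c0, rfl⟩ := g.hs c
  obtain ⟨k0, rfl⟩ := g.hs k
  obtain ⟨w, rfl⟩ := g.hs l
  obtain ⟨α, hα⟩ := h.dv t c0
  obtain ⟨α', hα'⟩ := h.dv t' c0
  rw [h.h1.symm] at hα hα'
  push_cast at hα hα'
  let z1 := α' • t + α • t'
  have him : ∀ z, b1 (i (c0 + μ z1)) z = b1 (i c0) z + 2 * b1 z1 z := by
    intro z
    rw [map_add, h.h1.badd, h.im, h.h1.bsmul]; rfl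
  have hπ : π (μ z1) ∈ P := (g.memP _).2 ⟨z1, rfl⟩
  have hq1 : Q (π (c0 + μ z1)) = 1 := by
    rw [map_add, hQ.add, hc1, g.Q0P _ hπ, hcr]; decide
  obtain ⟨z, hz⟩ := LBase.caseA_aux h.h1 h.h2 h.mi h.qm h.bm h.dv h.qi (c0 + μ z1) (k0 + c0) w
    (z2odd.1 (by rw [← g.Qp, hq1]))
    (fun x => z2even.1 (by rw [← g.Bp, map_add, map_add, AddMonoidHom.add_apply, hcr,
      g.radP _ hπ, add_zero]))
    (z2even.1 (by rw [← g.Qp, map_add, hQ.add, hkQ, hc1, hkc]; decide))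
    (fun hh => by
      rw [← z2even, ← g.Bp, map_add, map_add, AddMonoidHom.add_apply, hcr, add_zero] at hh
      exact hkl hh) t t' ht ht' htt'
    (by
      rw [him, hα]
      simp only [z1]
      rw [h.h1.badd, h.h1.bsmul, h.h1.bsmul, h.h1.self, h.h1.symm t' t]
      obtain ⟨o, ho⟩ : ∃ o, b1 t t' = 2 * o + 1 := ⟨b1 t t' / 2, by omega⟩
      rw [ho]
      exact ⟨α + α' * q1 t + α * o, by ring⟩)
    (by
      rw [him, hα']
      simp only [z1]
      rw [h.h1.badd, h.h1.bsmul, h.h1.bsmul, h.h1.self]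
      obtain ⟨o, ho⟩ : ∃ o, b1 t t' = 2 * o + 1 := ⟨b1 t t' / 2, by omega⟩
      rw [ho]
      exact ⟨α' + α * q1 t' + α' * o, by ring⟩) e he E
  refine hcon ⟨_, ?_, hz⟩
  rw [← g.memN, map_add, map_add]
  intro hh
  apply hcN
  have h1 := N.sub_mem (N.sub_mem hh (g.PN ((g.memP _).2 ⟨z, rfl⟩))) (g.PN hπ)
  simpa using h1
end

section
theorem loc_functional {n : ℕ} {X : Type} [AddCommGroup X] {π : X →+ (Fin n → ZMod 2)}
    (hs : Function.Surjective π) (hk : ∀ x, π x = 0 ↔ ∃ y, x = (2 : ℤ) • y) (f : X → ℤ)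
    (hf : ∀ x y, f (x + y) = f x + f y) :
    ∃ φ : (Fin n → ZMod 2) →+ ZMod 2, ∀ x, φ (π x) = f x := by
  let F : X →+ ZMod 2 := AddMonoidHom.mk' (fun x => (f x : ZMod 2))
    (by intro a b; simp only [hf]; push_cast; rfl)
  have h1 : ∀ x, F (Function.surjInv hs (π x)) = F x := by
    intro x
    obtain ⟨y, hy⟩ := (hk (Function.surjInv hs (π x) - x)).1
      (by rw [map_sub, Function.surjInv_eq hs, sub_self])
    rw [← sub_eq_zero, ← map_sub, hy, map_zsmul]
    generalize F y = t
    revert t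
    decide
  refine ⟨AddMonoidHom.mk' (fun u => F (Function.surjInv hs u)) ?_, h1⟩
  intro u v
  obtain ⟨u, rfl⟩ := hs u
  obtain ⟨v, rfl⟩ := hs v
  rw [← map_add, h1, h1, h1, map_add]

theorem LBase.caseB_even {L0 L1 L2 : Type} [AddCommGroup L0]
    [AddCommGroup L1]
    [AddCommGroup L2]
    {q0 : L0 → ℤ} {b0 : L0 → L0 → ℤ} {q1 : L1 → ℤ} {b1 : L1 → L1 → ℤ}
    {q2 : L2 → ℤ} {b2 : L2 → L2 → ℤ}
    {i : L2 →+ L1} {μ : L1 →+ L2} {ν : L0 →+ L2} (h : LBase 2 q0 b0 q1 b1 q2 b2 i μ ν)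
    {n : ℕ} (hn : 5 ≤ n) {π Q B P N} (g : LU 2 n q2 b2 μ ν π Q B P N) (e : ℤ)
    (he : ¬ (2 : ℤ) ∣ e) (E : ℕ)
    (hN : ∀ k ∈ N, ∀ l ∈ N, B k l = 0)
    (hcon : ¬ ∃ v, (¬ ∃ y, v = ν y) ∧ (2 : ℤ) ^ E ∣ q2 v - e) : ∀ x y, B x y = 0 := by
  have hQ := g.hQ
  have he1 : (e : ZMod 2) = 1 := z2odd.2 he
  have fin : ∀ v, v ∉ N → Q v = 1 → ∀ w, B v w = 0 := by
    intro v hv hq w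
    by_contra hw
    obtain ⟨x, hx, hx2⟩ := LBase.lift h.h2 g.hs g.hk g.Qp g.Bp e E v w (by rw [hq, he1]) hw
    refine hcon ⟨x, ?_, hx2⟩
    rwa [← g.memN, hx]
  have hdN : Module.finrank (ZMod 2) N ≤ 3 := by
    have hd := g.dimP
    have h1 : Module.finrank (ZMod 2) N ≤ Module.finrank (ZMod 2) P + 1 := by
      obtain ⟨k, hk, hk1⟩ := g.unN 1 (by decide)
      have : N ≤ P ⊔ Submodule.span (ZMod 2) {k} := by
        intro x hx
        rcases z2 (Q x) with h0 | h1
        · exact Submodule.mem_sup_left (g.anN x hx h0)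
        · have : x - k ∈ P := by
            apply g.anN _ (N.sub_mem hx hk)
            have h2 := hQ.add (x - k) k
            rw [sub_add_cancel, h1, hk1, hN _ (N.sub_mem hx hk) k hk] at h2
            linear_combination -h2
          have := Submodule.add_mem _ (Submodule.mem_sup_left (T := Submodule.span (ZMod 2) {k}) this)
            (Submodule.mem_sup_right (S := P) (Submodule.mem_span_singleton_self k))
          simpa using this
      have h3 := Submodule.finrank_mono this
      have h1 := Submodule.finrank_add_le_finrank_add_finrank P (Submodule.span (ZMod 2) {k})
      have h2 : Module.finrank (ZMod 2) (Submodule.span (ZMod 2) {k}) ≤ 1 := by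
        simpa using finrank_span_le_card (R := ZMod 2) ({k} : Set (Fin n → ZMod 2))
      omega
    omega
  have hkrad : ∀ k ∈ N, Q k = 1 → ∀ w, B k w = 0 := by
    intro k hk hk1 w
    by_contra hw
    have hwk : B w k ≠ 0 := by rwa [hQ.symm]
    have hwN : w ∉ N := fun hh => hw (hN k hk w hh)
    have hw0 : Q w = 0 := by
      by_contra h0
      exact hwk (fin w hwN (z2ne h0) k)
    obtain ⟨u, huN, hku⟩ : ∃ u, u ∉ N ∧ B k u = 0 := by
      let f := (B k).toZModLinearMap 2
      have h1 := LinearMap.finrank_range_add_finrank_ker f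
      have h2 : Module.finrank (ZMod 2) (LinearMap.range f) ≤ 1 := by
        simpa using Submodule.finrank_le (LinearMap.range f)
      simp only [Module.finrank_fintype_fun_eq_card, Fintype.card_fin] at h1
      by_contra hc
      push Not at hc
      have h3 : LinearMap.ker f ≤ N := by
        intro c hcc
        by_contra hcP
        exact hc c hcP hcc
      have := Submodule.finrank_mono h3
      omega
    have hall : ∀ u, u ∉ N → B k u = 0 → Q u = 0 := by
      intro u huN hku
      by_contra h0
      have h1 := z2ne h0
      have hr := fin u huN h1
      have hwu : B (u + w) k ≠ 0 := by
        rw [map_add, AddMonoidHom.add_apply, hr, zero_add]; exact hwk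
      have h2 : Q (u + w) = 1 := by
        rw [hQ.add, h1, hw0, hr]; decide
      exact hwu (fin (u + w) (fun hh => hwu (hN _ hh k hk)) h2 k)
    have h1 := hall u huN hku
    have h2 := hall (u + k) (fun hh => huN (by simpa using N.sub_mem hh hk)) (by
      rw [map_add, hku, hN k hk k hk, add_zero])
    rw [hQ.add, h1, hk1, hQ.symm, hku] at h2
    revert h2
    decide
  have hrad : ∀ v, Q v = 1 → ∀ w, B v w = 0 := by
    intro v hv w
    by_cases hvN : v ∈ N
    · exact hkrad v hvN hv w
    · exact fin v hvN hv w
  intro x y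
  by_contra hxy
  have hx : Q x = 0 := by
    by_contra h0
    exact hxy (hrad x (z2ne h0) y)
  have hy : Q y = 0 := by
    by_contra h0
    exact hxy (by rw [hQ.symm]; exact hrad y (z2ne h0) x)
  have h1 : Q (x + y) = 1 := by
    rw [hQ.add, hx, hy, z2ne hxy]; decide
  have h2 := hrad _ h1 y
  rw [map_add, AddMonoidHom.add_apply, hQ.self, hy] at h2
  apply hxy
  simpa using h2

theorem loc_odd_sq {a e : ℤ} (ha : ¬ (2 : ℤ) ∣ a) (h8 : (8 : ℤ) ∣ a - e) (E : ℕ) :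
    ∃ t : ℤ, ¬ (2 : ℤ) ∣ t ∧ (2 : ℤ) ^ E ∣ t ^ 2 * a - e := by
  have hc : IsCoprime a ((2 : ℤ) ^ (E + 3)) := by
    apply IsCoprime.pow_right
    rw [isCoprime_comm]
    exact Int.prime_two.coprime_iff_not_dvd.mpr ha
  obtain ⟨u, v, huv⟩ := hc
  obtain ⟨k, hk⟩ := h8
  have h1 : (8 : ℤ) ∣ e * u - 1 := by
    refine ⟨- (k * u) - v * 2 ^ E, ?_⟩
    rw [pow_add] at huv
    linear_combination huv - u * hk
  obtain ⟨t, ht, w, hw⟩ := loc_sqrt h1 E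
  refine ⟨t, ht, a * w - e * v * 8, ?_⟩
  rw [pow_add] at huv
  linear_combination a * hw + e * huv
end

section
theorem LBase.caseB {L0 L1 L2 : Type} [AddCommGroup L0]
    [AddCommGroup L1]
    [AddCommGroup L2]
    {q0 : L0 → ℤ} {b0 : L0 → L0 → ℤ} {q1 : L1 → ℤ} {b1 : L1 → L1 → ℤ}
    {q : L2 → ℤ} {b2 : L2 → L2 → ℤ}
    {i : L2 →+ L1} {μ : L1 →+ L2} {ν : L0 →+ L2} (h : LBase 2 q0 b0 q1 b1 q b2 i μ ν)
    {n : ℕ} (hn : 5 ≤ n) {π Q B P N} (g : LU 2 n q b2 μ ν π Q B P N) (e : ℤ)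
    (he : ¬ (2 : ℤ) ∣ e) (E : ℕ)
    (hN : ∀ k ∈ N, ∀ l ∈ N, B k l = 0)
    (hcon : ¬ ∃ v, (¬ ∃ y, v = ν y) ∧ (2 : ℤ) ^ E ∣ q v - e) : False := by
  have hB := LBase.caseB_even h hn g e he E hN hcon
  have hQ := g.hQ
  have hq := h.h2
  have hb : ∀ x y, ∃ k, b2 x y = 2 * k := by
    intro x y
    have := hB (π x) (π y)
    rw [g.Bp] at this
    exact z2even.1 this
  choose be hbe using hb
  have beadd : ∀ x y z, be x (y + z) = be x y + be x z := by
    intro x y z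
    have h1 := hq.addb x y z
    simp only [hbe] at h1
    linarith
  have badd : ∀ x y z, be (x + y) z = be x z + be y z := by
    intro x y z
    have h1 := hq.badd x y z
    simp only [hbe] at h1
    linarith
  have bsub : ∀ x y z, be (x - y) z = be x z - be y z := by
    intro x y z
    have := badd (x - y) y z
    rw [sub_add_cancel] at this
    linarith
  have bsymm : ∀ x y, be x y = be y x := by
    intro x y
    have h1 := hq.symm x y
    simp only [hbe] at h1
    linarith
  have bself : ∀ x, be x x = q x := by
    intro x
    have h1 := hq.self x
    simp only [hbe] at h1
    linarith
  have qadd : ∀ x y, q (x + y) = q x + q y + 2 * be x y := by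
    intro x y
    rw [hq.add, hbe]
  have qtwo : ∀ x y, q (x + (2 : ℤ) • y) = q x + 4 * q y + 4 * be x y := by
    intro x y
    rw [hq.line, hbe]; ring
  have b2z : ∀ x z, be x ((2 : ℤ) • z) = 2 * be x z := by
    intro x z
    rw [two_smul, beadd]; ring
  have F8 : ∀ y, π y ∉ N → ¬ (8 : ℤ) ∣ q y - e := by
    intro y hy h8
    have hodd : ¬ (2 : ℤ) ∣ q y := by omega
    obtain ⟨t, ht, hte⟩ := loc_odd_sq hodd h8 E
    refine hcon ⟨t • y, ?_, by rw [hq.smul]; exact hte⟩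
    rw [← g.memN]
    have : π (t • y) = π y := by
      rw [← sub_eq_zero, ← map_sub, g.hk]
      refine ⟨((t - 1) / 2) • y, ?_⟩
      have h2 : t = 2 * ((t - 1) / 2) + 1 := by omega
      push_cast
      rw [smul_smul]
      nth_rewrite 1 [h2]
      rw [add_smul, one_smul, add_sub_cancel_right]
    rwa [this]
  have pi2 : ∀ y z, π (y + (2 : ℤ) • z) = π y := by
    intro y z
    rw [map_add, (g.hk ((2 : ℤ) • z)).2 ⟨z, rfl⟩, add_zero]
  have S : ∀ y, π y ∉ N → (4 : ℤ) ∣ q y - e → ∀ z, (2 : ℤ) ∣ be y z + q z := by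
    intro y hy h4 z
    have h1 := F8 y hy
    have h2 := F8 (y + (2 : ℤ) • z) (by rwa [pi2])
    rw [qtwo] at h2
    omega
  have PQ : ∀ x, π x ∈ P → (4 : ℤ) ∣ q x → π x = 0 := by
    intro x hx h4
    obtain ⟨z, rfl⟩ := (g.memP x).1 hx
    rw [h.qm] at h4
    obtain ⟨w, rfl⟩ := h.an1 z (by push_cast at h4 ⊢; omega)
    rw [h.mi, g.hk]
    exact ⟨w, rfl⟩
  have NP : ∀ x, π x ∈ N → (2 : ℤ) ∣ q x → π x ∈ P := by
    intro x hx h2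
    apply g.anN _ hx
    rw [g.Qp]
    exact z2even.2 h2
  have dat : ∀ a : ℤ, ∃ v, π v ∈ N ∧ (8 : ℤ) ∣ q v - a := by
    intro a
    obtain ⟨y, hy⟩ := h.univ a 3
    refine ⟨ν y, (g.memN _).2 ⟨y, rfl⟩, ?_⟩
    rw [h.qn]
    norm_num at hy
    exact hy
  obtain ⟨v0, hv0N, hv0⟩ := dat e
  obtain ⟨φQ, hφQ⟩ : ∃ φ : (Fin n → ZMod 2) →+ ZMod 2, ∀ x, φ (π x) = q x :=
    ⟨AddMonoidHom.mk' Q (fun x y => by rw [hQ.add, hB, add_zero]), g.Qp⟩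
  by_cases hy : ∃ y, π y ∉ N ∧ (4 : ℤ) ∣ q y - e
  · obtain ⟨y, hyN, hy4⟩ := hy
    have hch := S y hyN hy4
    obtain ⟨x, hx⟩ : ∃ x, x = y - v0 := ⟨_, rfl⟩
    have hxv : x + v0 = y := by rw [hx, sub_add_cancel]
    have hbx : ∀ z, be x z = be y z - be v0 z := by
      intro z; rw [hx, bsub]
    have hbxv : (2 : ℤ) ∣ be x v0 := by
      rw [hbx, bself]
      have := hch v0
      omega
    have hqx : (4 : ℤ) ∣ q x := by
      have := qadd x v0
      rw [hxv] at this
      omega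
    have hxN : π x ∉ N := by
      intro hh
      apply hyN
      rw [← hxv, map_add]
      exact N.add_mem hh hv0N
    have M : ∀ f, (4 : ℤ) ∣ q f → (π (x + f) ∈ P) ∨ ∀ z, (2 : ℤ) ∣ be f z := by
      intro f hf
      have h1 := hch f
      have h2 := qadd y f
      by_cases hyf : π (y + f) ∈ N
      · left
        apply NP
        · have : x + f = y + f - v0 := by rw [hx]; abel
          rw [this, map_sub]
          exact N.sub_mem hyf hv0N
        · have h3 := qadd x f
          omega
      · right
        intro z
        have h3 := S _ hyf (by omega) z
        have h4 := hch z
        rw [badd] at h3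
        omega
    have ns : ∃ w, (2 : ℤ) ∣ q w ∧ ¬ (2 : ℤ) ∣ be x w := by
      obtain ⟨v1, hv1N, hv1⟩ := dat (5 * e)
      obtain ⟨s, hs⟩ : ∃ s, s = v1 - v0 := ⟨_, rfl⟩
      have hsv : v0 + s = v1 := by rw [hs]; abel
      have h1 := qadd v0 s
      rw [hsv] at h1
      have hsE : (2 : ℤ) ∣ q s := by omega
      have hsN : π s ∈ N := by rw [hs, map_sub]; exact N.sub_mem hv1N hv0N
      have hsP := NP s hsN hsE
      by_cases h0 : π s = 0
      · obtain ⟨z, hz⟩ := (g.hk s).1 h0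
        push_cast at hz
        have h2 : q s = 4 * q z := by rw [hz, hq.smul]; ring
        have h3 : be v0 s = 2 * be v0 z := by rw [hz, b2z]
        have h4 := hch z
        have h5 : ¬ (2 : ℤ) ∣ be x z := by
          rw [hbx]; omega
        by_cases hz2 : (2 : ℤ) ∣ q z
        · exact ⟨z, hz2, h5⟩
        · refine ⟨z + v0, ?_, ?_⟩
          · rw [qadd]; omega
          · rw [beadd]; omega
      · have h2 : ¬ (4 : ℤ) ∣ q s := fun hh => h0 (PQ s hsP hh)
        refine ⟨s, hsE, ?_⟩
        have h4 := hch s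
        rw [hbx]; omega
    obtain ⟨w, hw4, hxw⟩ : ∃ w, (4 : ℤ) ∣ q w ∧ ¬ (2 : ℤ) ∣ be x w := by
      obtain ⟨w, hw, hxw⟩ := ns
      by_cases h4 : (4 : ℤ) ∣ q w
      · exact ⟨w, h4, hxw⟩
      · refine ⟨w + x, ?_, ?_⟩
        · rw [qadd, bsymm w x]; omega
        · rw [beadd, bself]; omega
    have hwP : π (x + w) ∈ P := by
      rcases M w hw4 with h1 | h1
      · exact h1
      · exact absurd (h1 x) (by rwa [bsymm])
    obtain ⟨φx, hφx⟩ := loc_functional g.hs g.hk (be x) (beadd x)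
    obtain ⟨φw, hφw⟩ := loc_functional g.hs g.hk (be w) (beadd w)
    have key : ∀ u, π u ≠ 0 → (2 : ℤ) ∣ q u → (2 : ℤ) ∣ be x u → (2 : ℤ) ∣ be w u →
        π (x + u) ∈ P := by
      intro u hu0 hqu hxu hwu
      by_cases h4 : (4 : ℤ) ∣ q u
      · exfalso
        rcases M (x + u) (by rw [qadd]; omega) with h1 | h1
        · have : π (x + (x + u)) = π u := by
            rw [← add_assoc, ← two_zsmul, add_comm, pi2]
          rw [this] at h1
          exact hu0 (PQ u h1 h4)
        · have h2 := h1 w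
          rw [badd, bsymm u w] at h2
          omega
      · rcases M (x + w + u) (by rw [qadd, qadd, badd]; omega) with h1 | h1
        · have : π (x + (x + w + u)) = π (w + u) := by
            rw [add_assoc, ← add_assoc, ← two_zsmul, add_comm, pi2]
          rw [this] at h1
          have h2 := P.add_mem hwP h1
          rw [← map_add] at h2
          have : π (x + w + (w + u)) = π (x + u) := by
            have : x + w + (w + u) = x + u + (2 : ℤ) • w := by rw [two_zsmul]; abel
            rw [this, pi2]
          rwa [this] at h2
        · have h2 := h1 w
          rw [badd, badd, bsymm u w, bself] at h2
          omega
    let f : (Fin n → ZMod 2) →+ (Fin 3 → ZMod 2) := AddMonoidHom.mk'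
      (fun c => ![φQ c, φx c, φw c]) (by
        intro a b
        ext j
        fin_cases j <;> simp)
    let F := f.toZModLinearMap 2
    have h1 := LinearMap.finrank_range_add_finrank_ker F
    have h2 : Module.finrank (ZMod 2) (LinearMap.range F) ≤ 3 := by
      simpa using Submodule.finrank_le (LinearMap.range F)
    simp only [Module.finrank_fintype_fun_eq_card, Fintype.card_fin] at h1
    have h3 : 2 ≤ Module.finrank (ZMod 2) (LinearMap.ker F) := by omega
    have kk : ∀ u, π u ∈ LinearMap.ker F → π u ≠ 0 → π (x + u) ∈ P := by
      intro u hu hu0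
      have hu2 : f (π u) = 0 := hu
      have a0 : φQ (π u) = 0 := congrFun hu2 0
      have a1 : φx (π u) = 0 := congrFun hu2 1
      have a2 : φw (π u) = 0 := congrFun hu2 2
      rw [hφQ, z2even] at a0
      rw [hφx, z2even] at a1
      rw [hφw, z2even] at a2
      exact key u hu0 a0 a1 a2
    obtain ⟨v, hv⟩ := exists_linearIndependent_of_le_finrank h3
    rw [Fintype.linearIndependent_iff] at hv
    obtain ⟨u, hu⟩ := g.hs (v 0)
    obtain ⟨u', hu'⟩ := g.hs (v 1)
    have k1 := kk u (by rw [hu]; exact (v 0).2) (by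
      intro hh
      have := hv ![1, 0] (by rw [hu] at hh; simpa using hh) 0
      simp at this)
    have k2 := kk u' (by rw [hu']; exact (v 1).2) (by
      intro hh
      have := hv ![0, 1] (by rw [hu'] at hh; simpa using hh) 1
      simp at this)
    have k3 := kk (u + u') (by rw [map_add, hu, hu']; exact (v 0 + v 1).2) (by
      intro hh
      have := hv ![1, 1] (by rw [map_add, hu, hu'] at hh; simp; exact Subtype.ext hh) 0
      simp at this)
    have k4 := P.add_mem (P.add_mem k1 k2) k3
    rw [← map_add, ← map_add] at k4
    have : x + u + (x + u') + (x + (u + u')) = x + (2 : ℤ) • (x + u + u') := by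
      rw [two_zsmul]; abel
    rw [this, pi2] at k4
    exact hxN (g.PN k4)
  · push Not at hy
    have hP2 : ∀ f, (2 : ℤ) ∣ q f → (4 : ℤ) ∣ q f + 2 * be v0 f → π f ∈ P := by
      intro f hf h4
      by_cases hvf : π (v0 + f) ∈ N
      · apply NP f _ hf
        have : f = v0 + f - v0 := by abel
        rw [this, map_sub]
        exact N.sub_mem hvf hv0N
      · exfalso
        apply hy _ hvf
        rw [qadd]; omega
    obtain ⟨v2, hv2N, hv2⟩ := dat (e + 2)
    obtain ⟨κ, hκ⟩ : ∃ κ, κ = v2 - v0 := ⟨_, rfl⟩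
    have hκv : v0 + κ = v2 := by rw [hκ]; abel
    have hκq := qadd v0 κ
    rw [hκv] at hκq
    have hκ2 : (2 : ℤ) ∣ q κ := by omega
    have hκP : π κ ∈ P := NP κ (by rw [hκ, map_sub]; exact N.sub_mem hv2N hv0N) hκ2
    have hκ4 : ¬ (4 : ℤ) ∣ q κ + 2 * be v0 κ := by omega
    have hd := g.dimP
    have dimE : 4 ≤ Module.finrank (ZMod 2) (LinearMap.ker (φQ.toZModLinearMap 2)) := by
      have h1 := LinearMap.finrank_range_add_finrank_ker (φQ.toZModLinearMap 2)
      have h2 : Module.finrank (ZMod 2) (LinearMap.range (φQ.toZModLinearMap 2)) ≤ 1 := by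
        simpa using Submodule.finrank_le (LinearMap.range (φQ.toZModLinearMap 2))
      simp only [Module.finrank_fintype_fun_eq_card, Fintype.card_fin] at h1
      omega
    have pick : ∀ R : Submodule (ZMod 2) (Fin n → ZMod 2), Module.finrank (ZMod 2) R ≤ 3 →
        ∃ c, (2 : ℤ) ∣ q c ∧ π c ∉ R := by
      intro R hR
      by_contra hc
      push Not at hc
      have : LinearMap.ker (φQ.toZModLinearMap 2) ≤ R := by
        intro c hcc
        obtain ⟨c, rfl⟩ := g.hs c
        apply hc
        have : φQ (π c) = 0 := hcc
        rwa [hφQ, z2even] at this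
      have := Submodule.finrank_mono this
      omega
    obtain ⟨c, hc2, hcP⟩ := pick P (by omega)
    obtain ⟨d, hd2, hdP⟩ := pick (P ⊔ Submodule.span (ZMod 2) {π c}) (by
      have h1 := Submodule.finrank_add_le_finrank_add_finrank P (Submodule.span (ZMod 2) {π c})
      have h2 : Module.finrank (ZMod 2) (Submodule.span (ZMod 2) {π c}) ≤ 1 := by
        simpa using finrank_span_le_card (R := ZMod 2) ({π c} : Set (Fin n → ZMod 2))
      omega)
    have hcS : π c ∈ P ⊔ Submodule.span (ZMod 2) {π c} :=
      Submodule.mem_sup_right (Submodule.mem_span_singleton_self _)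
    have hPS : ∀ x ∈ P, x ∈ P ⊔ Submodule.span (ZMod 2) {π c} :=
      fun x hx => Submodule.mem_sup_left hx
    have : Fact (Nat.Prime 2) := ⟨Nat.prime_two⟩
    have n1 : ¬ (4 : ℤ) ∣ q c + 2 * be v0 c := fun hh => hcP (hP2 c hc2 hh)
    have n2 : ¬ (4 : ℤ) ∣ q d + 2 * be v0 d := fun hh => hdP (hPS _ (hP2 d hd2 hh))
    have n3 : ¬ (4 : ℤ) ∣ q (κ + c) + 2 * be v0 (κ + c) := by
      intro hh
      have h1 := hP2 (κ + c) (by rw [qadd]; omega) hh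
      rw [map_add] at h1
      exact hcP (by simpa using P.sub_mem h1 hκP)
    have n4 : ¬ (4 : ℤ) ∣ q (κ + d) + 2 * be v0 (κ + d) := by
      intro hh
      have h1 := hP2 (κ + d) (by rw [qadd]; omega) hh
      rw [map_add] at h1
      exact hdP (hPS _ (by simpa using P.sub_mem h1 hκP))
    have n5 : ¬ (4 : ℤ) ∣ q (c + d) + 2 * be v0 (c + d) := by
      intro hh
      have h1 := hP2 (c + d) (by rw [qadd]; omega) hh
      rw [map_add] at h1
      exact hdP (by simpa using Submodule.sub_mem _ (hPS _ h1) hcS)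
    have n6 : ¬ (4 : ℤ) ∣ q (κ + c + d) + 2 * be v0 (κ + c + d) := by
      intro hh
      have h1 := hP2 (κ + c + d) (by rw [qadd, qadd]; omega) hh
      rw [map_add, map_add] at h1
      have h2 := Submodule.sub_mem _ (Submodule.sub_mem _ (hPS _ h1) (hPS _ hκP)) hcS
      apply hdP
      convert h2 using 1
      abel
    rw [qadd, beadd] at n3 n4 n5
    rw [qadd, qadd, badd, beadd, beadd] at n6
    omega

theorem LBase.all {p : ℕ} [Fact p.Prime] {L0 L1 L2 : Type} [AddCommGroup L0]
    [AddCommGroup L1]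
    [AddCommGroup L2] [Module.Free ℤ L2] [Module.Finite ℤ L2]
    {q0 : L0 → ℤ} {b0 : L0 → L0 → ℤ} {q1 : L1 → ℤ} {b1 : L1 → L1 → ℤ}
    {q2 : L2 → ℤ} {b2 : L2 → L2 → ℤ}
    {i : L2 →+ L1} {μ : L1 →+ L2} {ν : L0 →+ L2} (h : LBase p q0 b0 q1 b1 q2 b2 i μ ν)
    (hn : 5 ≤ Module.finrank ℤ L2) (e : ℤ) (he : ¬ (p : ℤ) ∣ e) (E : ℕ) :
    ∃ v, (¬ ∃ y, v = ν y) ∧ (p : ℤ) ^ E ∣ q2 v - e := by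
  by_cases hp : p = 2
  · subst hp
    obtain ⟨π, Q, B, P, N, g⟩ := h.toLU rfl
    by_cases hN : ∃ k ∈ N, ∃ l ∈ N, B k l ≠ 0
    · exact LBase.caseA h hn g e he E hN
    · push Not at hN
      by_contra hcon
      exact LBase.caseB h hn g e he E hN hcon
  · exact LBase.odd hp h hn e he E
end

section
theorem IsQ.div {M : Type} [AddCommGroup M] {q : M → ℤ} {b : M → M → ℤ} (h : IsQ q b) {p : ℤ}
    (hp : p ≠ 0) (hn : ∀ v, p ∣ q v → ∀ w, p ∣ b v w) :
    ∃ L : Submodule ℤ M, (∀ x, x ∈ L ↔ p ∣ q x) ∧ ∃ (q1 : L → ℤ) (b1 : L → L → ℤ), IsQ q1 b1 ∧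
      (∀ x : L, q x = p * q1 x) ∧ (∀ x y : L, b x y = p * b1 x y) := by
  let L : Submodule ℤ M :=
    { carrier := {x | p ∣ q x}
      add_mem' := by
        intro x y hx hy
        change p ∣ q (x + y)
        rw [h.add]
        exact dvd_add (dvd_add hx hy) (hn x hx y)
      zero_mem' := by change p ∣ q 0; rw [h.zero]; exact dvd_zero _
      smul_mem' := by
        intro t x hx
        change p ∣ q (t • x)
        rw [h.smul]
        exact Dvd.dvd.mul_left hx _ }
  have hq : ∀ x : L, ∃ k, q x = p * k := fun x => x.2
  have hb : ∀ x y : L, ∃ k, b x y = p * k := fun x y => hn x x.2 y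
  choose q1 hq1 using hq
  choose b1 hb1 using hb
  refine ⟨L, fun x => Iff.rfl, q1, b1, ⟨?_, ?_, ?_⟩, hq1, hb1⟩
  · intro x y
    apply mul_left_cancel₀ hp
    rw [← hq1, mul_add, mul_add, ← hq1, ← hq1, ← hb1]
    exact h.add x y
  · intro t x
    apply mul_left_cancel₀ hp
    rw [← hq1]
    have := h.smul t x
    rw [hq1] at this
    rw [Submodule.coe_smul, this]; ring
  · intro x y z
    apply mul_left_cancel₀ hp
    rw [← hb1, mul_add, ← hb1, ← hb1]
    exact h.badd x y z

theorem loc_rank {M : Type} [AddCommGroup M] [Module.Free ℤ M] [Module.Finite ℤ M]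
    (L : Submodule ℤ M) {p : ℤ} (hp : p ≠ 0) (h : ∀ x, p • x ∈ L) :
    Module.finrank ℤ M ≤ Module.finrank ℤ L := by
  let f : M →ₗ[ℤ] L := LinearMap.codRestrict L (p • LinearMap.id) h
  apply LinearMap.finrank_le_finrank_of_injective (f := f)
  intro x y hxy
  have h1 := congrArg Subtype.val hxy
  have h2 : p • x = p • y := h1
  exact smul_right_injective M hp h2

theorem loc_main {p : ℕ} [Fact p.Prime] (j : ℕ) : ∀ (M : Type) [AddCommGroup M] [Module.Free ℤ M]
    [Module.Finite ℤ M] (q : M → ℤ) (b : M → M → ℤ), IsQ q b → 5 ≤ Module.finrank ℤ M →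
    (∀ (a : ℤ) (E : ℕ), ∃ y : M, (p : ℤ) ^ E ∣ q y - a) →
    ∀ a : ℤ, (p : ℤ) ^ j ∣ a → ¬ (p : ℤ) ^ (j + 1) ∣ a → ∀ E : ℕ,
    ∃ x : M, (¬ ∃ y : M, x = (p : ℤ) • y) ∧ (p : ℤ) ^ E ∣ q x - a := by
  have hp0 : (p : ℤ) ≠ 0 := by exact_mod_cast (Fact.out : p.Prime).ne_zero
  induction j with
  | zero =>
    intro M _ _ _ q b h hr hu a _ ha E
    obtain ⟨y, hy⟩ := hu a (E + 1)
    refine ⟨y, ?_, (pow_dvd_pow _ (by omega)).trans hy⟩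
    rintro ⟨z, rfl⟩
    apply ha
    have h1 : (p : ℤ) ^ 1 ∣ q ((p : ℤ) • z) - a := (pow_dvd_pow _ (by omega)).trans hy
    rw [h.smul] at h1
    have h2 : (p : ℤ) ^ 1 ∣ (p : ℤ) ^ 2 * q z := Dvd.dvd.mul_right (pow_dvd_pow _ (by omega)) _
    rw [zero_add]
    simpa using dvd_sub h2 h1
  | succ j ih =>
    intro M _ _ _ q b h hr hu a ha1 ha2 E
    by_cases hj0 : j = 0
    · subst hj0
      obtain ⟨y, hy⟩ := hu a (E + 2)
      refine ⟨y, ?_, (pow_dvd_pow _ (by omega)).trans hy⟩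
      rintro ⟨z, rfl⟩
      apply ha2
      have h1 : (p : ℤ) ^ 2 ∣ q ((p : ℤ) • z) - a := (pow_dvd_pow _ (by omega)).trans hy
      rw [h.smul] at h1
      have h2 : (p : ℤ) ^ 2 ∣ (p : ℤ) ^ 2 * q z := Dvd.intro _ rfl
      simpa using dvd_sub h2 h1
    have hpa : (p : ℤ) ∣ a := (dvd_pow_self _ (by omega)).trans ha1
    by_cases hns : ∀ v, (p : ℤ) ∣ q v → ∀ w, (p : ℤ) ∣ b v w
    swap
    · push Not at hns
      obtain ⟨v, ⟨k, hv⟩, w, hw⟩ := hns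
      obtain ⟨a', rfl⟩ := hpa
      obtain ⟨r, m, hr⟩ := loc_hensel (Fact.out : p.Prime) (α := b v w) (β := p * q w) hw
        (Dvd.intro _ rfl) (a' - k) E
      refine ⟨v + ((p : ℤ) * r) • w, ?_, p * m, ?_⟩
      · rintro ⟨y, hy⟩
        apply hw
        have : v = (p : ℤ) • (y - r • w) := by
          rw [smul_sub, ← hy, smul_smul]; abel
        rw [this, h.bsmul]
        exact Dvd.intro _ rfl
      · rw [h.line]
        linear_combination hv + p * hr
    obtain ⟨L, hL, q1, b1, h1, hq1, hb1⟩ := h.div hp0 hns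
    have hpL : ∀ x, (p : ℤ) • x ∈ L := by
      intro x
      rw [hL, h.smul]
      exact ⟨p * q x, by ring⟩
    have hrL := hr.trans (loc_rank L hp0 hpL)
    have huL : ∀ (a : ℤ) (E : ℕ), ∃ y, (p : ℤ) ^ E ∣ q1 y - a := by
      intro a E
      obtain ⟨y, k, hy⟩ := hu (p * a) (E + 1)
      have hyL : y ∈ L := by
        rw [hL]
        refine ⟨a + p ^ E * k, ?_⟩
        rw [pow_succ] at hy
        linear_combination hy
      refine ⟨⟨y, hyL⟩, k, ?_⟩
      apply mul_left_cancel₀ hp0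
      have := hq1 ⟨y, hyL⟩
      rw [mul_sub, ← this]
      rw [pow_succ] at hy
      linear_combination hy
    obtain ⟨a', rfl⟩ := hpa
    by_cases hj1 : j = 1
    · subst hj1
      obtain ⟨e, rfl⟩ : (p : ℤ) ∣ a' := by
        obtain ⟨k, hk⟩ := ha1
        refine ⟨k, ?_⟩
        apply mul_left_cancel₀ hp0
        linear_combination hk
      have he : ¬ (p : ℤ) ∣ e := by
        rintro ⟨k, rfl⟩
        apply ha2
        exact ⟨k, by ring⟩
      by_cases hns1 : ∀ v, (p : ℤ) ∣ q1 v → ∀ w, (p : ℤ) ∣ b1 v w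
      swap
      · push Not at hns1
        obtain ⟨v, ⟨k, hv⟩, w, hw⟩ := hns1
        obtain ⟨r, m, hr⟩ := loc_hensel (Fact.out : p.Prime) (α := b1 v w) (β := p * q1 w) hw
          (Dvd.intro _ rfl) (e - k) E
        refine ⟨v + ((p : ℤ) * r) • w, ?_, p ^ 2 * m, ?_⟩
        · rintro ⟨y, hy⟩
          apply hw
          have e1 : (v : M) = (p : ℤ) • (y - r • (w : M)) := by
            rw [smul_sub, ← hy, smul_smul]; abel
          have e2 := hb1 v w
          rw [e1, h.bsmul] at e2
          have e3 := mul_left_cancel₀ hp0 e2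
          rw [← e3, h.symm]
          exact hns w ((hL _).1 w.2) _
        · rw [h.line, hq1, hq1, hb1]
          linear_combination p * hv + p ^ 2 * hr
      obtain ⟨L2, hL2, q2, b2, h2, hq2, hb2⟩ := h1.div hp0 hns1
      have hpL2 : ∀ x, (p : ℤ) • x ∈ L2 := by
        intro x
        rw [hL2, h1.smul]
        exact ⟨p * q1 x, by ring⟩
      have hrL2 := hrL.trans (loc_rank L2 hp0 hpL2)
      let μ : L →ₗ[ℤ] L2 := LinearMap.codRestrict L2 ((p : ℤ) • LinearMap.id) hpL2
      have hμ : ∀ z : L, ((μ z : L2) : L) = (p : ℤ) • z := fun z => rfl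
      let ν1 : M →ₗ[ℤ] L := LinearMap.codRestrict L ((p : ℤ) • LinearMap.id) hpL
      have hν1c : ∀ z, ((ν1 z : L) : M) = (p : ℤ) • z := fun z => rfl
      have hν1 : ∀ z, q1 (ν1 z) = p * q z := by
        intro z
        apply mul_left_cancel₀ hp0
        rw [← hq1, hν1c, h.smul]; ring
      let ν : M →ₗ[ℤ] L2 := LinearMap.codRestrict L2 ν1 (by
        intro x
        rw [hL2, hν1]
        exact Dvd.intro _ rfl)
      have hν : ∀ z, ((ν z : L2) : L) = ν1 z := fun z => rfl
      have hb : LBase p q b q1 b1 q2 b2 L2.subtype.toAddMonoidHom μ.toAddMonoidHom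
          ν.toAddMonoidHom := by
        refine ⟨h, h1, h2, ?_, ?_, ?_, ?_, ?_, ?_, ?_, ?_, ?_, ?_, hu⟩
        · intro x; exact Subtype.ext rfl
        · intro z; rfl
        · intro z
          apply mul_left_cancel₀ hp0
          change (p : ℤ) * q2 (μ z) = _
          rw [← hq2, hμ, h1.smul]; ring
        · intro z x
          apply mul_left_cancel₀ hp0
          change (p : ℤ) * b2 (μ z) x = p * b1 z x
          rw [← hb2, hμ, h1.bsmul]
        · intro z x
          rw [h1.symm]
          exact hns1 _ ((hL2 _).1 x.2) z
        · intro x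
          exact hq2 x
        · intro z hz
          exact ⟨⟨z, (hL2 z).2 hz⟩, rfl⟩
        · intro y
          apply mul_left_cancel₀ hp0
          change (p : ℤ) * q2 (ν y) = _
          rw [← hq2, hν, hν1]
        · intro y hy
          exact ⟨⟨y, (hL y).2 hy⟩, Subtype.ext (Subtype.ext rfl)⟩
        · intro z
          exact ⟨z, Subtype.ext (Subtype.ext rfl)⟩
      obtain ⟨v, hv, k, hv2⟩ := hb.all hrL2 e he E
      refine ⟨((v : L) : M), ?_, p ^ 2 * k, ?_⟩
      · rintro ⟨y, hy⟩
        exact hv ⟨y, Subtype.ext (Subtype.ext hy)⟩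
      · rw [hq1, hq2]
        linear_combination p ^ 2 * hv2
    · obtain ⟨x, hx, k, hk⟩ := ih L q1 b1 h1 hrL huL a' (by
        obtain ⟨k, hk⟩ := ha1
        refine ⟨k, ?_⟩
        apply mul_left_cancel₀ hp0
        rw [pow_succ] at hk
        linear_combination hk) (by
        rintro ⟨k, rfl⟩
        apply ha2
        exact ⟨k, by ring⟩) (E + 2)
      refine ⟨x, ?_, p ^ 3 * k, ?_⟩
      · rintro ⟨y, hy⟩
        have e1 : (p : ℤ) ^ 2 ∣ q1 x := by
          have e2 : (p : ℤ) ^ 2 ∣ a' := by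
            have : (p : ℤ) ^ 3 ∣ p * a' := (pow_dvd_pow _ (by omega)).trans ha1
            obtain ⟨k, hk⟩ := this
            refine ⟨k, ?_⟩
            apply mul_left_cancel₀ hp0
            linear_combination hk
          have e3 : (p : ℤ) ^ 2 ∣ q1 x - a' := ⟨p ^ E * k, by rw [hk]; ring⟩
          simpa using dvd_add e3 e2
        obtain ⟨m, hm⟩ := e1
        have e4 := hq1 x
        rw [hy, h.smul, hm] at e4
        have hyL : y ∈ L := by
          rw [hL]
          refine ⟨m, ?_⟩
          apply mul_left_cancel₀ (pow_ne_zero 2 hp0)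
          linear_combination e4
        exact hx ⟨⟨y, hyL⟩, Subtype.ext hy⟩
      · rw [hq1]
        linear_combination p * hk

theorem local_lemma {p : ℕ} (hp : p.Prime) {n : ℕ} (hn : 5 ≤ n) {q : (Fin n → ℤ) → ℤ}
    {b : (Fin n → ℤ) → (Fin n → ℤ) → ℤ} (h : IsQ q b)
    (hu : ∀ (a : ℤ) (E : ℕ), ∃ y, (p : ℤ) ^ E ∣ q y - a) (a : ℤ) (E : ℕ) :
    ∃ x : Fin n → ℤ, (∃ i, ¬ (p : ℤ) ∣ x i) ∧ (p : ℤ) ^ E ∣ q x - a := by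
  have : Fact p.Prime := ⟨hp⟩
  have hp0 : (p : ℤ) ≠ 0 := by exact_mod_cast hp.ne_zero
  obtain ⟨a', ha', haa⟩ : ∃ a', a' ≠ 0 ∧ (p : ℤ) ^ E ∣ a' - a := by
    by_cases h0 : a = 0
    · refine ⟨p ^ E, pow_ne_zero _ hp0, by simp [h0]⟩
    · exact ⟨a, h0, by simp⟩
  have hf : FiniteMultiplicity (p : ℤ) a' :=
    Int.finiteMultiplicity_iff.2 ⟨by simpa using hp.one_lt.ne', ha'⟩
  obtain ⟨x, hx, hx2⟩ := loc_main (p := p) (multiplicity (p : ℤ) a') (Fin n → ℤ) q b h (by simpa) hu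
    a' (pow_multiplicity_dvd _ _) (hf.not_pow_dvd_of_multiplicity_lt (Nat.lt_succ_self _)) E
  refine ⟨x, ?_, by simpa using dvd_add hx2 haa⟩
  by_contra hc
  push Not at hc
  choose k hk using hc
  exact hx ⟨k, by ext i; simp [hk]⟩
end

section
theorem gs_card (k x : ℕ) [NeZero k] :
    (Finset.univ.filter fun l : ZMod k => (x : ZMod k) * l = 0).card ≤ Nat.gcd k x := by
  have hk : 0 < k := Nat.pos_of_ne_zero (NeZero.ne k)
  have hg : 0 < Nat.gcd k x := Nat.gcd_pos_of_pos_left _ hk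
  obtain ⟨k', hk'⟩ := Nat.gcd_dvd_left k x
  have hk'0 : 0 < k' := by
    rcases Nat.eq_zero_or_pos k' with h | h
    · rw [h] at hk'; omega
    · exact h
  have key : ∀ l ∈ (Finset.univ.filter fun l : ZMod k => (x : ZMod k) * l = 0), k' ∣ l.val := by
    intro l hl
    simp only [Finset.mem_filter, Finset.mem_univ, true_and] at hl
    have h1 : ((x * l.val : ℕ) : ZMod k) = 0 := by push_cast; rw [ZMod.natCast_zmod_val]; exact hl
    rw [ZMod.natCast_eq_zero_iff] at h1
    have h2 := (Nat.Coprime.dvd_mul_left (Nat.coprime_div_gcd_div_gcd hg)).1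
      (show k / Nat.gcd k x ∣ x / Nat.gcd k x * l.val by
        apply Nat.dvd_of_mul_dvd_mul_left hg
        rw [Nat.mul_div_cancel' (Nat.gcd_dvd_left k x), ← mul_assoc,
          Nat.mul_div_cancel' (Nat.gcd_dvd_right k x)]
        exact h1)
    have : k / Nat.gcd k x = k' := Nat.div_eq_of_eq_mul_right hg hk'
    rwa [this] at h2
  calc _ ≤ (Finset.range (Nat.gcd k x)).card := by
        apply Finset.card_le_card_of_injOn (fun l => l.val / k')
        · intro l hl
          simp only [Finset.coe_range, Set.mem_Iio]
          rw [Nat.div_lt_iff_lt_mul hk'0, ← hk']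
          exact ZMod.val_lt l
        · intro l hl l' hl' hll
          have h1 := key l hl
          have h2 := key l' hl'
          apply ZMod.val_injective
          rw [← Nat.div_mul_cancel h1, ← Nat.div_mul_cancel h2]
          simp only at hll
          rw [hll]
    _ = _ := Finset.card_range _

theorem gs_normsq (k : ℕ) [NeZero k] (α β : ZMod k) :
    ‖∑ r : ZMod k, ZMod.stdAddChar (α * r ^ 2 + β * r)‖ ^ 2 ≤
      k * (Finset.univ.filter fun l : ZMod k => (2 * α) * l = 0).card := by
  have h1 : ((‖∑ r : ZMod k, ZMod.stdAddChar (α * r ^ 2 + β * r)‖ ^ 2 : ℝ) : ℂ) =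
      ∑ l : ZMod k, ZMod.stdAddChar (α * l ^ 2 + β * l) *
        (if (2 * α) * l = 0 then (k : ℂ) else 0) := by
    push_cast
    rw [← Complex.mul_conj', map_sum, Finset.sum_mul_sum, Finset.sum_comm]
    have h2 : ∀ s : ZMod k, ∑ r : ZMod k, ZMod.stdAddChar (α * r ^ 2 + β * r) *
        (starRingEnd ℂ) (ZMod.stdAddChar (α * s ^ 2 + β * s)) =
        ∑ l : ZMod k, ZMod.stdAddChar (α * l ^ 2 + β * l) * ZMod.stdAddChar (s * (2 * α * l)) := by
      intro s
      rw [← Equiv.sum_comp (Equiv.addRight s)]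
      apply Finset.sum_congr rfl
      intro l _
      rw [← AddChar.map_neg_eq_conj, ← AddChar.map_add_eq_mul, ← AddChar.map_add_eq_mul]
      congr 1
      simp only [Equiv.coe_addRight]
      ring
    rw [Finset.sum_congr rfl fun s _ => h2 s, Finset.sum_comm]
    apply Finset.sum_congr rfl
    intro l _
    rw [← Finset.mul_sum, AddChar.sum_mulShift _ (ZMod.isPrimitive_stdAddChar k)]
    simp [ZMod.card]
  have h3 : ‖((‖∑ r : ZMod k, ZMod.stdAddChar (α * r ^ 2 + β * r)‖ ^ 2 : ℝ) : ℂ)‖ =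
    ‖∑ r : ZMod k, ZMod.stdAddChar (α * r ^ 2 + β * r)‖ ^ 2 := by
    rw [Complex.norm_real, Real.norm_eq_abs, abs_of_nonneg (by positivity)]
  rw [← h3, h1]
  refine (norm_sum_le _ _).trans ?_
  have h4 : ∀ l : ZMod k, ‖ZMod.stdAddChar (α * l ^ 2 + β * l) *
        (if (2 * α) * l = 0 then (k : ℂ) else 0)‖ = if (2 * α) * l = 0 then (k : ℝ) else 0 := by
    intro l
    rw [norm_mul, AddChar.norm_apply, one_mul]
    split_ifs <;> simp
  rw [Finset.sum_congr rfl fun l _ => h4 l, ← Finset.sum_filter]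
  simp [mul_comm]

theorem gs_bound (k : ℕ) [NeZero k] (x : ℕ) (h : ℤ) (hh : IsCoprime h k) (α β : ZMod k)
    (hα : 2 * α = h * x) :
    ‖∑ r : ZMod k, ZMod.stdAddChar (α * r ^ 2 + β * r)‖ ^ 2 ≤ k * Nat.gcd k x := by
  refine (gs_normsq k α β).trans ?_
  have hu : IsUnit (h : ZMod k) := (ZMod.coe_int_isUnit_iff_isCoprime h k).2 hh.symm
  have : (Finset.univ.filter fun l : ZMod k => (2 * α) * l = 0) =
    (Finset.univ.filter fun l : ZMod k => (x : ZMod k) * l = 0) := by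
    ext l
    simp only [Finset.mem_filter, Finset.mem_univ, true_and]
    rw [hα, mul_assoc, hu.mul_right_eq_zero]
  rw [this]
  have := gs_card k x
  gcongr
end

section
noncomputable def gG (k : ℕ) (h : ℤ) (d m : ℕ) (c : ℤ) : ℂ :=
  ∑ r ∈ Finset.range k,
    Complex.exp (2 * Real.pi * Complex.I * ((h * d * (c + m * (r : ℤ)) ^ 2 : ℤ) : ℂ) / k)

theorem sum_range_zmod (k : ℕ) [NeZero k] (F : ZMod k → ℂ) :
    ∑ r ∈ Finset.range k, F (r : ZMod k) = ∑ r : ZMod k, F r := by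
  refine Finset.sum_bij' (fun r _ => (r : ZMod k)) (fun r _ => r.val) ?_ ?_ ?_ ?_ ?_
  · intros; simp
  · intro r _; simpa using ZMod.val_lt r
  · intro r hr; exact ZMod.val_cast_of_lt (by simpa using hr)
  · intro r _; simp
  · intros; rfl

theorem gG_zmod (k : ℕ) [NeZero k] (h : ℤ) (d m : ℕ) (c : ℤ) :
    gG k h d m c = ∑ r : ZMod k, ZMod.stdAddChar ((h : ZMod k) * (d : ZMod k) * ((c : ZMod k) + (m : ZMod k) * r) ^ 2) := by
  rw [← sum_range_zmod k (fun r => ZMod.stdAddChar ((h : ZMod k) * (d : ZMod k) * ((c : ZMod k) + (m : ZMod k) * r) ^ 2))]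
  unfold gG
  apply Finset.sum_congr rfl
  intro r _
  rw [← ZMod.stdAddChar_coe]
  push_cast
  rfl

theorem gG_norm (k : ℕ) (hk : k ≠ 0) (h : ℤ) (hh : IsCoprime h k) (d m : ℕ) (c : ℤ) :
    ‖gG k h d m c‖ ^ 2 ≤ k * Nat.gcd k (2 * d * m ^ 2) := by
  have : NeZero k := ⟨hk⟩
  rw [gG_zmod]
  have h1 : ∀ r : ZMod k, ZMod.stdAddChar ((h : ZMod k) * (d : ZMod k) * ((c : ZMod k) + (m : ZMod k) * r) ^ 2) =
      ZMod.stdAddChar ((h : ZMod k) * (d : ZMod k) * (c : ZMod k) ^ 2) *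
        ZMod.stdAddChar (((h : ZMod k) * (d : ZMod k) * (m : ZMod k) ^ 2) * r ^ 2 + (2 * (h : ZMod k) * (d : ZMod k) * (c : ZMod k) * (m : ZMod k)) * r) := by
    intro r
    rw [← AddChar.map_add_eq_mul]
    congr 1
    ring
  rw [Finset.sum_congr rfl fun r _ => h1 r, ← Finset.mul_sum, norm_mul, AddChar.norm_apply, one_mul]
  apply gs_bound k _ h hh
  push_cast
  ring

theorem gG_eval (k : ℕ) (h : ℤ) (d m : ℕ) (c : ℤ)
    (h1 : (k : ℤ) ∣ 2 * d * c * m) (h2 : (k : ℤ) ∣ d * m ^ 2) :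
    gG k h d m c = k * Complex.exp (2 * Real.pi * Complex.I * ((h * d * c ^ 2 : ℤ) : ℂ) / k) := by
  rcases Nat.eq_zero_or_pos k with rfl | hk
  · simp [gG]
  have : NeZero k := ⟨hk.ne'⟩
  rw [gG_zmod, ← ZMod.stdAddChar_coe]
  have e1 : ((2 * d * c * m : ℤ) : ZMod k) = 0 := (ZMod.intCast_zmod_eq_zero_iff_dvd _ _).2 h1
  have e2 : ((d * m ^ 2 : ℤ) : ZMod k) = 0 := (ZMod.intCast_zmod_eq_zero_iff_dvd _ _).2 h2
  push_cast at e1 e2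
  have h3 : ∀ r : ZMod k, ZMod.stdAddChar ((h : ZMod k) * (d : ZMod k) * ((c : ZMod k) + (m : ZMod k) * r) ^ 2) =
      ZMod.stdAddChar (((h * d * c ^ 2 : ℤ) : ZMod k)) := by
    intro r
    congr 1
    push_cast
    linear_combination h * r * e1 + h * r ^ 2 * e2
  rw [Finset.sum_congr rfl fun r _ => h3 r]
  simp [ZMod.card]

theorem gG_zero (k q l : ℕ) (hk : k ≠ 0) (hkl : k = q * l) (h : ℤ) (hh : IsCoprime h k)
    (d m : ℕ) (c : ℤ) (h1 : (q : ℤ) ∣ d * m ^ 2) (h2 : ¬ (q : ℤ) ∣ 2 * d * c * m) :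
    gG k h d m c = 0 := by
  have : NeZero k := ⟨hk⟩
  have hl : (l : ℤ) ≠ 0 := by rintro h; apply hk; rw [hkl]; simp_all
  rw [gG_zmod]
  have e2 : ((d * m ^ 2 * l : ℤ) : ZMod k) = 0 := by
    rw [ZMod.intCast_zmod_eq_zero_iff_dvd, hkl]; push_cast; exact mul_dvd_mul_right h1 _
  push_cast at e2
  set S := ∑ r : ZMod k, ZMod.stdAddChar ((h : ZMod k) * (d : ZMod k) * ((c : ZMod k) + (m : ZMod k) * r) ^ 2) with hS
  set w : ℂ := ZMod.stdAddChar (((h * (2 * d * c * m * l) : ℤ) : ZMod k)) with hw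
  have hw1 : w ≠ 1 := by
    intro h0
    rw [hw, ← AddChar.map_zero_eq_one (ZMod.stdAddChar (N := k))] at h0
    have h3 := ZMod.injective_stdAddChar h0
    rw [ZMod.intCast_zmod_eq_zero_iff_dvd] at h3
    have h4 := hh.symm.dvd_of_dvd_mul_left h3
    rw [hkl] at h4
    push_cast at h4
    exact h2 (Int.dvd_of_mul_dvd_mul_right hl h4)
  have h5 : S = w * S := by
    conv_lhs => rw [hS, ← Equiv.sum_comp (Equiv.addRight (l : ZMod k))]
    rw [hS, Finset.mul_sum]
    apply Finset.sum_congr rfl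
    intro r _
    rw [hw, ← AddChar.map_add_eq_mul]
    congr 1
    simp only [Equiv.coe_addRight]
    push_cast
    linear_combination (2 * h * r + h * l) * e2
  have : (w - 1) * S = 0 := by linear_combination -h5
  rcases mul_eq_zero.1 this with h | h
  · exact absurd (sub_eq_zero.1 h) hw1
  · exact h

noncomputable def sA {n : ℕ} (d : Fin n → ℕ) (m : ℕ) (c : Fin n → ℤ) (A : ℤ) (k : ℕ) : ℂ :=
  ∑ h ∈ (Finset.range k).filter (fun h => k.Coprime h),
    (∏ i, (gG k h (d i) m (c i) / k)) * Complex.exp (-(2 * Real.pi * Complex.I * A * h / k))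

theorem sA_norm {n : ℕ} (hn : 5 ≤ n) (d : Fin n → ℕ) (m : ℕ) (c : Fin n → ℤ) (A : ℤ) (k : ℕ)
    (B : ℝ) (hB1 : B ≤ 1)
    (hB : ∀ h : ℕ, k.Coprime h → ∀ i, ‖gG k h (d i) m (c i) / k‖ ≤ B) :
    ‖sA d m c A k‖ ≤ k.totient * B ^ 5 := by
  unfold sA
  refine (norm_sum_le _ _).trans ?_
  rw [Nat.totient_eq_card_coprime, ← nsmul_eq_mul]
  apply Finset.sum_le_card_nsmul
  intro h hh
  simp only [Finset.mem_filter] at hh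
  have hB0 : 0 ≤ B := (norm_nonneg _).trans (hB h hh.2 ⟨0, by omega⟩)
  rw [norm_mul, norm_prod]
  have h1 : ‖Complex.exp (-(2 * Real.pi * Complex.I * A * h / k))‖ = 1 := by
    have : -(2 * Real.pi * Complex.I * A * h / k) =
      ((-(2 * Real.pi * A * h / k) : ℝ) : ℂ) * Complex.I := by push_cast; ring
    rw [this, Complex.norm_exp_ofReal_mul_I]
  rw [h1, mul_one]
  calc _ ≤ ∏ i : Fin n, B := Finset.prod_le_prod (fun _ _ => norm_nonneg _) fun i _ => hB h hh.2 i
    _ = B ^ n := by simp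
    _ ≤ B ^ 5 := pow_le_pow_of_le_one hB0 hB1 hn

theorem gG_div_norm (k : ℕ) (hk : k ≠ 0) (h : ℕ) (hh : k.Coprime h) (d m : ℕ) (c : ℤ) :
    ‖gG k h d m c / k‖ ≤ Real.sqrt (Nat.gcd k (2 * d * m ^ 2) / k) := by
  have h0 : IsCoprime (h : ℤ) k := Nat.isCoprime_iff_coprime.2 hh.symm
  have h1 := gG_norm k hk h h0 d m c
  have hk' : (0 : ℝ) < k := by positivity
  apply Real.le_sqrt_of_sq_le
  rw [norm_div, div_pow, Complex.norm_natCast, div_le_div_iff₀ (by positivity) hk']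
  nlinarith
end

section
theorem sA_van {n : ℕ} (d : Fin n → ℕ) (m : ℕ) (hm : m ≠ 0) (c : Fin n → ℤ) (A : ℤ) (k : ℕ)
    (hk : k ≠ 0) (g : ℕ) (hg : g ≠ 0) (p : ℕ) (hp : p.Prime) (hgp : g * p ∣ m)
    (i : Fin n) (hi : ¬ ((p ^ (g.factorization p + 1) : ℕ) : ℤ) ∣ 2 * d i * c i)
    (hpk : p ∣ k / Nat.gcd k (m * g)) : sA d m c A k = 0 := by
  have hgcd : Nat.gcd k (m * g) ≠ 0 := Nat.gcd_ne_zero_left hk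
  have hmg : m * g ≠ 0 := mul_ne_zero hm hg
  have h1 : m.factorization p + g.factorization p + 1 ≤ k.factorization p := by
    obtain ⟨l, hl⟩ := Nat.gcd_dvd_left k (m * g)
    have h2 : k / Nat.gcd k (m * g) = l := Nat.div_eq_of_eq_mul_right (Nat.pos_of_ne_zero hgcd) hl
    rw [h2] at hpk
    have hl0 : l ≠ 0 := by rintro rfl; simp at hl; omega
    have h3 : 1 ≤ l.factorization p := (hp.dvd_iff_one_le_factorization hl0).1 hpk
    have h4 : k.factorization p = (Nat.gcd k (m * g)).factorization p + l.factorization p := by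
      conv_lhs => rw [hl, Nat.factorization_mul hgcd hl0]
      rfl
    rw [Nat.factorization_gcd hk hmg] at h4
    have h5 : (m * g).factorization p = m.factorization p + g.factorization p := by
      rw [Nat.factorization_mul hm hg]; rfl
    rw [Finsupp.inf_apply, h5] at h4
    rcases le_total (k.factorization p) (m.factorization p + g.factorization p) with h | h
    · rw [inf_eq_left.2 h] at h4; omega
    · rw [inf_eq_right.2 h] at h4; omega
  have h2 : g.factorization p + 1 ≤ m.factorization p := by
    have := (Nat.factorization_le_iff_dvd (mul_ne_zero hg hp.ne_zero) hm).2 hgp p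
    rw [Nat.factorization_mul hg hp.ne_zero] at this
    simpa [hp.factorization_self] using this
  set e := g.factorization p
  set M := m.factorization p
  obtain ⟨l, hl⟩ := (hp.pow_dvd_iff_le_factorization hk).2 h1
  unfold sA
  apply Finset.sum_eq_zero
  intro h hh
  simp only [Finset.mem_filter] at hh
  have h0 : IsCoprime (h : ℤ) k := Nat.isCoprime_iff_coprime.2 hh.2.symm
  have hz := gG_zero k _ l hk hl h h0 (d i) m (c i) ?_ ?_
  · rw [Finset.prod_eq_zero (Finset.mem_univ i) (by rw [hz, zero_div]), zero_mul]
  · apply Dvd.dvd.mul_left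
    have h3 : p ^ M ∣ m := Nat.ordProj_dvd m p
    have h4 : p ^ (M + e + 1) ∣ m ^ 2 := by
      refine (pow_dvd_pow p (show M + e + 1 ≤ M * 2 by omega)).trans ?_
      rw [pow_mul]
      exact pow_dvd_pow_of_dvd h3 2
    exact_mod_cast h4
  · intro hq
    apply hi
    obtain ⟨m0, hm0⟩ := Nat.ordProj_dvd m p
    have hcop : ¬ p ∣ m0 := by
      intro h
      have : p ^ (M + 1) ∣ m := by
        rw [hm0, pow_succ]; exact mul_dvd_mul_left _ h
      have := (hp.pow_dvd_iff_le_factorization hm).1 this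
      omega
    have hpM : ((p : ℤ) ^ M) ≠ 0 := pow_ne_zero _ (by exact_mod_cast hp.ne_zero)
    rw [hm0] at hq
    push_cast at hq ⊢
    have h6 : (p : ℤ) ^ M * (p : ℤ) ^ (e + 1) ∣ (p : ℤ) ^ M * (m0 * (2 * d i * c i)) := by
      convert hq using 1
      · ring
      · ring
    have h7 := Int.dvd_of_mul_dvd_mul_left hpM h6
    have h8 : IsCoprime ((p : ℤ) ^ (e + 1)) (m0 : ℤ) := by
      apply IsCoprime.pow_left
      rw [Nat.isCoprime_iff_coprime]
      exact (Nat.Prime.coprime_iff_not_dvd hp).2 hcop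
    exact h8.dvd_of_dvd_mul_left h7

theorem sA_one {n : ℕ} (d : Fin n → ℕ) (m : ℕ) (c : Fin n → ℤ) (A : ℤ) (k : ℕ) (g : ℕ)
    (hgm : g ∣ m) (hg1 : ∀ i, (g : ℤ) ∣ 2 * d i * c i) (hk : k ∣ m * g)
    (hA : ((m * g : ℕ) : ℤ) ∣ (∑ i, d i * c i ^ 2) - A) : sA d m c A k = k.totient := by
  rcases Nat.eq_zero_or_pos k with rfl | hk0
  · simp [sA]
  have hk' : (k : ℤ) ∣ m * g := by exact_mod_cast hk
  have hkC : (k : ℂ) ≠ 0 := by exact_mod_cast hk0.ne'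
  unfold sA
  have h1 : ∀ h ∈ (Finset.range k).filter (fun h => k.Coprime h),
      (∏ i, (gG k h (d i) m (c i) / k)) * Complex.exp (-(2 * Real.pi * Complex.I * A * h / k))
        = 1 := by
    intro h _
    have h2 : ∀ i, gG k h (d i) m (c i) / k =
        Complex.exp (2 * Real.pi * Complex.I * (((h : ℤ) * d i * c i ^ 2 : ℤ) : ℂ) / k) := by
      intro i
      rw [gG_eval]
      · field_simp
      · refine hk'.trans ?_
        rw [mul_comm (m : ℤ)]
        exact mul_dvd_mul_right (hg1 i) _
      · refine hk'.trans ?_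
        apply Dvd.dvd.mul_left
        rw [pow_two]
        apply mul_dvd_mul_left
        exact_mod_cast hgm
    rw [Finset.prod_congr rfl fun i _ => h2 i, ← Complex.exp_sum, ← Complex.exp_add]
    obtain ⟨t, ht⟩ := (show (k : ℤ) ∣ (∑ i, d i * c i ^ 2) - A from hk'.trans (by exact_mod_cast hA))
    rw [Complex.exp_eq_one_iff]
    refine ⟨h * t, ?_⟩
    have ht' : (∑ i, (d i : ℂ) * (c i : ℂ) ^ 2) - A = k * t := by exact_mod_cast ht
    have h3 : ∑ i, 2 * (Real.pi : ℂ) * Complex.I * (((h : ℤ) * d i * c i ^ 2 : ℤ) : ℂ) / k =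
        2 * Real.pi * Complex.I * h / k * ∑ i, (d i : ℂ) * (c i : ℂ) ^ 2 := by
      rw [Finset.mul_sum]
      apply Finset.sum_congr rfl
      intro i _
      push_cast
      ring
    rw [h3, eq_add_of_sub_eq ht']
    push_cast
    field_simp
    ring
  rw [Finset.sum_congr rfl h1, Nat.totient_eq_card_coprime]
  simp

theorem sA_main {n : ℕ} (hn : 5 ≤ n) (d : Fin n → ℕ) (m : ℕ) (hm : m ≠ 0)
    (hd : ∀ i, 2 * d i ∣ m) (c : Fin n → ℤ) (A : ℤ) (g : ℕ)
    (hg : g ≠ 0) (hgm : g ∣ m) (hg1 : ∀ i, (g : ℤ) ∣ 2 * d i * c i)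
    (hg2 : ∀ p : ℕ, p.Prime → p ∣ m → g * p ∣ m ∧
      ∃ i, ¬ ((p ^ (g.factorization p + 1) : ℕ) : ℤ) ∣ 2 * d i * c i)
    (P : ℕ) (hP : ∀ p : ℕ, p.Prime → p ≤ P → p ∣ m)
    (hPs : ∀ t : Finset ℕ, (∀ k ∈ t, P < k) → ∑ k ∈ t, (1 / Real.sqrt k) ^ 3 ≤ 1 / 4) (K : ℕ) :
    ∑ k ∈ Finset.range (K + 1), ‖sA d m c A k‖ ≤ (m * g : ℕ) * (5 / 4) ∧
    (m * g ≤ K → ((m * g : ℕ) : ℤ) ∣ (∑ i, d i * c i ^ 2) - A →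
      ‖∑ k ∈ Finset.range (K + 1), sA d m c A k - (m * g : ℕ)‖ ≤ (m * g : ℕ) * (1 / 4)) := by
  have hmg : m * g ≠ 0 := mul_ne_zero hm hg
  set N := m * g with hN
  have hcop : ∀ k, k ≠ 0 → sA d m c A k ≠ 0 → Nat.Coprime (k / Nat.gcd k N) m := by
    intro k hk h0
    rw [Nat.coprime_iff_gcd_eq_one]
    by_contra hne
    obtain ⟨p, hp, hpd⟩ := Nat.exists_prime_and_dvd hne
    obtain ⟨h1, i, hi⟩ := hg2 p hp (hpd.trans (Nat.gcd_dvd_right _ _))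
    exact h0 (sA_van d m hm c A k hk g hg p hp h1 i hi (hpd.trans (Nat.gcd_dvd_left _ _)))
  have hbd : ∀ k, k ≠ 0 → sA d m c A k ≠ 0 → ‖sA d m c A k‖ ≤
      (Nat.gcd k N).totient * (1 / Real.sqrt ((k / Nat.gcd k N : ℕ) : ℝ)) ^ 3 := by
    intro k hk h0
    have hc := hcop k hk h0
    have hdv := Nat.gcd_dvd_left k N
    have hdN := Nat.gcd_dvd_right k N
    obtain ⟨k2, hk2⟩ := hdv
    have hg0 : Nat.gcd k N ≠ 0 := Nat.gcd_ne_zero_left hk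
    have e2 : k / Nat.gcd k N = k2 := Nat.div_eq_of_eq_mul_right (Nat.pos_of_ne_zero hg0) hk2
    rw [e2] at hc ⊢
    generalize Nat.gcd k N = k1 at hk2 hg0 hdN
    have hk20 : k2 ≠ 0 := by rintro rfl; simp at hk2; omega
    have hk2R : (0 : ℝ) < k2 := by positivity
    have hk2R1 : (1 : ℝ) ≤ k2 := by exact_mod_cast Nat.one_le_iff_ne_zero.2 hk20
    have hs1 : 1 ≤ Real.sqrt k2 := Real.one_le_sqrt.2 hk2R1
    have hs : Real.sqrt k2 ^ 2 = k2 := Real.sq_sqrt hk2R.le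
    have hcop12 : Nat.Coprime k1 k2 := by
      apply Nat.Coprime.symm
      apply Nat.Coprime.coprime_dvd_right hdN
      rw [hN]
      exact Nat.Coprime.mul_right hc (Nat.Coprime.coprime_dvd_right hgm hc)
    have h3 := sA_norm hn d m c A k (1 / Real.sqrt k2) (by
      rw [div_le_one (by positivity)]; exact hs1) ?_
    · refine h3.trans ?_
      rw [hk2, Nat.totient_mul hcop12]
      have h4 : (k2.totient : ℝ) ≤ Real.sqrt k2 ^ 2 := by
        rw [hs]; exact_mod_cast Nat.totient_le k2
      have h5 : (1 / Real.sqrt k2) ^ 5 * Real.sqrt k2 ^ 2 = (1 / Real.sqrt k2) ^ 3 := by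
        field_simp
      rw [← h5]
      push_cast
      have : 0 ≤ (k1.totient : ℝ) := by positivity
      have h6 : 0 ≤ (1 / Real.sqrt k2) ^ 5 := by positivity
      calc (k1.totient : ℝ) * k2.totient * (1 / Real.sqrt k2) ^ 5
          = k1.totient * ((1 / Real.sqrt k2) ^ 5 * k2.totient) := by ring
        _ ≤ _ := by gcongr
    · intro h hh i
      refine (gG_div_norm k hk h hh (d i) m (c i)).trans ?_
      rw [← Real.sqrt_one, ← Real.sqrt_div zero_le_one]
      apply Real.sqrt_le_sqrt
      have h7 : Nat.gcd k (2 * d i * m ^ 2) ∣ k1 := by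
        have h8 : Nat.Coprime (2 * d i * m ^ 2) k2 := by
          apply Nat.Coprime.symm
          exact Nat.Coprime.mul_right (Nat.Coprime.coprime_dvd_right (hd i) hc)
            (Nat.Coprime.pow_right 2 hc)
        have h9 : Nat.Coprime (Nat.gcd k (2 * d i * m ^ 2)) k2 :=
          Nat.Coprime.coprime_dvd_left (Nat.gcd_dvd_right _ _) h8
        apply h9.dvd_of_dvd_mul_right
        rw [← hk2]
        exact Nat.gcd_dvd_left _ _
      have h10 : ((Nat.gcd k (2 * d i * m ^ 2) : ℕ) : ℝ) ≤ k1 := by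
        exact_mod_cast Nat.le_of_dvd (Nat.pos_of_ne_zero hg0) h7
      rw [hk2] at h10 ⊢
      push_cast at h10 ⊢
      have : (0 : ℝ) < k1 := by positivity
      rw [div_le_div_iff₀ (by positivity) hk2R]
      nlinarith
  set R := Finset.range (K + 1)
  set R1 := R.filter (fun k => k ∣ N)
  set R2 := R.filter (fun k => ¬ k ∣ N)
  have hR2 : ∑ k ∈ R2, ‖sA d m c A k‖ ≤ N * (1 / 4) := by
    set T := R2.filter (fun k => k ≠ 0 ∧ sA d m c A k ≠ 0)
    have h1 : ∑ k ∈ R2, ‖sA d m c A k‖ = ∑ k ∈ T, ‖sA d m c A k‖ := by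
      symm
      apply Finset.sum_subset (Finset.filter_subset _ _)
      intro k hk hkT
      simp only [Finset.mem_filter, not_and, not_not] at hkT
      by_cases h0 : k = 0
      · subst h0; simp [sA]
      · rw [hkT hk h0, norm_zero]
    set f : ℕ × ℕ → ℝ := fun x => x.1.totient * (1 / Real.sqrt (x.2 : ℝ)) ^ 3
    set π : ℕ → ℕ × ℕ := fun k => (Nat.gcd k N, k / Nat.gcd k N)
    set U := (Finset.range (K + 1)).filter (fun k => P < k)
    have hinj : Set.InjOn π T := by
      intro x _ y _ hxy
      simp only [π, Prod.mk.injEq] at hxy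
      rw [← Nat.mul_div_cancel' (Nat.gcd_dvd_left x N), ← Nat.mul_div_cancel' (Nat.gcd_dvd_left y N),
        hxy.2, hxy.1]
    have hsub : T.image π ⊆ N.divisors ×ˢ U := by
      intro x hx
      obtain ⟨k, hk, rfl⟩ := Finset.mem_image.1 hx
      simp only [T, R2, R, Finset.mem_filter, Finset.mem_range] at hk
      simp only [π, U, Finset.mem_product, Nat.mem_divisors, Finset.mem_filter, Finset.mem_range]
      refine ⟨⟨Nat.gcd_dvd_right _ _, hmg⟩, ?_, ?_⟩
      · exact lt_of_le_of_lt (Nat.div_le_self _ _) hk.1.1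
      · have hc := hcop k hk.2.1 hk.2.2
        have hne : k / Nat.gcd k N ≠ 1 := by
          intro h
          apply hk.1.2
          have := Nat.mul_div_cancel' (Nat.gcd_dvd_left k N)
          rw [h, mul_one] at this
          rw [← this]
          exact Nat.gcd_dvd_right _ _
        have hne0 : k / Nat.gcd k N ≠ 0 := by
          intro h
          have := Nat.mul_div_cancel' (Nat.gcd_dvd_left k N)
          rw [h, mul_zero] at this
          exact hk.2.1 this.symm
        obtain ⟨p, hp, hpd⟩ := Nat.exists_prime_and_dvd hne
        by_contra hle
        have hpP : p ≤ P := (Nat.le_of_dvd (Nat.pos_of_ne_zero hne0) hpd).trans (not_lt.1 hle)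
        have := Nat.dvd_gcd hpd (hP p hp hpP)
        rw [hc] at this
        exact hp.one_lt.ne' (Nat.dvd_one.1 this)
    rw [h1]
    calc ∑ k ∈ T, ‖sA d m c A k‖ ≤ ∑ k ∈ T, f (π k) := by
          apply Finset.sum_le_sum
          intro k hk
          simp only [T, Finset.mem_filter] at hk
          exact hbd k hk.2.1 hk.2.2
      _ = ∑ x ∈ T.image π, f x := (Finset.sum_image hinj).symm
      _ ≤ ∑ x ∈ N.divisors ×ˢ U, f x := by
          apply Finset.sum_le_sum_of_subset_of_nonneg hsub
          intro x _ _
          positivity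
      _ = (∑ k ∈ N.divisors, (k.totient : ℝ)) * ∑ k ∈ U, (1 / Real.sqrt k) ^ 3 := by
          rw [Finset.sum_product, Finset.sum_mul_sum]
      _ ≤ N * (1 / 4) := by
          have h2 : ∑ k ∈ N.divisors, (k.totient : ℝ) = N := by
            exact_mod_cast Nat.sum_totient N
          rw [h2]
          apply mul_le_mul_of_nonneg_left _ (by positivity)
          apply hPs
          intro k hk
          exact (Finset.mem_filter.1 hk).2
  have hR1 : ∑ k ∈ R1, ‖sA d m c A k‖ ≤ N := by
    calc ∑ k ∈ R1, ‖sA d m c A k‖ ≤ ∑ k ∈ R1, (k.totient : ℝ) := by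
          apply Finset.sum_le_sum
          intro k hk
          simp only [R1, Finset.mem_filter] at hk
          by_cases h0 : k = 0
          · subst h0; simp [sA]
          by_cases h1 : sA d m c A k = 0
          · rw [h1, norm_zero]; positivity
          refine (hbd k h0 h1).trans ?_
          rw [Nat.gcd_eq_left hk.2, Nat.div_self (Nat.pos_of_ne_zero h0)]
          simp
      _ ≤ ∑ k ∈ N.divisors, (k.totient : ℝ) := by
          apply Finset.sum_le_sum_of_subset_of_nonneg
          · intro k hk
            simp only [R1, Finset.mem_filter] at hk
            exact Nat.mem_divisors.2 ⟨hk.2, hmg⟩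
          · intros; positivity
      _ = N := by exact_mod_cast Nat.sum_totient N
  constructor
  · rw [← Finset.sum_filter_add_sum_filter_not R (fun k => k ∣ N)]
    calc _ ≤ (N : ℝ) + N * (1 / 4) := add_le_add hR1 hR2
      _ = _ := by ring
  · intro hK hA
    rw [← Finset.sum_filter_add_sum_filter_not R (fun k => k ∣ N)]
    have h1 : ∑ k ∈ R1, sA d m c A k = N := by
      have e : R1 = N.divisors := by
        ext k
        simp only [R1, R, Finset.mem_filter, Finset.mem_range, Nat.mem_divisors]
        constructor
        · rintro ⟨_, h⟩; exact ⟨h, hmg⟩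
        · rintro ⟨h, _⟩
          exact ⟨lt_of_le_of_lt (Nat.le_of_dvd (Nat.pos_of_ne_zero hmg) h) (by omega), h⟩
      rw [e]
      have : ∀ k ∈ N.divisors, sA d m c A k = (k.totient : ℂ) := fun k hk =>
        sA_one d m c A k g hgm hg1 (Nat.mem_divisors.1 hk).1 hA
      rw [Finset.sum_congr rfl this]
      exact_mod_cast Nat.sum_totient N
    rw [h1, add_sub_cancel_left]
    exact (norm_sum_le _ _).trans hR2
end

section
open Complex in
noncomputable def thT (d m : ℕ) (c : ℤ) (τ : ℂ) (t : ℤ) : ℂ :=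
  cexp (2 * Real.pi * I * τ * d * (c + m * t) ^ 2)

noncomputable def th (d m : ℕ) (c : ℤ) (τ : ℂ) : ℂ := ∑' t : ℤ, thT d m c τ t

noncomputable def gX (k : ℕ) (h : ℤ) (d m : ℕ) (c : ℤ) (x : ℤ) : ℂ :=
  ∑ r ∈ Finset.range k,
    Complex.exp (2 * Real.pi * Complex.I * ((h * d * (c + m * (r : ℤ)) ^ 2 : ℤ) : ℂ) / k) *
    Complex.exp (2 * Real.pi * Complex.I * x * (c + m * (r : ℤ)) / (m * k))

theorem gX_zero (k : ℕ) (h : ℤ) (d m : ℕ) (c : ℤ) : gX k h d m c 0 = gG k h d m c := by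
  simp [gX, gG]

theorem gX_norm (k : ℕ) (hk : k ≠ 0) (h : ℤ) (hh : IsCoprime h k) (d m : ℕ) (hd : d ≠ 0) (hm : m ≠ 0)
    (c : ℤ) (x : ℤ) :
    ‖gX k h d m c x‖ ^ 2 ≤ k * (2 * d * m ^ 2 : ℕ) := by
  have : NeZero k := ⟨hk⟩
  have hkC : (k : ℂ) ≠ 0 := by exact_mod_cast hk
  have hmC : (m : ℂ) ≠ 0 := by exact_mod_cast hm
  have h1 : gX k h d m c x = (Complex.exp (2 * Real.pi * Complex.I * x * c / (m * k)) *
      Complex.exp (2 * Real.pi * Complex.I * h * d * c ^ 2 / k)) *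
      ∑ r : ZMod k, ZMod.stdAddChar (((h : ZMod k) * (d : ZMod k) * (m : ZMod k) ^ 2) * r ^ 2 +
       (2 * (h : ZMod k) * (d : ZMod k) * (c : ZMod k) * (m : ZMod k) + (x : ZMod k)) * r) := by
    rw [← sum_range_zmod k (fun r => ZMod.stdAddChar
      (((h : ZMod k) * (d : ZMod k) * (m : ZMod k) ^ 2) * r ^ 2 +
       (2 * (h : ZMod k) * (d : ZMod k) * (c : ZMod k) * (m : ZMod k) + (x : ZMod k)) * r))]
    unfold gX
    rw [Finset.mul_sum]
    apply Finset.sum_congr rfl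
    intro r _
    have h2 := ZMod.stdAddChar_coe (N := k)
      (h * d * m ^ 2 * (r : ℤ) ^ 2 + (2 * h * d * c * m + x) * (r : ℤ))
    push_cast at h2
    rw [h2, ← Complex.exp_add, ← Complex.exp_add, ← Complex.exp_add]
    congr 1
    push_cast
    field_simp
    ring
  have h3 : ‖Complex.exp (2 * Real.pi * Complex.I * x * c / (m * k))‖ = 1 := by
    have : 2 * Real.pi * Complex.I * x * c / (m * k) =
      (((2 * Real.pi * x * c / (m * k)) : ℝ) : ℂ) * Complex.I := by push_cast; ring
    rw [this, Complex.norm_exp_ofReal_mul_I]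
  have h4 : ‖Complex.exp (2 * Real.pi * Complex.I * h * d * c ^ 2 / k)‖ = 1 := by
    have : 2 * Real.pi * Complex.I * h * d * c ^ 2 / k =
      (((2 * Real.pi * h * d * c ^ 2 / k) : ℝ) : ℂ) * Complex.I := by push_cast; ring
    rw [this, Complex.norm_exp_ofReal_mul_I]
  rw [h1, norm_mul, norm_mul, h3, h4, one_mul, one_mul]
  refine (gs_bound k (2 * d * m ^ 2) h hh _ _ (by push_cast; ring)).trans ?_
  gcongr
  exact Nat.gcd_le_right _ (by positivity)

theorem thT_eq (d m : ℕ) (c : ℤ) (τ : ℂ) (t : ℤ) : thT d m c τ t =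
    Complex.exp (2 * Real.pi * Complex.I * τ * d * c ^ 2) *
      jacobiTheta₂_term t (2 * τ * d * c * m) (2 * τ * d * m ^ 2) := by
  unfold thT jacobiTheta₂_term
  rw [← Complex.exp_add]
  congr 1
  ring

theorem im_scale {τ : ℂ} (hτ : 0 < τ.im) {d m : ℕ} (hd : d ≠ 0) (hm : m ≠ 0) :
    0 < (2 * τ * d * m ^ 2).im := by
  have : (2 * τ * d * m ^ 2) = ((2 * d * m ^ 2 : ℝ) : ℂ) * τ := by push_cast; ring
  rw [this, Complex.im_ofReal_mul]
  positivity

theorem th_summable {d m : ℕ} (hd : d ≠ 0) (hm : m ≠ 0) (c : ℤ) {τ : ℂ} (hτ : 0 < τ.im) :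
    Summable (thT d m c τ) := by
  have h1 : thT d m c τ = fun t => Complex.exp (2 * Real.pi * Complex.I * τ * d * c ^ 2) *
      jacobiTheta₂_term t (2 * τ * d * c * m) (2 * τ * d * m ^ 2) := by
    ext t; exact thT_eq d m c τ t
  rw [h1]
  apply Summable.mul_left
  rw [summable_jacobiTheta₂_term_iff]
  exact im_scale hτ hd hm

theorem tsum_residue (k : ℕ) (hk : k ≠ 0) (f : ℤ → ℂ) (hf : Summable f) :
    ∑' t, f t = ∑ r ∈ Finset.range k, ∑' s : ℤ, f (r + k * s) := by
  have : NeZero k := ⟨hk⟩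
  set e := (Equiv.prodComm (Fin k) ℤ).trans (Int.divModEquiv k).symm
  have he : ∀ x, e x = x.1 + k * x.2 := by
    intro x
    simp [e, Int.divModEquiv]
    ring
  rw [← e.tsum_eq f, Summable.tsum_prod (f := fun x => f (e x)) ((Equiv.summable_iff e).2 hf), tsum_fintype,
    Finset.sum_range]
  simp only [he]

theorem th_transform {d m : ℕ} (hd : d ≠ 0) (hm : m ≠ 0) (c : ℤ) (k : ℕ) (hk : k ≠ 0) (h : ℤ)
    {z : ℂ} (hz : 0 < z.im) :
    HasSum (fun x : ℤ => gX k h d m c x *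
      Complex.exp (-(Real.pi * Complex.I * x ^ 2 / (2 * z * d * m ^ 2 * k ^ 2))))
      ((-Complex.I * (2 * z * d * m ^ 2 * k ^ 2)) ^ (1 / 2 : ℂ) * th d m c (h / k + z)) := by
  have hkC : (k : ℂ) ≠ 0 := by exact_mod_cast hk
  have hmC : (m : ℂ) ≠ 0 := by exact_mod_cast hm
  have hdC : (d : ℂ) ≠ 0 := by exact_mod_cast hd
  have hz0 : z ≠ 0 := by rintro rfl; simp at hz
  set T := 2 * z * d * m ^ 2 * k ^ 2 with hT
  have hT0 : T ≠ 0 := by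
    rw [hT]; simp [hz0, hdC, hmC, hkC]
  have hTim : 0 < T.im := by
    have := im_scale hz hd (mul_ne_zero hm hk)
    convert this using 2
    rw [hT]; push_cast; ring
  have hTim' : 0 < (-1 / T).im := by
    rw [neg_div, Complex.neg_im, one_div, Complex.inv_im, neg_div, neg_neg]
    exact div_pos hTim (Complex.normSq_pos.2 hT0)
  have hτ : 0 < ((h : ℂ) / k + z).im := by
    have : ((h : ℂ) / k).im = 0 := by
      have : (h : ℂ) / k = ((h / k : ℝ) : ℂ) := by push_cast; rfl
      rw [this, Complex.ofReal_im]
    rw [Complex.add_im, this, zero_add]; exact hz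
  have hsq : (-Complex.I * T) ^ (1 / 2 : ℂ) ≠ 0 := by
    intro h0
    rw [Complex.cpow_eq_zero_iff] at h0
    exact mul_ne_zero (neg_ne_zero.2 Complex.I_ne_zero) hT0 h0.1
  have key : ∀ r : ℕ, (-Complex.I * T) ^ (1 / 2 : ℂ) *
      ∑' s : ℤ, thT d m c (h / k + z) (r + k * s) =
      Complex.exp (2 * Real.pi * Complex.I * ((h * d * (c + m * (r : ℤ)) ^ 2 : ℤ) : ℂ) / k) *
      jacobiTheta₂ ((c + m * r) / (m * k)) (-1 / T) := by
    intro r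
    have h1 : ∀ s : ℤ, thT d m c (h / k + z) (r + k * s) =
        (Complex.exp (2 * Real.pi * Complex.I * ((h * d * (c + m * (r : ℤ)) ^ 2 : ℤ) : ℂ) / k) *
        Complex.exp (2 * Real.pi * Complex.I * z * d * (c + m * r) ^ 2)) *
        jacobiTheta₂_term s (2 * z * d * (c + m * r) * m * k) T := by
      intro s
      unfold thT jacobiTheta₂_term
      rw [← Complex.exp_add, ← Complex.exp_add, Complex.exp_eq_exp_iff_exists_int]
      refine ⟨h * d * (2 * (c + m * r) * m * s + m ^ 2 * k * s ^ 2), ?_⟩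
      rw [hT]
      push_cast
      field_simp
      ring
    rw [tsum_congr h1, tsum_mul_left]
    change _ * (_ * jacobiTheta₂ _ _) = _
    rw [jacobiTheta₂_functional_equation]
    have e1 : (2 * z * d * (c + m * r) * m * k) / T = (c + m * r) / (m * k) := by
      rw [hT]; field_simp
    have e2 : -(Real.pi : ℂ) * Complex.I * (2 * z * d * (c + m * r) * m * k) ^ 2 / T =
      -(2 * Real.pi * Complex.I * z * d * (c + m * r) ^ 2) := by
      rw [hT]; field_simp
    rw [e1, e2, Complex.exp_neg]
    have h5 := Complex.exp_ne_zero (2 * Real.pi * Complex.I * z * d * (c + m * r) ^ 2)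
    field_simp
  have h2 : (-Complex.I * T) ^ (1 / 2 : ℂ) * th d m c (h / k + z) =
      ∑ r ∈ Finset.range k,
      Complex.exp (2 * Real.pi * Complex.I * ((h * d * (c + m * (r : ℤ)) ^ 2 : ℤ) : ℂ) / k) *
      jacobiTheta₂ ((c + m * r) / (m * k)) (-1 / T) := by
    unfold th
    rw [tsum_residue k hk _ (th_summable hd hm c hτ), Finset.mul_sum]
    exact Finset.sum_congr rfl fun r _ => key r
  rw [h2]
  have h3 : (fun x : ℤ => gX k h d m c x *
      Complex.exp (-(Real.pi * Complex.I * x ^ 2 / T))) = fun x : ℤ => ∑ r ∈ Finset.range k,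
      Complex.exp (2 * Real.pi * Complex.I * ((h * d * (c + m * (r : ℤ)) ^ 2 : ℤ) : ℂ) / k) *
      jacobiTheta₂_term x ((c + m * r) / (m * k)) (-1 / T) := by
    ext x
    unfold gX jacobiTheta₂_term
    rw [Finset.sum_mul]
    apply Finset.sum_congr rfl
    intro r _
    rw [mul_assoc, ← Complex.exp_add]
    congr 2
    push_cast
    field_simp
  rw [h3]
  apply hasSum_sum
  intro r _
  exact (hasSum_jacobiTheta₂_term _ hTim').mul_left _
end

section
noncomputable def eE (δ : ℝ) : ℝ := ∑' x : ℤ, if x = 0 then 0 else Real.exp (-(Real.pi * x ^ 2 * δ))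

theorem eE_summable {δ : ℝ} (hδ : 0 < δ) :
    Summable (fun x : ℤ => if x = 0 then 0 else Real.exp (-(Real.pi * x ^ 2 * δ))) := by
  have h1 := ((summable_jacobiTheta₂_term_iff 0 (Complex.I * δ)).2 (by simpa using hδ)).norm
  refine Summable.of_nonneg_of_le (fun x => ?_) (fun x => ?_) h1
  · split_ifs <;> positivity
  · rw [norm_jacobiTheta₂_term]
    split_ifs
    · positivity
    · apply le_of_eq
      congr 1
      simp

theorem eE_nonneg (δ : ℝ) : 0 ≤ eE δ := by
  apply tsum_nonneg
  intro x
  split_ifs <;> positivity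

theorem eE_anti {δ0 δ : ℝ} (h0 : 0 < δ0) (h : δ0 ≤ δ) : eE δ ≤ eE δ0 := by
  apply Summable.tsum_le_tsum _ (eE_summable (h0.trans_le h)) (eE_summable h0)
  intro x
  split_ifs
  · exact le_rfl
  · apply Real.exp_le_exp.2
    have : 0 ≤ Real.pi * (x : ℝ) ^ 2 := by positivity
    nlinarith

theorem eE_le {δ : ℝ} (h : 1 ≤ δ) : eE δ ≤ eE 1 * Real.exp (-(Real.pi * (δ - 1))) := by
  unfold eE
  rw [← tsum_mul_right]
  apply Summable.tsum_le_tsum _ (eE_summable (by linarith)) ((eE_summable one_pos).mul_right _)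
  intro x
  split_ifs with hx
  · simp
  · rw [← Real.exp_add]
    apply Real.exp_le_exp.2
    have h1 : (1 : ℝ) ≤ (x : ℝ) ^ 2 := by
      have : 0 < x ^ 2 := by positivity
      have : 1 ≤ x ^ 2 := by omega
      exact_mod_cast this
    have h2 : 0 ≤ ((x : ℝ) ^ 2 - 1) * (δ - 1) := mul_nonneg (by linarith) (by linarith)
    nlinarith [Real.pi_pos]

theorem eE_tendsto : Filter.Tendsto eE Filter.atTop (nhds 0) := by
  have h1 : Filter.Tendsto (fun δ : ℝ => eE 1 * Real.exp (-(Real.pi * (δ - 1)))) Filter.atTop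
      (nhds (eE 1 * 0)) := by
    apply Filter.Tendsto.const_mul
    apply Real.tendsto_exp_neg_atTop_nhds_zero.comp
    apply Filter.Tendsto.const_mul_atTop Real.pi_pos
    exact Filter.tendsto_atTop_add_const_right _ _ Filter.tendsto_id
  rw [mul_zero] at h1
  refine squeeze_zero' (Filter.Eventually.of_forall eE_nonneg) ?_ h1
  filter_upwards [Filter.eventually_ge_atTop 1] with δ hδ using eE_le hδ

noncomputable def sg (b : ℝ) : ℂ := (1 - Complex.I * b) ^ (1 / 2 : ℂ)

theorem sg_base_ne (b : ℝ) : (1 - Complex.I * b) ≠ 0 := by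
  intro h
  have := congrArg Complex.re h
  simp at this

theorem sg_ne (b : ℝ) : sg b ≠ 0 := by
  unfold sg
  intro h0
  rw [Complex.cpow_eq_zero_iff] at h0
  exact sg_base_ne b h0.1

theorem sg_sq (b : ℝ) : sg b ^ 2 = 1 - Complex.I * b := by
  unfold sg
  rw [← Complex.cpow_nat_mul]
  norm_num

theorem sg_norm4 (b : ℝ) : ‖sg b‖ ^ 4 = 1 + b ^ 2 := by
  have h1 : ‖sg b‖ ^ 2 = ‖1 - Complex.I * b‖ := by rw [← norm_pow, sg_sq]
  have : ‖sg b‖ ^ 4 = (‖sg b‖ ^ 2) ^ 2 := by ring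
  rw [this, h1, ← Complex.normSq_eq_norm_sq, Complex.normSq_apply]
  simp
  ring

theorem sg_norm_ge (b : ℝ) : 1 ≤ ‖sg b‖ := by
  have h1 := sg_norm4 b
  by_contra h
  push Not at h
  have h2 : ‖sg b‖ ^ 4 < 1 := pow_lt_one₀ (norm_nonneg _) h (by norm_num)
  nlinarith [sq_nonneg b]

theorem sg_cont : Continuous sg := by
  unfold sg
  apply Continuous.cpow (by fun_prop) continuous_const
  intro b
  left
  simp

theorem cpow_half_mul {x : ℝ} (hx : 0 < x) {w : ℂ} (hw : w ≠ 0) :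
    ((x : ℂ) * w) ^ (1 / 2 : ℂ) = (Real.sqrt x : ℂ) * w ^ (1 / 2 : ℂ) := by
  have hx' : (x : ℂ) ≠ 0 := by exact_mod_cast hx.ne'
  rw [Complex.cpow_def_of_ne_zero (mul_ne_zero hx' hw), Complex.log_ofReal_mul hx hw, add_mul,
    Complex.exp_add, Complex.cpow_def_of_ne_zero hw]
  congr 1
  rw [Real.sqrt_eq_rpow, Complex.ofReal_cpow hx.le, Complex.cpow_def_of_ne_zero hx',
    Complex.ofReal_log hx.le]
  norm_num

noncomputable def thM (d m : ℕ) (c : ℤ) (k : ℕ) (h : ℤ) (A b : ℝ) : ℂ :=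
  (Real.sqrt A / Real.sqrt (2 * d * m ^ 2) : ℝ) / sg b * (gG k h d m c / k)

theorem gG_norm' (k : ℕ) (hk : k ≠ 0) (h : ℤ) (hh : IsCoprime h k) (d m : ℕ) (hd : d ≠ 0)
    (hm : m ≠ 0) (c : ℤ) (x : ℤ) :
    ‖gX k h d m c x‖ ≤ Real.sqrt k * Real.sqrt (2 * d * m ^ 2) := by
  rw [← Real.sqrt_mul (by positivity)]
  apply Real.le_sqrt_of_sq_le
  have := gX_norm k hk h hh d m hd hm c x
  push_cast at this
  exact this

theorem th_est {d m : ℕ} (hd : d ≠ 0) (hm : m ≠ 0) (c : ℤ) (k : ℕ) (hk : k ≠ 0) (h : ℤ)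
    (hh : IsCoprime h k) {A : ℝ} (hA : 0 < A) (b : ℝ) :
    ‖thM d m c k h A b‖ ≤ Real.sqrt (A / k) / ‖sg b‖ ∧
    ‖th d m c (h / k + (b + Complex.I) / A) - thM d m c k h A b‖ ≤
      Real.sqrt (A / k) / ‖sg b‖ * eE (A / (2 * d * m ^ 2 * k ^ 2 * (1 + b ^ 2))) := by
  have hkR : (0 : ℝ) < k := by positivity
  have hDpos : (0 : ℝ) < 2 * d * m ^ 2 := by positivity
  set D := Real.sqrt (2 * d * m ^ 2) with hD
  have hD0 : 0 < D := Real.sqrt_pos.2 hDpos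
  have hDsq : D ^ 2 = 2 * d * m ^ 2 := Real.sq_sqrt hDpos.le
  have hsk : 0 < Real.sqrt k := Real.sqrt_pos.2 hkR
  have hsksq : Real.sqrt k ^ 2 = k := Real.sq_sqrt hkR.le
  have hsA : 0 < Real.sqrt A := Real.sqrt_pos.2 hA
  have hsg := norm_pos_iff.2 (sg_ne b)
  have hdiv : Real.sqrt (A / k) = Real.sqrt A / Real.sqrt k := Real.sqrt_div hA.le _
  constructor
  · unfold thM
    rw [norm_mul, norm_div, norm_div, Complex.norm_natCast, Complex.norm_real, Real.norm_eq_abs,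
      abs_of_nonneg (by positivity)]
    have h1 := gG_norm' k hk h hh d m hd hm c 0
    rw [gX_zero, ← hD] at h1
    rw [hdiv, ← hD]
    calc _ ≤ Real.sqrt A / D / ‖sg b‖ * (Real.sqrt k * D / k) := by gcongr
      _ = Real.sqrt A / Real.sqrt k / ‖sg b‖ := by
        field_simp
        exact hsksq
  · set z : ℂ := (b + Complex.I) / A with hzdef
    have hzim : z.im = 1 / A := by
      rw [hzdef, Complex.div_ofReal_im]; simp
    have hz : 0 < z.im := by rw [hzim]; positivity
    have hAC : (A : ℂ) ≠ 0 := by exact_mod_cast hA.ne'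
    have hkC : (k : ℂ) ≠ 0 := by exact_mod_cast hk
    have hsum := th_transform hd hm c k hk h hz
    set T : ℂ := 2 * z * d * m ^ 2 * k ^ 2 with hT
    have e1 : -Complex.I * T = ((D ^ 2 * k ^ 2 / A : ℝ) : ℂ) * (1 - Complex.I * b) := by
      rw [hT, hDsq, hzdef]
      push_cast
      field_simp
      linear_combination -Complex.I_sq
    have e2 : (-Complex.I * T) ^ (1 / 2 : ℂ) = (D * k / Real.sqrt A : ℝ) * sg b := by
      rw [e1, cpow_half_mul (by positivity) (sg_base_ne b)]
      congr 2
      rw [Real.sqrt_div (by positivity), Real.sqrt_mul (by positivity), Real.sqrt_sq hD0.le,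
        Real.sqrt_sq hkR.le]
    rw [e2] at hsum
    have hTI : T = Complex.I * (((D ^ 2 * k ^ 2 / A : ℝ) : ℂ) * (1 - Complex.I * b)) := by
      rw [← e1]; linear_combination T * Complex.I_sq
    set δ := A / (2 * d * m ^ 2 * k ^ 2 * (1 + b ^ 2)) with hδ
    have hδ0 : 0 < δ := by positivity
    have hnorm : ∀ x : ℤ, ‖Complex.exp (-(Real.pi * Complex.I * x ^ 2 / T))‖ =
        Real.exp (-(Real.pi * x ^ 2 * δ)) := by
      intro x
      rw [Complex.norm_exp]
      congr 1
      have hbC : (1 + (b : ℂ) ^ 2) ≠ 0 := by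
        have : (1 + b ^ 2) ≠ 0 := by positivity
        exact_mod_cast this
      have hb2 := sg_base_ne b
      have hDC : (D : ℂ) ≠ 0 := by exact_mod_cast hD0.ne'
      have : -(Real.pi * Complex.I * x ^ 2 / T) =
          ((-(Real.pi * x ^ 2 * δ) : ℝ) : ℂ) + ((-(Real.pi * x ^ 2 * δ * b) : ℝ) : ℂ) * Complex.I := by
        rw [hTI, hδ, ← hDsq]
        push_cast
        field_simp
        linear_combination (-(x : ℂ) ^ 2 * (b : ℂ) ^ 2) * Complex.I_sq
      rw [this, Complex.add_re, Complex.ofReal_re, Complex.re_ofReal_mul, Complex.I_re, mul_zero,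
        add_zero]
    set C : ℂ := (D * k / Real.sqrt A : ℝ) * sg b with hC
    have hCn : ‖C‖ = D * k / Real.sqrt A * ‖sg b‖ := by
      rw [hC, norm_mul, Complex.norm_real, Real.norm_eq_abs, abs_of_nonneg (by positivity)]
    have hCM : C * thM d m c k h A b = gG k h d m c := by
      rw [hC]
      unfold thM
      rw [← hD]
      have hDC : (D : ℂ) ≠ 0 := by exact_mod_cast hD0.ne'
      have hAC' : (Real.sqrt A : ℂ) ≠ 0 := by exact_mod_cast hsA.ne'
      have := sg_ne b
      push_cast
      field_simp
    have hs2 := hsum.sub (hasSum_ite_eq (0 : ℤ) (gG k h d m c))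
    rw [← hCM, ← mul_sub] at hs2
    have hle := hs2.norm_le_of_bounded ((eE_summable hδ0).hasSum.mul_left (Real.sqrt k * D)) (by
      intro x
      by_cases hx : x = 0
      · subst hx
        simp [gX_zero, hCM]
      · simp only [hx, if_false, sub_zero]
        rw [norm_mul, hnorm]
        apply mul_le_mul_of_nonneg_right (gG_norm' k hk h hh d m hd hm c x) (by positivity))
    rw [norm_mul, hCn] at hle
    change _ ≤ _ * eE δ at hle
    have hpos : 0 < D * k / Real.sqrt A * ‖sg b‖ := by positivity
    rw [← le_div_iff₀' hpos] at hle
    refine hle.trans (le_of_eq ?_)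
    rw [hdiv]
    field_simp
    rw [hsksq, mul_comm]
end

section
theorem pi_tsum {n : ℕ} (g : Fin n → ℤ → ℂ) (hg : ∀ i, Summable fun t => ‖g i t‖) :
    (Summable fun t : Fin n → ℤ => ‖∏ i, g i (t i)‖) ∧
    ∑' t : Fin n → ℤ, ∏ i, g i (t i) = ∏ i, ∑' t, g i t := by
  induction n with
  | zero =>
    constructor
    · exact (hasSum_fintype _).summable
    · rw [tsum_fintype]; simp
  | succ n ih =>
    obtain ⟨h1, h2⟩ := ih (fun i => g i.succ) fun i => hg i.succ
    set e := Fin.consEquiv (fun _ : Fin (n + 1) => ℤ)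
    have he : ∀ x : ℤ × (Fin n → ℤ), ∏ i, g i (e x i) = g 0 x.1 * ∏ i : Fin n, g i.succ (x.2 i) := by
      intro x
      rw [Fin.prod_univ_succ]
      simp [e, Fin.consEquiv]
    have h3 := summable_mul_of_summable_norm (hg 0) h1
    have h3' : Summable fun x : ℤ × (Fin n → ℤ) => ‖g 0 x.1 * ∏ i : Fin n, g i.succ (x.2 i)‖ := h3.norm
    constructor
    · rw [← Equiv.summable_iff e]
      convert h3' using 1
      ext x
      simp only [Function.comp]
      rw [he]
    · rw [← e.tsum_eq, Fin.prod_univ_succ, ← h2, tsum_mul_tsum_of_summable_norm (hg 0) h1]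
      exact tsum_congr he

def repS {n : ℕ} (d : Fin n → ℕ) (m : ℕ) (c : Fin n → ℤ) (A : ℤ) : Set (Fin n → ℤ) :=
  {t | ∑ i, (d i : ℤ) * (c i + m * t i) ^ 2 = A}

noncomputable def thF {n : ℕ} (d : Fin n → ℕ) (m : ℕ) (c : Fin n → ℤ) (A u : ℝ) : ℂ :=
  ∏ i, th (d i) m (c i) (u + Complex.I / A)

theorem char_integral (a0 : ℝ) (q : ℤ) :
    ∫ u in a0..(a0 + 1), Complex.exp (2 * Real.pi * Complex.I * q * u) = if q = 0 then 1 else 0 := by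
  split_ifs with h
  · subst h; simp
  · have hc : 2 * Real.pi * Complex.I * q ≠ 0 := by
      simp [h, Complex.I_ne_zero, Real.pi_ne_zero]
    rw [integral_exp_mul_complex hc]
    have : 2 * Real.pi * Complex.I * q * ((a0 + 1 : ℝ) : ℂ) =
      2 * Real.pi * Complex.I * q * a0 + q * (2 * Real.pi * Complex.I) := by push_cast; ring
    rw [this, Complex.exp_add, Complex.exp_int_mul_two_pi_mul_I]
    simp

theorem thF_integral {n : ℕ} (d : Fin n → ℕ) (hd : ∀ i, d i ≠ 0) (m : ℕ) (hm : m ≠ 0)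
    (c : Fin n → ℤ) (A : ℕ) (hA : 0 < A) (a0 : ℝ) :
    (repS d m c A).Finite ∧
    ∫ u in a0..(a0 + 1), thF d m c A u * Complex.exp (-(2 * Real.pi * Complex.I * A * u)) =
      Real.exp (-(2 * Real.pi)) * ((repS d m c A).ncard : ℂ) := by
  have hAR : (0 : ℝ) < A := by positivity
  have hAC : (A : ℂ) ≠ 0 := by exact_mod_cast hA.ne'
  have him : ∀ u : ℝ, 0 < ((u : ℂ) + Complex.I / (A : ℝ)).im := by
    intro u
    rw [Complex.add_im, Complex.div_ofReal_im]
    simp [hA]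
  set Q : (Fin n → ℤ) → ℤ := fun t => ∑ i, (d i : ℤ) * (c i + m * t i) ^ 2 with hQ
  have hpt : ∀ (t : Fin n → ℤ) (u : ℝ), ∏ i, thT (d i) m (c i) (u + Complex.I / (A : ℝ)) (t i) =
      Real.exp (-(2 * Real.pi * Q t / A)) * Complex.exp (2 * Real.pi * Complex.I * Q t * u) := by
    intro t u
    unfold thT
    rw [← Complex.exp_sum, Complex.ofReal_exp, ← Complex.exp_add]
    congr 1
    have h1 : ∀ i : Fin n, 2 * (Real.pi : ℂ) * Complex.I * (u + Complex.I / (A : ℝ)) * d i *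
        (c i + m * t i) ^ 2 = (2 * (Real.pi : ℂ) * Complex.I * (u + Complex.I / (A : ℝ))) *
          (d i * (c i + m * t i) ^ 2) := by intro i; ring
    rw [Finset.sum_congr rfl fun i _ => h1 i, ← Finset.mul_sum]
    have h2 : ∑ i, (d i : ℂ) * (c i + m * t i) ^ 2 = (Q t : ℂ) := by rw [hQ]; push_cast; rfl
    rw [h2]
    push_cast
    field_simp
    linear_combination (Q t : ℂ) * Complex.I_sq
  have hS : ∀ u : ℝ, (Summable fun t : Fin n → ℤ =>
      ‖∏ i, thT (d i) m (c i) (u + Complex.I / (A : ℝ)) (t i)‖) ∧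
      ∑' t : Fin n → ℤ, ∏ i, thT (d i) m (c i) (u + Complex.I / (A : ℝ)) (t i) = thF d m c A u := by
    intro u
    exact pi_tsum _ fun i => (th_summable (hd i) hm (c i) (him u)).norm
  have hnorm : ∀ (t : Fin n → ℤ) (u : ℝ),
      ‖∏ i, thT (d i) m (c i) (u + Complex.I / (A : ℝ)) (t i)‖ = Real.exp (-(2 * Real.pi * Q t / A)) := by
    intro t u
    rw [hpt, norm_mul, Complex.norm_real, Real.norm_eq_abs, abs_of_pos (Real.exp_pos _)]
    have : 2 * Real.pi * Complex.I * Q t * u = ((2 * Real.pi * Q t * u : ℝ) : ℂ) * Complex.I := by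
      push_cast; ring
    rw [this, Complex.norm_exp_ofReal_mul_I, mul_one]
  have hbs : Summable fun t : Fin n → ℤ => Real.exp (-(2 * Real.pi * Q t / A)) := by
    have := (hS 0).1
    simp only [hnorm] at this
    exact this
  have hn1 : ∀ u : ℝ, ‖Complex.exp (-(2 * Real.pi * Complex.I * A * u))‖ = 1 := by
    intro u
    have : -(2 * Real.pi * Complex.I * A * u) = ((-(2 * Real.pi * A * u) : ℝ) : ℂ) * Complex.I := by
      push_cast; ring
    rw [this, Complex.norm_exp_ofReal_mul_I]
  have hmain := intervalIntegral.hasSum_integral_of_dominated_convergence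
    (F := fun (t : Fin n → ℤ) (u : ℝ) => (Real.exp (-(2 * Real.pi * Q t / A)) *
      Complex.exp (2 * Real.pi * Complex.I * Q t * u)) *
      Complex.exp (-(2 * Real.pi * Complex.I * A * u)))
    (f := fun u => thF d m c A u * Complex.exp (-(2 * Real.pi * Complex.I * A * u)))
    (a := a0) (b := a0 + 1) (μ := MeasureTheory.volume)
    (fun t _ => Real.exp (-(2 * Real.pi * Q t / A)))
    (fun t => Continuous.aestronglyMeasurable (by fun_prop))
    (fun t => Filter.Eventually.of_forall fun u _ => by
      rw [← hpt, norm_mul, hnorm, hn1, mul_one])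
    (Filter.Eventually.of_forall fun u _ => hbs)
    (by simp)
    (Filter.Eventually.of_forall fun u _ => by
      have h1 := (hS u).1.of_norm.hasSum
      rw [(hS u).2] at h1
      simp only [hpt] at h1
      exact h1.mul_right _)
  have hintg : ∀ t : Fin n → ℤ, ∫ u in a0..(a0 + 1), (Real.exp (-(2 * Real.pi * Q t / A)) *
      Complex.exp (2 * Real.pi * Complex.I * Q t * u)) *
      Complex.exp (-(2 * Real.pi * Complex.I * A * u)) =
      if Q t = A then (Real.exp (-(2 * Real.pi)) : ℂ) else 0 := by
    intro t
    have h1 : ∀ u : ℝ, (Real.exp (-(2 * Real.pi * Q t / A)) *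
      Complex.exp (2 * Real.pi * Complex.I * Q t * u)) *
      Complex.exp (-(2 * Real.pi * Complex.I * A * u)) = Real.exp (-(2 * Real.pi * Q t / A)) *
       Complex.exp (2 * Real.pi * Complex.I * ((Q t - A : ℤ) : ℂ) * u) := by
      intro u
      rw [mul_assoc, ← Complex.exp_add]
      congr 2
      push_cast
      ring
    simp only [h1]
    rw [intervalIntegral.integral_const_mul, char_integral]
    by_cases hq : Q t = A
    · simp only [hq, sub_self, if_true, mul_one]
      congr 2
      push_cast
      field_simp
    · rw [if_neg (sub_ne_zero.2 hq), if_neg hq, mul_zero]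
  simp only [hintg] at hmain
  have hind : (fun t : Fin n → ℤ => if Q t = A then (Real.exp (-(2 * Real.pi)) : ℂ) else 0) =
      (repS d m c A).indicator fun _ => (Real.exp (-(2 * Real.pi)) : ℂ) := by
    ext t
    by_cases hq : Q t = A
    · rw [if_pos hq, Set.indicator_of_mem]
      exact hq
    · rw [if_neg hq, Set.indicator_of_notMem]
      exact hq
  rw [hind] at hmain
  have hfin : (repS d m c A).Finite := by
    by_contra hinf
    have : Infinite (repS d m c A) := Set.infinite_coe_iff.2 hinf
    have h1 := hmain.summable
    rw [← summable_subtype_iff_indicator] at h1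
    have h2 : Summable fun _ : repS d m c A => (Real.exp (-(2 * Real.pi)) : ℂ) := h1
    rw [summable_const_iff] at h2
    have : Real.exp (-(2 * Real.pi)) = 0 := by exact_mod_cast h2
    exact (Real.exp_pos _).ne' this
  refine ⟨hfin, ?_⟩
  rw [← hmain.tsum_eq, tsum_eq_sum (s := hfin.toFinset) (by
    intro t ht
    rw [Set.indicator_of_notMem]
    simpa using ht), Finset.sum_congr rfl (g := fun _ => (Real.exp (-(2 * Real.pi)) : ℂ)) (by
    intro t ht
    rw [Set.indicator_of_mem]
    simpa using ht), Set.ncard_eq_toFinset_card _ hfin]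
  simp [mul_comm]
end

section
open MeasureTheory Set

theorem gam_int (s : ℝ) (hs : 0 < s) (w : ℂ) (hw : 0 < w.re) :
    ∫ t in Ioi (0:ℝ), ((t ^ (s - 1) : ℝ) : ℂ) * Complex.exp (-(w * t)) =
      Real.Gamma s * w ^ (-(s : ℂ)) := by
  set g : ℝ → NNReal := fun x => Real.toNNReal (x ^ (s - 1)) with hg
  have hgm : Measurable g := by
    apply Measurable.real_toNNReal
    fun_prop
  set ν : Measure ℝ := (volume.restrict (Ioi (0:ℝ))).withDensity (fun x => (g x : ENNReal)) with hν
  have key : ∀ z : ℂ, ProbabilityTheory.complexMGF id ν z =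
      ∫ t in Ioi (0:ℝ), ((t ^ (s - 1) : ℝ) : ℂ) * Complex.exp (z * t) := by
    intro z
    unfold ProbabilityTheory.complexMGF
    rw [hν, integral_withDensity_eq_integral_smul hgm]
    apply setIntegral_congr_fun measurableSet_Ioi
    intro t ht
    have ht : 0 < t := ht
    simp only [hg, id, NNReal.smul_def, Real.coe_toNNReal _ (Real.rpow_nonneg ht.le _)]
    simp
  have hintg : ∀ r : ℝ, r < 0 → r ∈ ProbabilityTheory.integrableExpSet id ν := by
    intro r hr
    show Integrable (fun x => Real.exp (r * id x)) ν
    rw [hν, integrable_withDensity_iff_integrable_smul hgm]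
    have := integrableOn_rpow_mul_exp_neg_mul_rpow (s := s - 1) (p := 1) (b := -r) (by linarith) (by norm_num) (by linarith)
    apply (integrable_congr _).1 this
    filter_upwards [ae_restrict_mem measurableSet_Ioi] with t ht
    have ht : 0 < t := ht
    simp only [hg, id, NNReal.smul_def, Real.coe_toNNReal _ (Real.rpow_nonneg ht.le _)]
    simp
  have hsub : Iio (0:ℝ) ⊆ interior (ProbabilityTheory.integrableExpSet id ν) :=
    interior_maximal (fun r hr => hintg r hr) isOpen_Iio
  have han : AnalyticOnNhd ℂ (ProbabilityTheory.complexMGF id ν) {z : ℂ | z.re < 0} :=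
    ProbabilityTheory.analyticOnNhd_complexMGF.mono (fun z hz => hsub hz)
  have hop : IsOpen {z : ℂ | z.re < 0} := isOpen_lt Complex.continuous_re continuous_const
  have han2 : AnalyticOnNhd ℂ (fun z : ℂ => (Real.Gamma s : ℂ) * (-z) ^ (-(s:ℂ))) {z : ℂ | z.re < 0} := by
    apply DifferentiableOn.analyticOnNhd _ hop
    intro z hz
    have hz : z.re < 0 := hz
    apply DifferentiableAt.differentiableWithinAt
    apply DifferentiableAt.const_mul
    apply DifferentiableAt.cpow (by fun_prop) (by fun_prop)
    left; simp; exact hz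
  have hpre : IsPreconnected {z : ℂ | z.re < 0} := (convex_halfSpace_re_lt 0).isPreconnected
  have hre : ∀ r : ℝ, r < 0 → ProbabilityTheory.complexMGF id ν r = (Real.Gamma s : ℂ) * (-(r:ℂ)) ^ (-(s:ℂ)) := by
    intro r hr
    rw [key]
    have := Complex.integral_cpow_mul_exp_neg_mul_Ioi (a := s) (r := -r) (by simpa using hs) (by linarith)
    rw [Complex.Gamma_ofReal] at this
    rw [mul_comm, Complex.cpow_neg]
    have e : (1 / ((-r : ℝ) : ℂ)) ^ (s : ℂ) = ((-(r:ℂ)) ^ (s:ℂ))⁻¹ := by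
      rw [one_div, Complex.inv_cpow]
      · simp
      · rw [Complex.arg_ofReal_of_nonneg (by linarith)]; exact Real.pi_pos.ne
    rw [← e, ← this]
    apply setIntegral_congr_fun measurableSet_Ioi
    intro t ht
    have ht : 0 < t := ht
    simp only
    rw [Complex.ofReal_cpow ht.le]
    push_cast
    congr 2
    ring
  have hfr : ∃ᶠ z in nhdsWithin (-1:ℂ) {-1}ᶜ, ProbabilityTheory.complexMGF id ν z = (fun z : ℂ => (Real.Gamma s : ℂ) * (-z) ^ (-(s:ℂ))) z := by
    have ht : Filter.Tendsto (fun r : ℝ => (r : ℂ)) (nhdsWithin (-1:ℝ) {-1}ᶜ) (nhdsWithin (-1:ℂ) {-1}ᶜ) := by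
      apply tendsto_nhdsWithin_of_tendsto_nhds_of_eventually_within
      · apply tendsto_nhdsWithin_of_tendsto_nhds
        have := Complex.continuous_ofReal.tendsto (-1)
        simpa using this
      · filter_upwards [self_mem_nhdsWithin] with r hr
        simp only [mem_compl_iff, mem_singleton_iff] at hr ⊢
        intro h; apply hr; exact_mod_cast h
    apply ht.frequently
    apply Filter.Eventually.frequently
    have : ∀ᶠ r : ℝ in nhdsWithin (-1:ℝ) {-1}ᶜ, r < 0 :=
      nhdsWithin_le_nhds (Iio_mem_nhds (by norm_num))
    filter_upwards [this] with r hr using hre r hr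
  have hfin := han.eqOn_of_preconnected_of_frequently_eq han2 hpre (z₀ := -1) (by simp) hfr
  have := hfin (show (-w) ∈ {z : ℂ | z.re < 0} by simpa using hw)
  rw [key] at this
  simp only [neg_neg] at this
  rw [← this]
  simp

theorem sg_inv_norm {n : ℕ} (hn : 5 ≤ n) (b : ℝ) : ‖(1 / sg b) ^ n‖ ≤ (1 + b ^ 2)⁻¹ := by
  rw [norm_pow, norm_div, norm_one, ← sg_norm4, ← inv_pow, one_div]
  apply pow_le_pow_of_le_one (by positivity) _ (by omega)
  exact inv_le_one_of_one_le₀ (sg_norm_ge b)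

theorem sg_inv_cont (n : ℕ) : Continuous (fun b => (1 / sg b) ^ n) := by
  apply Continuous.pow
  exact continuous_const.div sg_cont sg_ne

theorem sg_integrable {n : ℕ} (hn : 5 ≤ n) : Integrable (fun b => (1 / sg b) ^ n) := by
  apply Integrable.mono' integrable_inv_one_add_sq (sg_inv_cont n).aestronglyMeasurable
  exact Filter.Eventually.of_forall (sg_inv_norm hn)

theorem sg_cpow (n : ℕ) (b : ℝ) : (1 / sg b) ^ n = (1 - Complex.I * b) ^ (-((n / 2 : ℝ) : ℂ)) := by
  unfold sg
  rw [Complex.cpow_neg, one_div, inv_pow, ← Complex.cpow_nat_mul]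
  congr 2
  push_cast; ring

theorem I_integral {n : ℕ} (hn : 5 ≤ n) : ∃ I0 : ℝ, 0 < I0 ∧
    ∫ b : ℝ, (1 / sg b) ^ n * Complex.exp (-(2 * Real.pi * Complex.I * b)) = I0 := by
  set s : ℝ := n / 2 with hs
  have hs2 : 2 < s := by
    have : (5:ℝ) ≤ n := by exact_mod_cast hn
    rw [hs]; linarith
  set f : ℝ → ℂ := indicator (Ioi 0) (fun t => ((t ^ (s - 1) : ℝ) : ℂ) * Complex.exp (-(2 * Real.pi * t))) with hf
  have hpi := Real.pi_pos
  have hfi : Integrable f := by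
    rw [hf, integrable_indicator_iff measurableSet_Ioi]
    have := (integrableOn_rpow_mul_exp_neg_mul_rpow (s := s - 1) (p := 1) (b := 2 * Real.pi) (by linarith) (by norm_num) (by positivity)).ofReal (𝕜 := ℂ)
    apply (integrable_congr _).1 this
    filter_upwards with t
    simp
  set C : ℂ := (Real.Gamma s : ℂ) * ((2 * Real.pi : ℝ) : ℂ) ^ (-(s:ℂ)) with hC
  have hCr : C = ((Real.Gamma s * (2 * Real.pi) ^ (-s) : ℝ) : ℂ) := by
    rw [hC, ← Complex.ofReal_neg, ← Complex.ofReal_cpow (by positivity), ← Complex.ofReal_mul]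
  have hC0 : C ≠ 0 := by
    have := Real.Gamma_pos_of_pos (show 0 < s by linarith)
    rw [hCr]
    have : (Real.Gamma s * (2 * Real.pi) ^ (-s)) ≠ 0 := by positivity
    exact_mod_cast this
  have hF : ∀ ξ : ℝ, FourierTransform.fourier f ξ = C * (1 / sg (-ξ)) ^ n := by
    intro ξ
    rw [Real.fourier_real_eq_integral_exp_smul, sg_cpow]
    have e1 : (fun v : ℝ => Complex.exp (↑(-2 * Real.pi * v * ξ) * Complex.I) • f v) =
        indicator (Ioi 0) (fun t => ((t ^ (s - 1) : ℝ) : ℂ) * Complex.exp (-(((2 * Real.pi : ℝ) * (1 + Complex.I * ξ) : ℂ) * t))) := by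
      funext v
      by_cases hv : v ∈ Ioi (0:ℝ)
      · simp only [hf, indicator_of_mem hv, smul_eq_mul]
        rw [mul_left_comm, ← Complex.exp_add]
        congr 2
        push_cast; ring
      · simp only [hf, indicator_of_notMem hv, smul_zero]
    rw [e1, integral_indicator measurableSet_Ioi, gam_int s (by linarith) _ (by simp; exact hpi)]
    rw [hC, mul_assoc]
    congr 1
    have : (1 - Complex.I * ((-ξ : ℝ) : ℂ)) = 1 + Complex.I * ξ := by push_cast; ring
    rw [this]
    have hne : (1 + Complex.I * ξ) ≠ 0 := by
      intro h
      have := congrArg Complex.re h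
      simp at this
    have hne2 : ((2 * Real.pi : ℝ) : ℂ) ≠ 0 := by
      have : (2 * Real.pi : ℝ) ≠ 0 := by positivity
      exact_mod_cast this
    rw [Complex.cpow_def_of_ne_zero (mul_ne_zero hne2 hne), Complex.cpow_def_of_ne_zero hne2, Complex.cpow_def_of_ne_zero hne, ← Complex.exp_add,
      Complex.log_ofReal_mul (by positivity) hne, ← Complex.ofReal_log (by positivity)]
    congr 1
    ring
  have hFi : Integrable (FourierTransform.fourier f) := by
    have : FourierTransform.fourier f = fun ξ => C * (1 / sg (-ξ)) ^ n := funext hF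
    rw [this]
    exact ((sg_integrable hn).comp_neg).const_mul C
  have hcont : ContinuousAt f 1 := by
    have hev : f =ᶠ[nhds 1] (fun t => ((t ^ (s - 1) : ℝ) : ℂ) * Complex.exp (-(2 * Real.pi * t))) := by
      filter_upwards [Ioi_mem_nhds (show (0:ℝ) < 1 by norm_num)] with t ht
      simp only [hf, indicator_of_mem ht]
    rw [continuousAt_congr hev]
    apply ContinuousAt.mul
    · apply Complex.continuous_ofReal.continuousAt.comp
      exact Real.continuousAt_rpow_const _ _ (Or.inl one_ne_zero)
    · fun_prop
  have hinv := hfi.fourierInv_fourier_eq hFi hcont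
  rw [Real.fourierInv_eq'] at hinv
  have hf1 : f 1 = Real.exp (-(2 * Real.pi)) := by
    simp [hf]
  rw [hf1] at hinv
  have e2 : ∫ b : ℝ, (1 / sg b) ^ n * Complex.exp (-(2 * Real.pi * Complex.I * b)) = 
     C⁻¹ * Real.exp (-(2 * Real.pi)) := by
    rw [← hinv, ← integral_neg_eq_self, ← integral_const_mul]
    congr 1
    funext v
    rw [hF]
    have e3 : (((2 * Real.pi * inner ℝ v 1 : ℝ) : ℂ) * Complex.I) = -(2 * Real.pi * Complex.I * ((-v : ℝ) : ℂ)) := by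
      simp; ring
    rw [e3, smul_eq_mul]
    field_simp
  refine ⟨(Real.Gamma s * (2 * Real.pi) ^ (-s))⁻¹ * Real.exp (-(2 * Real.pi)), ?_, ?_⟩
  · have := Real.Gamma_pos_of_pos (show 0 < s by linarith)
    positivity
  · rw [e2, hCr]
    push_cast; ring
end

section
open MeasureTheory Set

theorem prod_est {ι : Type} (S : Finset ι) (t M : ι → ℂ) (s e : ℝ) (hs : 0 ≤ s) (he : 0 ≤ e)
    (hM : ∀ i, ‖M i‖ ≤ s) (ht : ∀ i, ‖t i - M i‖ ≤ s * e) :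
    ‖∏ i ∈ S, t i - ∏ i ∈ S, M i‖ ≤ s ^ S.card * ((1 + e) ^ S.card - 1) ∧
    ‖∏ i ∈ S, t i‖ ≤ s ^ S.card * (1 + e) ^ S.card := by
  classical
  have htn : ∀ i, ‖t i‖ ≤ s * (1 + e) := by
    intro i
    have : t i = M i + (t i - M i) := by ring
    rw [this]
    refine (norm_add_le _ _).trans ?_
    have := hM i
    have := ht i
    linarith
  refine ⟨?_, ?_⟩
  · induction S using Finset.induction_on with
    | empty => simp
    | insert a S ha ih =>
      rw [Finset.prod_insert ha, Finset.prod_insert ha, Finset.card_insert_of_notMem ha]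
      have h1 : t a * ∏ i ∈ S, t i - M a * ∏ i ∈ S, M i =
        t a * (∏ i ∈ S, t i - ∏ i ∈ S, M i) + (t a - M a) * ∏ i ∈ S, M i := by ring
      have h2 : ‖∏ i ∈ S, M i‖ ≤ s ^ S.card := by
        rw [norm_prod]
        calc _ ≤ ∏ i ∈ S, s := Finset.prod_le_prod (fun _ _ => norm_nonneg _) (fun i _ => hM i)
          _ = _ := by simp
      rw [h1]
      refine (norm_add_le _ _).trans ?_
      rw [norm_mul, norm_mul]
      have h3 : ‖t a‖ * ‖∏ i ∈ S, t i - ∏ i ∈ S, M i‖ ≤ (s * (1 + e)) * (s ^ S.card * ((1 + e) ^ S.card - 1)) := by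
        gcongr; exact htn a
      have h4 : ‖t a - M a‖ * ‖∏ i ∈ S, M i‖ ≤ s * e * s ^ S.card := by
        gcongr; exact ht a
      calc _ ≤ _ := add_le_add h3 h4
        _ = _ := by ring
  · rw [norm_prod]
    calc _ ≤ ∏ i ∈ S, (s * (1 + e)) := Finset.prod_le_prod (fun _ _ => norm_nonneg _) (fun i _ => htn i)
      _ = _ := by simp [mul_pow]

noncomputable def cZ {n : ℕ} (d : Fin n → ℕ) (m : ℕ) : ℝ := ∏ i, (1 / Real.sqrt (2 * d i * m ^ 2))

theorem thM_prod {n : ℕ} (d : Fin n → ℕ) (m : ℕ) (c : Fin n → ℤ) (k : ℕ) (h : ℤ) (A b : ℝ) :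
    ∏ i, thM (d i) m (c i) k h A b =
      ((Real.sqrt A ^ n * cZ d m : ℝ) : ℂ) * (1 / sg b) ^ n * ∏ i, (gG k h (d i) m (c i) / k) := by
  unfold thM cZ
  rw [Finset.prod_mul_distrib, Finset.prod_div_distrib]
  congr 1
  push_cast
  simp only [Finset.prod_div_distrib, Finset.prod_const, Finset.card_univ, Fintype.card_fin]
  ring

theorem thF_est {n : ℕ} (hn : 5 ≤ n) (d : Fin n → ℕ) (hd : ∀ i, d i ≠ 0) (m : ℕ) (hm : m ≠ 0)
    (W : ℝ) (hW : ∀ i, 2 * (d i : ℝ) * m ^ 2 ≤ W)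
    (c : Fin n → ℤ) (k : ℕ) (hk : k ≠ 0) (h : ℤ) (hh : IsCoprime h k) {A : ℝ} (hA : 0 < A) (b : ℝ)
    (δ : ℝ) (hδ0 : 0 < δ) (hδ : δ * (W * k ^ 2 * (1 + b ^ 2)) ≤ A) :
    ‖thF d m c A (h / k + b / A) - ∏ i, thM (d i) m (c i) k h A b‖ ≤
      Real.sqrt A ^ n * (1 / Real.sqrt k) ^ 5 * (1 + b ^ 2)⁻¹ * ((1 + eE δ) ^ n - 1) ∧
    ‖thF d m c A (h / k + b / A)‖ ≤
      Real.sqrt A ^ n * (1 / Real.sqrt k) ^ 5 * (1 + b ^ 2)⁻¹ * (1 + eE δ) ^ n := by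
  set s : ℝ := Real.sqrt (A / k) / ‖sg b‖ with hs
  have hs0 : 0 ≤ s := by positivity
  have he : 0 ≤ eE δ := eE_nonneg δ
  have hkr : (1 : ℝ) ≤ k := by exact_mod_cast Nat.one_le_iff_ne_zero.2 hk
  have hsn : s ^ n ≤ Real.sqrt A ^ n * (1 / Real.sqrt k) ^ 5 * (1 + b ^ 2)⁻¹ := by
    have : s = Real.sqrt A * (1 / Real.sqrt k) * ‖1 / sg b‖ := by
      rw [hs, Real.sqrt_div hA.le]; simp; ring
    rw [this, mul_pow, mul_pow, ← norm_pow]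
    have h1 : (1 / Real.sqrt k) ^ n ≤ (1 / Real.sqrt k) ^ 5 := by
      apply pow_le_pow_of_le_one (by positivity) _ hn
      rw [one_div]
      exact inv_le_one_of_one_le₀ (by rw [Real.one_le_sqrt]; exact hkr)
    have h2 := sg_inv_norm hn b
    exact mul_le_mul (mul_le_mul_of_nonneg_left h1 (by positivity)) h2 (norm_nonneg _) (by positivity)
  have hest : ∀ i, ‖thM (d i) m (c i) k h A b‖ ≤ s ∧ ‖th (d i) m (c i) (h / k + (b + Complex.I) / A) - thM (d i) m (c i) k h A b‖ ≤ s * eE δ := by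
    intro i
    have := th_est (hd i) hm (c i) k hk h hh hA b
    refine ⟨this.1, this.2.trans ?_⟩
    gcongr
    apply eE_anti hδ0
    have hdi : (0:ℝ) < d i := by exact_mod_cast Nat.pos_of_ne_zero (hd i)
    have hmi : (0:ℝ) < m := by exact_mod_cast Nat.pos_of_ne_zero hm
    rw [le_div_iff₀ (by positivity)]
    refine le_trans ?_ hδ
    gcongr
    exact hW i
  have hF : thF d m c A (h / k + b / A) = ∏ i, th (d i) m (c i) (h / k + (b + Complex.I) / A) := by
    unfold thF
    congr 1; funext i; congr 1
    push_cast; ring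
  rw [hF]
  have := prod_est Finset.univ (fun i => th (d i) m (c i) (h / k + (b + Complex.I) / A)) (fun i => thM (d i) m (c i) k h A b) s (eE δ) hs0 he (fun i => (hest i).1) (fun i => (hest i).2)
  simp only [Finset.card_univ, Fintype.card_fin] at this
  refine ⟨this.1.trans ?_, this.2.trans ?_⟩
  · apply mul_le_mul_of_nonneg_right hsn
    have := one_le_pow₀ (n := n) (show 1 ≤ 1 + eE δ by linarith)
    linarith
  · gcongr

theorem thF_cont {n : ℕ} (d : Fin n → ℕ) (hd : ∀ i, d i ≠ 0) (m : ℕ) (hm : m ≠ 0)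
    (c : Fin n → ℤ) {A : ℝ} (hA : 0 < A) : Continuous (thF d m c A) := by
  unfold thF
  apply continuous_finsetProd
  intro i _
  have e : ∀ τ : ℂ, th (d i) m (c i) τ = Complex.exp (2 * Real.pi * Complex.I * τ * d i * c i ^ 2) *
      jacobiTheta₂ (2 * τ * d i * c i * m) (2 * τ * d i * m ^ 2) := by
    intro τ
    unfold th jacobiTheta₂
    rw [← tsum_mul_left]
    congr 1; funext t; exact thT_eq _ _ _ _ _
  simp only [e]
  apply Continuous.mul (by fun_prop)
  rw [continuous_iff_continuousAt]
  intro u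
  have h1 : 0 < ((u : ℂ) + Complex.I / A).im := by
    rw [Complex.add_im, Complex.ofReal_im, Complex.div_ofReal_im, Complex.I_im, zero_add]; positivity
  have h2 := continuousAt_jacobiTheta₂ (2 * ((u : ℂ) + Complex.I / A) * d i * c i * m) (im_scale h1 (hd i) hm)
  have h3 : ContinuousAt (fun u : ℝ => ((2 * ((u : ℂ) + Complex.I / A) * d i * c i * m, 2 * ((u : ℂ) + Complex.I / A) * d i * m ^ 2) : ℂ × ℂ)) u := by
    fun_prop
  exact ContinuousAt.comp (f := fun u : ℝ => ((2 * ((u : ℂ) + Complex.I / A) * d i * c i * m, 2 * ((u : ℂ) + Complex.I / A) * d i * m ^ 2) : ℂ × ℂ)) h2 h3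
end

section
open MeasureTheory Set

theorem arc_unique {K k k' h h' : ℕ} (hk : k ≠ 0) (hk' : k' ≠ 0) (hkK : k ≤ K) (hkK' : k' ≤ K)
    (hc : k.Coprime h) (hc' : k'.Coprime h') {ρ u : ℝ} (hρ : 2 * ρ * K ^ 2 ≤ 1)
    (h1 : |u - h / k| < ρ) (h2 : |u - h' / k'| < ρ) : k' = k ∧ h' = h := by
  have hk0 : (0:ℝ) < k := by exact_mod_cast Nat.pos_of_ne_zero hk
  have hk0' : (0:ℝ) < k' := by exact_mod_cast Nat.pos_of_ne_zero hk'
  have hkr : (k:ℝ) ≤ K := by exact_mod_cast hkK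
  have hkr' : (k':ℝ) ≤ K := by exact_mod_cast hkK'
  have h3 : |(h:ℝ) / k - h' / k'| < 2 * ρ := by
    rw [abs_lt] at *
    constructor <;> linarith
  have h4 : |(h:ℝ) * k' - h' * k| < 1 := by
    have e : (h:ℝ) * k' - h' * k = (h / k - h' / k') * (k * k') := by field_simp
    rw [e, abs_mul, abs_of_pos (show (0:ℝ) < k * k' by positivity)]
    calc _ < 2 * ρ * (k * k') := by
          apply mul_lt_mul_of_pos_right h3; positivity
      _ ≤ 2 * ρ * K ^ 2 := by
          have : 0 ≤ ρ := (abs_nonneg _).trans h1.le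
          rw [sq]; gcongr
      _ ≤ 1 := hρ
  have h5 : (h:ℤ) * k' - h' * k = 0 := by
    have : |(h:ℤ) * k' - h' * k| < 1 := by exact_mod_cast h4
    exact Int.abs_lt_one_iff.1 this
  have h6 : h * k' = h' * k := by
    have : (h:ℤ) * k' = h' * k := by linarith
    exact_mod_cast this
  have h7 : k ∣ k' := hc.dvd_of_dvd_mul_left (Dvd.intro_left h' h6.symm)
  have h8 : k' ∣ k := hc'.dvd_of_dvd_mul_left (Dvd.intro_left h h6)
  have h9 : k' = k := Nat.dvd_antisymm h8 h7
  subst h9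
  exact ⟨rfl, (Nat.eq_of_mul_eq_mul_right (Nat.pos_of_ne_zero hk) h6).symm⟩

open Classical in
noncomputable def psi (K : ℕ) (η C : ℝ) (k : ℕ) (b : ℝ) : ℝ :=
  (1 + b ^ 2)⁻¹ * (η + (if K < k then C else 0) + (if (K : ℝ) ≤ |b| then C else 0))

open Classical in
noncomputable def phi {n : ℕ} (d : Fin n → ℕ) (m : ℕ) (c : Fin n → ℤ) (A ρ : ℝ) (k h : ℕ) (u : ℝ) : ℂ :=
  if |u - h / k| < ρ then ∏ i, thM (d i) m (c i) k h A (A * (u - h / k)) else 0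

noncomputable def maj (n : ℕ) (A : ℝ) (K N : ℕ) (η C : ℝ) (u : ℝ) : ℝ :=
  ∑ k ∈ Finset.Icc 1 N, ∑ h ∈ Finset.Icc (-(2 * k : ℤ)) (2 * k),
    Real.sqrt A ^ n * (1 / Real.sqrt k) ^ 5 * psi K η C k (A * (u - h / k))

theorem psi_nonneg (K : ℕ) (η C : ℝ) (hη : 0 ≤ η) (hC : 0 ≤ C) (k : ℕ) (b : ℝ) : 0 ≤ psi K η C k b := by
  unfold psi
  split_ifs <;> positivity

theorem le_maj {n : ℕ} {A : ℝ} {K N : ℕ} {η C : ℝ} (hη : 0 ≤ η) (hC : 0 ≤ C) (u : ℝ)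
    {k : ℕ} (hk : k ≠ 0) (hkN : k ≤ N) {h : ℤ} (hu : |u| ≤ 1) (huh : |u - h / k| ≤ 1) :
    Real.sqrt A ^ n * (1 / Real.sqrt k) ^ 5 * psi K η C k (A * (u - h / k)) ≤ maj n A K N η C u := by
  have hk0 : (0:ℝ) < k := by exact_mod_cast Nat.pos_of_ne_zero hk
  have hmem : h ∈ Finset.Icc (-(2 * k : ℤ)) (2 * k) := by
    rw [abs_le] at hu huh
    have h1 : (h:ℝ) / k ≤ 2 := by linarith
    have h2 : (-2:ℝ) ≤ h / k := by linarith
    rw [div_le_iff₀ hk0] at h1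
    rw [le_div_iff₀ hk0] at h2
    rw [Finset.mem_Icc]
    constructor
    · have : -(2 * (k:ℝ)) ≤ h := by linarith
      exact_mod_cast this
    · exact_mod_cast h1
  have hnn : ∀ (k : ℕ) (h : ℤ), 0 ≤ Real.sqrt A ^ n * (1 / Real.sqrt k) ^ 5 * psi K η C k (A * (u - h / k)) := by
    intro k h
    have := psi_nonneg K η C hη hC k (A * (u - h / k))
    positivity
  unfold maj
  refine le_trans ?_ (Finset.single_le_sum (f := fun k : ℕ => ∑ h ∈ Finset.Icc (-(2 * k : ℤ)) (2 * k),
    Real.sqrt A ^ n * (1 / Real.sqrt k) ^ 5 * psi K η C k (A * (u - h / k))) (fun k _ => Finset.sum_nonneg (fun h _ => hnn k h)) (Finset.mem_Icc.2 ⟨Nat.pos_of_ne_zero hk, hkN⟩))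
  exact Finset.single_le_sum (f := fun h : ℤ => Real.sqrt A ^ n * (1 / Real.sqrt k) ^ 5 * psi K η C k (A * (u - h / k))) (fun h _ => hnn k h) hmem

set_option maxHeartbeats 1600000 in
theorem pointwise {n : ℕ} (hn : 5 ≤ n) (d : Fin n → ℕ) (hd : ∀ i, d i ≠ 0) (m : ℕ) (hm : m ≠ 0)
    (W : ℝ) (hW0 : 0 < W) (hW : ∀ i, 2 * (d i : ℝ) * m ^ 2 ≤ W) (c : Fin n → ℤ) (K : ℕ) (hK : K ≠ 0)
    (A : ℕ) (hA : 0 < A) (hAK : 2 * K ^ 3 ≤ A) (η : ℝ)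
    (hη : (1 + eE (A / (W * (K ^ 2 * (1 + K ^ 2))))) ^ n - 1 ≤ η) (u : ℝ)
    (hu1 : -((K:ℝ) / A) ≤ u) (hu2 : u ≤ 1 - (K:ℝ) / A) :
    ‖thF d m c A u - ∑ k ∈ Finset.range (K + 1), ∑ h ∈ (Finset.range k).filter (fun h => k.Coprime h), phi d m c A (K / A) k h u‖ ≤
      maj n A K (Nat.sqrt A) η ((1 + eE (1 / (2 * W))) ^ n) u := by
  have hAr : (0:ℝ) < A := by exact_mod_cast hA
  have hKr : (1:ℝ) ≤ K := by exact_mod_cast Nat.pos_of_ne_zero hK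
  have hAKr : 2 * (K:ℝ) ^ 3 ≤ A := by exact_mod_cast hAK
  set ρ : ℝ := K / A with hρdef
  have hρ0 : 0 < ρ := by positivity
  have hρ1 : 2 * ρ * K ^ 2 ≤ 1 := by
    rw [hρdef, show 2 * ((K:ℝ) / A) * K ^ 2 = (2 * K ^ 3) / A by ring, div_le_one hAr]; exact hAKr
  have hρ2 : 2 * ρ * K ≤ 1 := by
    refine le_trans ?_ hρ1
    have : (K:ℝ) ≤ K ^ 2 := by nlinarith
    gcongr
  have hρ3 : 2 * ρ ≤ 1 := by nlinarith
  have huabs : |u| ≤ 1 := by rw [abs_le]; constructor <;> linarith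
  have hη0 : 0 ≤ η := by
    refine le_trans ?_ hη
    have := one_le_pow₀ (n := n) (show 1 ≤ 1 + eE (A / (W * (K ^ 2 * (1 + K ^ 2)))) by linarith [eE_nonneg (A / (W * (K ^ 2 * (1 + K ^ 2))))])
    linarith
  have hC0 : 0 ≤ (1 + eE (1 / (2 * W))) ^ n := by
    have := eE_nonneg (1 / (2 * W))
    positivity
  set C := (1 + eE (1 / (2 * W))) ^ n with hC
  by_cases hcase : ∃ k h : ℕ, k ≠ 0 ∧ k ≤ K ∧ h < k ∧ k.Coprime h ∧ |u - h / k| < ρ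
  · obtain ⟨k, h, hk, hkK, hhk, hcop, hclose⟩ := hcase
    have hE : ∑ k ∈ Finset.range (K + 1), ∑ h ∈ (Finset.range k).filter (fun h => k.Coprime h), phi d m c A ρ k h u = phi d m c A ρ k h u := by
      have huniq : ∀ k' h' : ℕ, k' ≤ K → h' < k' → k'.Coprime h' → ¬ (k' = k ∧ h' = h) → phi d m c A ρ k' h' u = 0 := by
        intro k' h' hk' hh' hc' hne
        unfold phi
        rw [if_neg]
        intro hlt
        exact hne (arc_unique hk (by omega) hkK hk' hcop hc' hρ1 hclose hlt)
      rw [Finset.sum_eq_single k]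
      · rw [Finset.sum_eq_single h]
        · intro h' hh' hne
          simp only [Finset.mem_filter, Finset.mem_range] at hh'
          exact huniq k h' hkK hh'.1 hh'.2 (fun h => hne h.2)
        · intro hnm; exact absurd (Finset.mem_filter.2 ⟨Finset.mem_range.2 hhk, hcop⟩) hnm
      · intro k' hk' hne
        apply Finset.sum_eq_zero
        intro h' hh'
        simp only [Finset.mem_filter, Finset.mem_range] at hh' hk'
        exact huniq k' h' (by omega) hh'.1 hh'.2 (fun h => hne h.1)
      · intro hnm; exact absurd (by simp; omega) hnm
    rw [hE]
    unfold phi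
    rw [if_pos hclose]
    set b := A * (u - h / k) with hb
    have hbK : |b| < K := by
      rw [hb, abs_mul, abs_of_pos hAr]
      calc _ < A * ρ := by gcongr
        _ = K := by rw [hρdef]; field_simp
    have hbK2 : b ^ 2 ≤ K ^ 2 := by
      rw [← sq_abs b]; gcongr
    have hkKr : (k:ℝ) ≤ K := by exact_mod_cast hkK
    have hest := (thF_est hn d hd m hm W hW c k hk h (Nat.isCoprime_iff_coprime.2 hcop.symm) hAr b
      (A / (W * (K ^ 2 * (1 + K ^ 2)))) (by positivity) (by
        rw [div_mul_eq_mul_div, div_le_iff₀ (by positivity)]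
        rw [mul_assoc W]
        gcongr)).1
    have hu : u = ((h:ℤ):ℝ) / k + b / A := by rw [hb]; push_cast; field_simp; ring
    rw [← hu] at hest
    refine hest.trans ?_
    have hNk : k ≤ Nat.sqrt A := by
      rw [Nat.le_sqrt]
      calc k * k ≤ K * K := by gcongr
        _ ≤ 2 * K ^ 3 := by
            have : 1 ≤ K := Nat.pos_of_ne_zero hK
            nlinarith [Nat.mul_le_mul_left (K * K) this]
        _ ≤ A := hAK
    refine le_trans ?_ (le_maj (h := h) hη0 hC0 u hk hNk huabs (by push_cast; linarith))
    rw [mul_assoc, mul_assoc, mul_assoc]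
    push_cast
    rw [← hb]
    apply mul_le_mul_of_nonneg_left _ (by positivity)
    apply mul_le_mul_of_nonneg_left _ (by positivity)
    unfold psi
    apply mul_le_mul_of_nonneg_left _ (by positivity)
    refine hη.trans ?_
    split_ifs <;> linarith
  · have hE : ∑ k ∈ Finset.range (K + 1), ∑ h ∈ (Finset.range k).filter (fun h => k.Coprime h), phi d m c A ρ k h u = 0 := by
      apply Finset.sum_eq_zero
      intro k hk
      apply Finset.sum_eq_zero
      intro h hh
      simp only [Finset.mem_filter, Finset.mem_range] at hh hk
      unfold phi
      rw [if_neg]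
      intro hlt
      exact hcase ⟨k, h, by omega, by omega, hh.1, hh.2, hlt⟩
    rw [hE, sub_zero]
    have hN0 : 0 < Nat.sqrt A := Nat.sqrt_pos.2 hA
    obtain ⟨q, hq1, hq2⟩ := Real.exists_rat_abs_sub_le_and_den_le u hN0
    set k := q.den with hkdef
    have hk : k ≠ 0 := q.den_nz
    have hk0 : (1:ℝ) ≤ k := by exact_mod_cast Nat.pos_of_ne_zero hk
    set h := q.num with hhdef
    have hqq : (q:ℝ) = h / k := by rw [hkdef, hhdef]; exact Rat.cast_def q
    rw [hqq] at hq1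
    set N := Nat.sqrt A with hN
    have hN1 : (N:ℝ) ^ 2 ≤ A := by
      have := Nat.sqrt_le' A
      exact_mod_cast this
    have hN2 : (A:ℝ) ≤ (N + 1) ^ 2 := by
      have := (Nat.lt_succ_sqrt' A).le
      exact_mod_cast this
    have hkN : (k:ℝ) ≤ N := by exact_mod_cast hq2
    set b := A * (u - h / k) with hb
    have hkb : k * |b| ≤ A / (N + 1) := by
      rw [hb, abs_mul, abs_of_pos hAr]
      calc (k:ℝ) * (A * |u - h / k|) ≤ k * (A * (1 / ((N + 1) * k))) := by gcongr
        _ = A / (N + 1) := by field_simp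
    have hkb2 : (k:ℝ) ^ 2 * (1 + b ^ 2) ≤ 2 * A := by
      have h1 : (k * |b|) ^ 2 ≤ A := by
        calc _ ≤ (A / (N + 1) : ℝ) ^ 2 := by gcongr
          _ = A * (A / (N + 1) ^ 2) := by rw [div_pow]; ring
          _ ≤ A * 1 := by
            gcongr
            rw [div_le_one (by positivity)]; exact hN2
          _ = A := mul_one _
      rw [mul_pow, sq_abs] at h1
      have h2 : (k:ℝ) ^ 2 ≤ N ^ 2 := by gcongr
      nlinarith
    have hest := (thF_est hn d hd m hm W hW c k hk h (by
        rw [Int.isCoprime_iff_gcd_eq_one]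
        exact q.reduced) hAr b
      (1 / (2 * W)) (by positivity) (by
        rw [div_mul_eq_mul_div, div_le_iff₀ (by positivity)]
        nlinarith)).2
    have hu : u = (h:ℝ) / k + b / A := by rw [hb]; field_simp; ring
    rw [← hu] at hest
    refine hest.trans ?_
    have hle1 : |u - h / k| ≤ 1 := by
      refine hq1.trans ?_
      rw [div_le_one (by positivity)]
      have : (0:ℝ) ≤ N := by positivity
      nlinarith
    refine le_trans ?_ (le_maj (h := h) hη0 hC0 u hk hq2 huabs hle1)
    rw [mul_assoc, mul_assoc, mul_assoc]
    rw [← hb]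
    apply mul_le_mul_of_nonneg_left _ (by positivity)
    apply mul_le_mul_of_nonneg_left _ (by positivity)
    unfold psi
    apply mul_le_mul_of_nonneg_left _ (by positivity)
    by_cases hKk : K < k
    · rw [if_pos hKk]
      split_ifs <;> linarith
    by_cases hKb : (K:ℝ) ≤ |b|
    · rw [if_pos hKb, if_neg hKk]
      linarith
    exfalso
    apply hcase
    push Not at hKk hKb
    have hlt : |u - h / k| < ρ := by
      rw [hb, abs_mul, abs_of_pos hAr] at hKb
      rw [hρdef, lt_div_iff₀ hAr]; linarith
    have hkKr : (k:ℝ) ≤ K := by exact_mod_cast hKk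
    have hlt' := abs_lt.1 hlt
    have h1 : (h:ℝ) / k < 1 := by linarith
    have h2 : (-1:ℝ) < h := by
      have h3 : -(2 * ρ) < h / k := by linarith
      rw [lt_div_iff₀ (by linarith)] at h3
      have : 2 * ρ * k ≤ 2 * ρ * K := by gcongr
      linarith
    rw [div_lt_one (by linarith)] at h1
    have h1' : h < k := by exact_mod_cast h1
    have h2' : -1 < h := by exact_mod_cast h2
    obtain ⟨h0, hh0⟩ : ∃ h0 : ℕ, h = h0 := ⟨h.toNat, by omega⟩
    refine ⟨k, h0, hk, hKk, by omega, ?_, ?_⟩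
    · have : q.num.natAbs = h0 := by omega
      rw [← this]
      exact q.reduced.symm
    · have : (h0 : ℝ) = (h:ℝ) := by rw [hh0]; simp
      rw [this]; exact hlt
end

section
open MeasureTheory Set

open Classical in
noncomputable def tauf (K : ℕ) (b : ℝ) : ℝ := (1 + b ^ 2)⁻¹ * (if (K : ℝ) ≤ |b| then 1 else 0)

noncomputable def tau (K : ℕ) : ℝ := ∫ b, tauf K b

theorem tauf_nonneg (K : ℕ) (b : ℝ) : 0 ≤ tauf K b := by
  unfold tauf; split_ifs <;> positivity

theorem tauf_le (K : ℕ) (b : ℝ) : tauf K b ≤ (1 + b ^ 2)⁻¹ := by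
  unfold tauf; split_ifs
  · simp
  · simp; positivity

theorem tauf_meas (K : ℕ) : Measurable (tauf K) := by
  unfold tauf
  apply Measurable.mul (by fun_prop)
  apply Measurable.ite _ measurable_const measurable_const
  exact measurableSet_le measurable_const (by fun_prop)

theorem tauf_int (K : ℕ) : Integrable (tauf K) := by
  apply integrable_inv_one_add_sq.mono' (tauf_meas K).aestronglyMeasurable
  filter_upwards with b
  rw [Real.norm_of_nonneg (tauf_nonneg K b)]
  exact tauf_le K b

theorem tau_nonneg (K : ℕ) : 0 ≤ tau K := integral_nonneg (tauf_nonneg K)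

theorem tau_tendsto : Filter.Tendsto tau Filter.atTop (nhds 0) := by
  have := tendsto_integral_of_dominated_convergence (μ := volume) (F := tauf) (f := fun _ => (0:ℝ)) (fun b : ℝ => (1 + b ^ 2)⁻¹)
    (fun K => (tauf_meas K).aestronglyMeasurable) integrable_inv_one_add_sq
    (fun K => by
      filter_upwards with b
      rw [Real.norm_of_nonneg (tauf_nonneg K b)]
      exact tauf_le K b)
    (by
      filter_upwards with b
      apply tendsto_const_nhds.congr'
      filter_upwards [Filter.eventually_gt_atTop (Nat.ceil |b|)] with K hK
      unfold tauf
      rw [if_neg, mul_zero]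
      rw [not_le]
      exact (Nat.le_ceil _).trans_lt (by exact_mod_cast hK))
  rw [integral_zero] at this
  exact this

theorem psi_eq (K : ℕ) (η C : ℝ) (k : ℕ) : psi K η C k =
    fun b => (η + (if K < k then C else 0)) * (1 + b ^ 2)⁻¹ + C * tauf K b := by
  funext b
  unfold psi tauf
  split_ifs <;> ring

theorem psi_integrable (K : ℕ) (η C : ℝ) (k : ℕ) : Integrable (psi K η C k) := by
  rw [psi_eq]
  exact (integrable_inv_one_add_sq.const_mul _).add ((tauf_int K).const_mul C)

theorem psi_integral (K : ℕ) (η C : ℝ) (k : ℕ) : ∫ b, psi K η C k b =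
    (η + (if K < k then C else 0)) * Real.pi + C * tau K := by
  rw [psi_eq, integral_add (integrable_inv_one_add_sq.const_mul _) ((tauf_int K).const_mul C),
    integral_const_mul, integral_const_mul, integral_univ_inv_one_add_sq]
  rfl

theorem psi_comp_integrable (K : ℕ) (η C : ℝ) (k : ℕ) {A : ℝ} (hA : 0 < A) (x : ℝ) :
    Integrable (fun u => psi K η C k (A * (u - x))) :=
  ((psi_integrable K η C k).comp_mul_left' hA.ne').comp_sub_right x

theorem psi_comp_integral (K : ℕ) (η C : ℝ) (k : ℕ) {A : ℝ} (hA : 0 < A) (x : ℝ) :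
    ∫ u, psi K η C k (A * (u - x)) = A⁻¹ * ∫ b, psi K η C k b := by
  rw [integral_sub_right_eq_self (fun u => psi K η C k (A * u)) x, Measure.integral_comp_mul_left]
  rw [abs_of_pos (by positivity), smul_eq_mul]

theorem maj_integrable (n : ℕ) {A : ℝ} (hA : 0 < A) (K N : ℕ) (η C : ℝ) : Integrable (maj n A K N η C) := by
  unfold maj
  apply integrable_finsetSum
  intro k _
  apply integrable_finsetSum
  intro h _
  exact (psi_comp_integrable K η C k hA _).const_mul _

theorem maj_integral (n : ℕ) {A : ℝ} (hA : 0 < A) (K N : ℕ) {η C S ε1 : ℝ} (hη : 0 ≤ η) (hC : 0 ≤ C)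
    (hS : ∀ t : Finset ℕ, ∑ k ∈ t, (1 / Real.sqrt k) ^ 3 ≤ S)
    (hε : ∀ t : Finset ℕ, (∀ k ∈ t, K < k) → ∑ k ∈ t, (1 / Real.sqrt k) ^ 3 ≤ ε1) :
    ∫ u, maj n A K N η C u ≤ Real.sqrt A ^ n / A * (5 * (Real.pi * η * S + Real.pi * C * ε1 + C * tau K * S)) := by
  have hpi := Real.pi_pos
  have htau := tau_nonneg K
  unfold maj
  rw [integral_finsetSum _ (fun k _ => integrable_finsetSum _ (fun h _ => (psi_comp_integrable K η C k hA _).const_mul _))]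
  have h1 : ∀ k ∈ Finset.Icc 1 N, ∫ u, ∑ h ∈ Finset.Icc (-(2 * k : ℤ)) (2 * k), Real.sqrt A ^ n * (1 / Real.sqrt k) ^ 5 * psi K η C k (A * (u - h / k)) ≤
      Real.sqrt A ^ n / A * 5 * ((Real.pi * η + C * tau K) * (1 / Real.sqrt k) ^ 3 + Real.pi * C * (if K < k then (1 / Real.sqrt k) ^ 3 else 0)) := by
    intro k hk
    rw [Finset.mem_Icc] at hk
    have hk1 : (1:ℝ) ≤ k := by exact_mod_cast hk.1
    rw [integral_finsetSum _ (fun h _ => (psi_comp_integrable K η C k hA _).const_mul _)]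
    simp only [integral_const_mul, psi_comp_integral K η C k hA, psi_integral]
    rw [Finset.sum_const, nsmul_eq_mul]
    have hcard : ((Finset.Icc (-(2 * k : ℤ)) (2 * k)).card : ℝ) ≤ 5 * (Real.sqrt k) ^ 2 := by
      rw [Int.card_Icc, Real.sq_sqrt (by positivity)]
      have : (2 * (k:ℤ) + 1 - -(2 * k)).toNat = 4 * k + 1 := by omega
      rw [this]; push_cast; linarith
    have hsq : 0 < Real.sqrt k := Real.sqrt_pos.2 (by linarith)
    have hX : 0 ≤ (η + if K < k then C else 0) * Real.pi + C * tau K := by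
      split_ifs <;> positivity
    calc _ ≤ 5 * (Real.sqrt k) ^ 2 * (Real.sqrt A ^ n * (1 / Real.sqrt k) ^ 5 * (A⁻¹ * ((η + if K < k then C else 0) * Real.pi + C * tau K))) := by
          gcongr
      _ = Real.sqrt A ^ n / A * 5 * (((η + if K < k then C else 0) * Real.pi + C * tau K) * (1 / Real.sqrt k) ^ 3) := by
          field_simp
      _ = _ := by
          congr 1
          split_ifs <;> ring
  refine (Finset.sum_le_sum h1).trans ?_
  rw [← Finset.mul_sum, Finset.sum_add_distrib, ← Finset.mul_sum, ← Finset.mul_sum, mul_assoc]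
  have h2 := hS (Finset.Icc 1 N)
  have h3 := hε ((Finset.Icc 1 N).filter (fun k => K < k)) (fun k hk => (Finset.mem_filter.1 hk).2)
  rw [Finset.sum_filter] at h3
  apply mul_le_mul_of_nonneg_left _ (by positivity)
  apply mul_le_mul_of_nonneg_left _ (by norm_num)
  calc _ ≤ (Real.pi * η + C * tau K) * S + Real.pi * C * ε1 := by gcongr
    _ = _ := by ring
end

section
open MeasureTheory Set

noncomputable def iK (n K : ℕ) : ℂ := ∫ b in (-(K:ℝ))..K, (1 / sg b) ^ n * Complex.exp (-(2 * Real.pi * Complex.I * b))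

theorem iK_close {n : ℕ} (hn : 5 ≤ n) (K : ℕ) :
    ‖(∫ b : ℝ, (1 / sg b) ^ n * Complex.exp (-(2 * Real.pi * Complex.I * b))) - iK n K‖ ≤ tau K := by
  set g : ℝ → ℂ := fun b => (1 / sg b) ^ n * Complex.exp (-(2 * Real.pi * Complex.I * b)) with hg
  have hnorm : ∀ b, ‖g b‖ ≤ (1 + b ^ 2)⁻¹ := by
    intro b
    rw [hg]
    simp only
    rw [norm_mul]
    have : ‖Complex.exp (-(2 * Real.pi * Complex.I * b))‖ = 1 := by
      rw [Complex.norm_exp]; simp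
    rw [this, mul_one]
    exact sg_inv_norm hn b
  have hcont : Continuous g := by
    rw [hg]
    exact (sg_inv_cont n).mul (by fun_prop)
  have hgi : Integrable g := by
    apply integrable_inv_one_add_sq.mono' hcont.aestronglyMeasurable
    filter_upwards with b using hnorm b
  have hS : MeasurableSet (Ioo (-(K:ℝ)) K) := measurableSet_Ioo
  have e1 : iK n K = ∫ b in Ioo (-(K:ℝ)) K, g b := by
    unfold iK
    rw [intervalIntegral.integral_of_le (by linarith [show (0:ℝ) ≤ K by positivity]), integral_Ioc_eq_integral_Ioo]
  change ‖(∫ b, g b) - iK n K‖ ≤ tau K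
  rw [e1, ← integral_add_compl hS hgi, add_sub_cancel_left]
  have e2 : tau K = ∫ b in (Ioo (-(K:ℝ)) K)ᶜ, (1 + b ^ 2)⁻¹ := by
    rw [← integral_indicator hS.compl]
    unfold tau
    congr 1
    funext b
    unfold tauf indicator
    have : b ∈ (Ioo (-(K:ℝ)) K)ᶜ ↔ (K:ℝ) ≤ |b| := by
      rw [mem_compl_iff, mem_Ioo, ← abs_lt, not_lt]
    by_cases h : (K:ℝ) ≤ |b|
    · rw [if_pos h, if_pos (this.2 h), mul_one]
    · rw [if_neg h, if_neg (fun h' => h (this.1 h')), mul_zero]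
  rw [e2]
  apply norm_integral_le_of_norm_le integrable_inv_one_add_sq.integrableOn
  filter_upwards with b using hnorm b

theorem phi_eq {n : ℕ} (d : Fin n → ℕ) (m : ℕ) (c : Fin n → ℤ) {A : ℝ} (K : ℕ) (k h : ℕ) :
    phi d m c A (K / A) k h = indicator (Ioo ((h:ℝ) / k - K / A) (h / k + K / A))
        (fun u => ((Real.sqrt A ^ n * cZ d m : ℝ) : ℂ) * (1 / sg (A * (u - h / k))) ^ n * ∏ i, (gG k h (d i) m (c i) / k)) := by
  funext u
  unfold phi indicator
  have : u ∈ Ioo ((h:ℝ) / k - K / A) (h / k + K / A) ↔ |u - h / k| < K / A := by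
    rw [mem_Ioo, abs_lt]
    constructor <;> rintro ⟨h1, h2⟩ <;> constructor <;> linarith
  by_cases hc : |u - h / k| < K / A
  · rw [if_pos hc, if_pos (this.2 hc), thM_prod]
  · rw [if_neg hc, if_neg (fun h' => hc (this.1 h'))]

theorem phi_integrable {n : ℕ} (d : Fin n → ℕ) (m : ℕ) (c : Fin n → ℤ) {A : ℝ} (K : ℕ) (k h : ℕ) :
    Integrable (fun u : ℝ => phi d m c A (K / A) k h u * Complex.exp (-(2 * Real.pi * Complex.I * A * u))) := by
  have e : (fun u : ℝ => phi d m c A (K / A) k h u * Complex.exp (-(2 * Real.pi * Complex.I * A * u))) =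
    indicator (Ioo ((h:ℝ) / k - K / A) (h / k + K / A)) (fun u => (((Real.sqrt A ^ n * cZ d m : ℝ) : ℂ) * (1 / sg (A * (u - h / k))) ^ n * ∏ i, (gG k h (d i) m (c i) / k)) * Complex.exp (-(2 * Real.pi * Complex.I * A * u))) := by
    funext u
    rw [phi_eq]
    unfold indicator
    split_ifs <;> simp
  rw [e, integrable_indicator_iff measurableSet_Ioo]
  apply IntegrableOn.mono_set (t := Icc ((h:ℝ) / k - K / A) (h / k + K / A)) _ Ioo_subset_Icc_self
  apply Continuous.integrableOn_Icc
  apply Continuous.mul _ (by fun_prop)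
  apply Continuous.mul _ continuous_const
  apply Continuous.mul continuous_const
  exact (sg_inv_cont n).comp (by fun_prop)

theorem phi_integral {n : ℕ} (d : Fin n → ℕ) (m : ℕ) (c : Fin n → ℤ) {A : ℝ} (hA : 0 < A) (K : ℕ) (k h : ℕ)
    (hk : k ≠ 0) (hkK : k ≤ K) (hh : h < k) (hρ : 2 * ((K:ℝ) / A) * K ≤ 1) :
    ∫ u in Ioc (-((K:ℝ) / A)) (1 - K / A), phi d m c A (K / A) k h u * Complex.exp (-(2 * Real.pi * Complex.I * A * u)) =
      ((Real.sqrt A ^ n / A * cZ d m : ℝ) : ℂ) * iK n K *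
        ((∏ i, (gG k h (d i) m (c i) / k)) * Complex.exp (-(2 * Real.pi * Complex.I * A * h / k))) := by
  have hk0 : (0:ℝ) < k := by exact_mod_cast Nat.pos_of_ne_zero hk
  have hkr : (k:ℝ) ≤ K := by exact_mod_cast hkK
  have hhr : (h:ℝ) + 1 ≤ k := by exact_mod_cast hh
  have hρ0 : 0 ≤ (K:ℝ) / A := by positivity
  have hsub : Ioo ((h:ℝ) / k - K / A) (h / k + K / A) ⊆ Ioc (-((K:ℝ) / A)) (1 - K / A) := by
    intro u hu
    have h1 : (0:ℝ) ≤ h / k := by positivity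
    have h2 : (h:ℝ) / k + 2 * (K / A) ≤ 1 := by
      have : 2 * ((K:ℝ) / A) ≤ 1 / k := by
        rw [le_div_iff₀ hk0]
        refine le_trans ?_ hρ
        gcongr
      calc (h:ℝ) / k + 2 * (K / A) ≤ h / k + 1 / k := by gcongr
        _ = (h + 1) / k := by ring
        _ ≤ 1 := by rw [div_le_one hk0]; exact hhr
    exact ⟨by linarith [hu.1], by linarith [hu.2]⟩
  set G : ℂ := ∏ i, (gG k h (d i) m (c i) / k) with hG
  set g : ℝ → ℂ := fun b => (1 / sg b) ^ n * Complex.exp (-(2 * Real.pi * Complex.I * b)) with hg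
  have e : (fun u : ℝ => phi d m c A (K / A) k h u * Complex.exp (-(2 * Real.pi * Complex.I * A * u))) =
    indicator (Ioo ((h:ℝ) / k - K / A) (h / k + K / A)) (fun u => (((Real.sqrt A ^ n * cZ d m : ℝ) : ℂ) * (G * Complex.exp (-(2 * Real.pi * Complex.I * A * h / k)))) * g (A * u - A * (h / k))) := by
    funext u
    rw [phi_eq]
    unfold indicator
    split_ifs
    · rw [hg, ← hG]
      simp only
      have : Complex.exp (-(2 * Real.pi * Complex.I * A * u)) = Complex.exp (-(2 * Real.pi * Complex.I * A * h / k)) * Complex.exp (-(2 * Real.pi * Complex.I * ((A * u - A * (h / k) : ℝ) : ℂ))) := by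
        rw [← Complex.exp_add]
        congr 1
        push_cast; ring
      rw [this, mul_sub]
      ring
    · simp
  rw [e, setIntegral_indicator measurableSet_Ioo, inter_eq_right.2 hsub, integral_const_mul,
    ← integral_Ioc_eq_integral_Ioo, ← intervalIntegral.integral_of_le (by linarith),
    intervalIntegral.integral_comp_mul_sub g hA.ne']
  have e1 : A * ((h:ℝ) / k - K / A) - A * (h / k) = -(K:ℝ) := by field_simp; ring
  have e2 : A * ((h:ℝ) / k + K / A) - A * (h / k) = K := by field_simp; ring
  rw [e1, e2]
  have : ∫ x in (-(K:ℝ))..K, g x = iK n K := rfl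
  rw [this, Complex.real_smul]
  push_cast
  field_simp
end

section
open MeasureTheory Set

theorem circle1 {n : ℕ} (hn : 5 ≤ n) (d : Fin n → ℕ) (hd : ∀ i, d i ≠ 0) (m : ℕ) (hm : m ≠ 0)
    (W : ℝ) (hW0 : 0 < W) (hW : ∀ i, 2 * (d i : ℝ) * m ^ 2 ≤ W) (c : Fin n → ℤ) (K : ℕ) (hK : K ≠ 0)
    (A : ℕ) (hA : 0 < A) (hAK : 2 * K ^ 3 ≤ A) (η S ε1 : ℝ)
    (hη : (1 + eE (A / (W * (K ^ 2 * (1 + K ^ 2))))) ^ n - 1 ≤ η)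
    (hS : ∀ t : Finset ℕ, ∑ k ∈ t, (1 / Real.sqrt k) ^ 3 ≤ S)
    (hε : ∀ t : Finset ℕ, (∀ k ∈ t, K < k) → ∑ k ∈ t, (1 / Real.sqrt k) ^ 3 ≤ ε1) :
    ‖(Real.exp (-(2 * Real.pi)) : ℂ) * ((repS d m c A).ncard : ℂ) - ((Real.sqrt A ^ n / A * cZ d m : ℝ) : ℂ) * iK n K *
        ∑ k ∈ Finset.range (K + 1), sA d m c A k‖ ≤
      Real.sqrt A ^ n / A * (5 * (Real.pi * η * S + Real.pi * (1 + eE (1 / (2 * W))) ^ n * ε1 + (1 + eE (1 / (2 * W))) ^ n * tau K * S)) := by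
  have hAr : (0:ℝ) < A := by exact_mod_cast hA
  have hKr : (1:ℝ) ≤ K := by exact_mod_cast Nat.pos_of_ne_zero hK
  have hAKr : 2 * (K:ℝ) ^ 3 ≤ A := by exact_mod_cast hAK
  have hρ : 2 * ((K:ℝ) / A) * K ≤ 1 := by
    rw [show 2 * ((K:ℝ) / A) * K = (2 * K ^ 2) / A by ring, div_le_one hAr]
    nlinarith
  have hη0 : 0 ≤ η := by
    refine le_trans ?_ hη
    have := one_le_pow₀ (n := n) (show 1 ≤ 1 + eE (A / (W * (K ^ 2 * (1 + K ^ 2)))) by linarith [eE_nonneg (A / (W * (K ^ 2 * (1 + K ^ 2))))])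
    linarith
  have hC0 : 0 ≤ (1 + eE (1 / (2 * W))) ^ n := by
    have := eE_nonneg (1 / (2 * W))
    positivity
  have hI := (thF_integral d hd m hm c A hA (-((K:ℝ) / A))).2
  rw [intervalIntegral.integral_of_le (by linarith), show -((K:ℝ) / A) + 1 = 1 - K / A by ring] at hI
  set U := Ioc (-((K:ℝ) / A)) (1 - K / A) with hU
  set E : ℝ → ℂ := fun u => ∑ k ∈ Finset.range (K + 1), ∑ h ∈ (Finset.range k).filter (fun h => k.Coprime h), phi d m c A (K / A) k h u with hE
  have hEe : ∀ u : ℝ, E u * Complex.exp (-(2 * Real.pi * Complex.I * A * u)) =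
     ∑ k ∈ Finset.range (K + 1), ∑ h ∈ (Finset.range k).filter (fun h => k.Coprime h), (phi d m c A (K / A) k h u * Complex.exp (-(2 * Real.pi * Complex.I * A * u))) := by
    intro u
    simp only [hE, Finset.sum_mul]
  have hphi := fun k h => (phi_integrable d m c (A := A) K k h)
  simp only [Complex.ofReal_natCast] at hphi
  have hEint : IntegrableOn (fun u : ℝ => E u * Complex.exp (-(2 * Real.pi * Complex.I * A * u))) U := by
    simp only [hEe]
    exact (integrable_finsetSum _ (fun k _ => integrable_finsetSum _ (fun h _ => hphi k h))).integrableOn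
  have hEI : ∫ u in U, E u * Complex.exp (-(2 * Real.pi * Complex.I * A * u)) =
      ((Real.sqrt A ^ n / A * cZ d m : ℝ) : ℂ) * iK n K * ∑ k ∈ Finset.range (K + 1), sA d m c A k := by
    simp only [hEe]
    rw [integral_finsetSum _ (fun k _ => (integrable_finsetSum _ (fun h _ => hphi k h)).integrableOn), Finset.mul_sum]
    apply Finset.sum_congr rfl
    intro k hk
    rw [integral_finsetSum _ (fun h _ => (hphi k h).integrableOn)]
    unfold sA
    rw [Finset.mul_sum]
    apply Finset.sum_congr rfl
    intro h hh
    rw [Finset.mem_filter, Finset.mem_range] at hh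
    rw [Finset.mem_range] at hk
    have := phi_integral d m c hAr K k h (by omega) (by omega) hh.1 hρ
    simp only [Complex.ofReal_natCast] at this
    rw [this]
    simp
  have hFint : IntegrableOn (fun u : ℝ => thF d m c A u * Complex.exp (-(2 * Real.pi * Complex.I * A * u))) U := by
    apply IntegrableOn.mono_set (t := Icc (-((K:ℝ) / A)) (1 - K / A)) _ Ioc_subset_Icc_self
    apply Continuous.integrableOn_Icc
    exact (thF_cont d hd m hm c hAr).mul (by fun_prop)
  rw [← hI, ← hEI, ← integral_sub hFint hEint]
  have hmaj := maj_integral n hAr K (Nat.sqrt A) (C := (1 + eE (1 / (2 * W))) ^ n) hη0 hC0 hS hε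
  refine le_trans ?_ hmaj
  have hmi := maj_integrable n hAr K (Nat.sqrt A) η ((1 + eE (1 / (2 * W))) ^ n)
  have hmn : ∀ u, 0 ≤ maj n A K (Nat.sqrt A) η ((1 + eE (1 / (2 * W))) ^ n) u := by
    intro u
    unfold maj
    apply Finset.sum_nonneg; intro k _
    apply Finset.sum_nonneg; intro h _
    have := psi_nonneg K η _ hη0 hC0 k (A * (u - h / k))
    positivity
  refine le_trans ?_ (setIntegral_le_integral hmi (s := U) (by filter_upwards with u using hmn u))
  apply norm_integral_le_of_norm_le hmi.integrableOn
  filter_upwards [ae_restrict_mem measurableSet_Ioc] with u hu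
  rw [← sub_mul, norm_mul]
  have : ‖Complex.exp (-(2 * Real.pi * Complex.I * A * u))‖ = 1 := by
    rw [Complex.norm_exp]; simp
  rw [this, mul_one]
  exact pointwise hn d hd m hm W hW0 hW c K hK A hA hAK η hη u hu.1.le hu.2

theorem sA_norm2 {n : ℕ} (hn : 5 ≤ n) (d : Fin n → ℕ) (hd : ∀ i, d i ≠ 0) (m : ℕ) (hm : m ≠ 0)
    (W : ℝ) (hW0 : 0 < W) (hW : ∀ i, 2 * (d i : ℝ) * m ^ 2 ≤ W) (c : Fin n → ℤ) (A : ℤ) (k : ℕ) :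
    ‖sA d m c A k‖ ≤ Real.sqrt W ^ n * (1 / Real.sqrt k) ^ 3 := by
  rcases Nat.eq_zero_or_pos k with rfl | hk
  · simp [sA]
  have hk0 : (1:ℝ) ≤ k := by exact_mod_cast hk
  have hsq : 0 < Real.sqrt k := Real.sqrt_pos.2 (by linarith)
  unfold sA
  have h1 : ∀ h ∈ (Finset.range k).filter (fun h => k.Coprime h), ‖(∏ i, (gG k h (d i) m (c i) / k)) * Complex.exp (-(2 * Real.pi * Complex.I * A * h / k))‖ ≤ Real.sqrt W ^ n * (1 / Real.sqrt k) ^ 5 := by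
    intro h hh
    rw [Finset.mem_filter] at hh
    rw [norm_mul]
    have : ‖Complex.exp (-(2 * Real.pi * Complex.I * A * h / k))‖ = 1 := by
      have e : (-(2 * Real.pi * Complex.I * A * h / k)) = ((-(2 * Real.pi * A * h / k) : ℝ) : ℂ) * Complex.I := by push_cast; ring
      rw [e, Complex.norm_exp_ofReal_mul_I]
    rw [this, mul_one, norm_prod]
    calc _ ≤ ∏ i : Fin n, (Real.sqrt W * (1 / Real.sqrt k)) := by
          apply Finset.prod_le_prod (fun _ _ => norm_nonneg _)
          intro i _
          refine (gG_div_norm k hk.ne' h hh.2 (d i) m (c i)).trans ?_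
          rw [← Real.sqrt_one, ← Real.sqrt_div (by norm_num), ← Real.sqrt_mul hW0.le, mul_one_div]
          apply Real.sqrt_le_sqrt
          gcongr
          refine le_trans ?_ (hW i)
          have : Nat.gcd k (2 * d i * m ^ 2) ≤ 2 * d i * m ^ 2 := Nat.gcd_le_right _ (by have := hd i; positivity)
          exact_mod_cast this
      _ = Real.sqrt W ^ n * (1 / Real.sqrt k) ^ n := by simp [mul_pow]
      _ ≤ _ := by
        apply mul_le_mul_of_nonneg_left _ (by positivity)
        apply pow_le_pow_of_le_one (by positivity) _ hn
        rw [one_div]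
        exact inv_le_one_of_one_le₀ (by rw [Real.one_le_sqrt]; exact hk0)
  refine (norm_sum_le_of_le _ h1).trans ?_
  rw [Finset.sum_const, nsmul_eq_mul]
  have hcard : (((Finset.range k).filter (fun h => k.Coprime h)).card : ℝ) ≤ Real.sqrt k ^ 2 := by
    rw [Real.sq_sqrt (by positivity)]
    have := Finset.card_filter_le (Finset.range k) (fun h => k.Coprime h)
    rw [Finset.card_range] at this
    exact_mod_cast this
  calc _ ≤ Real.sqrt k ^ 2 * (Real.sqrt W ^ n * (1 / Real.sqrt k) ^ 5) := by gcongr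
    _ = _ := by field_simp
end

section
open MeasureTheory Set

theorem zz_summable : Summable (fun k : ℕ => (1 / Real.sqrt k) ^ 3) := by
  have h := Real.summable_one_div_nat_rpow.2 (show (1:ℝ) < 3 / 2 by norm_num)
  apply h.congr
  intro k
  rw [Real.sqrt_eq_rpow, one_div_pow, ← Real.rpow_natCast, ← Real.rpow_mul (by positivity)]
  norm_num

theorem zz_bound : ∃ S : ℝ, 0 < S ∧ ∀ t : Finset ℕ, ∑ k ∈ t, (1 / Real.sqrt k) ^ 3 ≤ S := by
  refine ⟨∑' k : ℕ, (1 / Real.sqrt k) ^ 3 + 1, ?_, fun t => ?_⟩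
  · have : 0 ≤ ∑' k : ℕ, (1 / Real.sqrt k) ^ 3 := tsum_nonneg (fun k => by positivity)
    linarith
  · have := zz_summable.sum_le_tsum t (fun k _ => by positivity)
    linarith

theorem zz_tail (θ : ℝ) (hθ : 0 < θ) : ∃ P : ℕ, ∀ K : ℕ, P ≤ K → ∀ t : Finset ℕ, (∀ k ∈ t, K < k) → ∑ k ∈ t, (1 / Real.sqrt k) ^ 3 ≤ θ := by
  obtain ⟨s, hs⟩ := summable_iff_vanishing_norm.1 zz_summable θ hθ
  refine ⟨s.sup id, fun K hK t ht => ?_⟩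
  have : Disjoint t s := by
    rw [Finset.disjoint_left]
    intro k hk hks
    have h1 := ht k hk
    have h2 : k ≤ s.sup id := Finset.le_sup (f := id) hks
    omega
  have := hs t this
  exact (le_abs_self _).trans this.le

theorem thmA {n : ℕ} (hn : 5 ≤ n) (d : Fin n → ℕ) (hd : ∀ i, d i ≠ 0) (m : ℕ) (hm : m ≠ 0) :
    ∃ κ : ℝ, 0 < κ ∧ ∀ ε : ℝ, 0 < ε → ∃ K0 : ℕ, ∀ K : ℕ, K0 ≤ K → ∃ A0 : ℕ, ∀ (c : Fin n → ℤ) (A : ℕ), A0 ≤ A →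
      ‖((repS d m c A).ncard : ℂ) - ((Real.sqrt A ^ n / A * κ : ℝ) : ℂ) * ∑ k ∈ Finset.range (K + 1), sA d m c A k‖ ≤
        ε * (Real.sqrt A ^ n / A) := by
  obtain ⟨I0, hI0, hI⟩ := I_integral hn
  obtain ⟨S, hS0, hS⟩ := zz_bound
  have hm0 : (0:ℝ) < m := by exact_mod_cast Nat.pos_of_ne_zero hm
  have hd0 : ∀ i, (0:ℝ) < d i := fun i => by exact_mod_cast Nat.pos_of_ne_zero (hd i)
  have hcZ : 0 < cZ d m := by
    unfold cZ
    apply Finset.prod_pos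
    intro i _
    have := hd0 i
    positivity
  set W : ℝ := 1 + ∑ i, 2 * (d i : ℝ) * m ^ 2 with hWdef
  have hW : ∀ i, 2 * (d i : ℝ) * m ^ 2 ≤ W := by
    intro i
    have := Finset.single_le_sum (f := fun i => 2 * (d i : ℝ) * m ^ 2) (fun i _ => by positivity) (Finset.mem_univ i)
    rw [hWdef]

    linarith
  have hW0 : 0 < W := by
    have : 0 ≤ ∑ i, 2 * (d i : ℝ) * (m:ℝ) ^ 2 := Finset.sum_nonneg (fun i _ => by positivity)
    rw [hWdef]; linarith
  set C : ℝ := (1 + eE (1 / (2 * W))) ^ n with hC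
  have hC0 : 0 < C := by
    have := eE_nonneg (1 / (2 * W))
    positivity
  have hpi := Real.pi_pos
  set e := Real.exp (2 * Real.pi) with he
  have he0 : 0 < e := Real.exp_pos _
  have hee : Real.exp (-(2 * Real.pi)) = e⁻¹ := Real.exp_neg _
  refine ⟨e * cZ d m * I0, by positivity, fun ε hε => ?_⟩
  set B : ℝ := e * (5 * Real.pi * S + 5 * Real.pi * C + 5 * C * S + cZ d m * (Real.sqrt W ^ n * S)) with hB
  have hB0 : 0 < B := by positivity
  set θ := ε / B with hθ
  have hθ0 : 0 < θ := by positivity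
  obtain ⟨P, hP⟩ := zz_tail θ hθ0
  obtain ⟨P2, hP2⟩ := Filter.eventually_atTop.1 (tau_tendsto.eventually (gt_mem_nhds hθ0))
  refine ⟨max (max P P2) 1, fun K hK => ?_⟩
  have hK1 : K ≠ 0 := by have := le_trans (le_max_right _ _) hK; omega
  have hKP : P ≤ K := le_trans (le_trans (le_max_left _ _) (le_max_left _ _)) hK
  have hKP2 : P2 ≤ K := le_trans (le_trans (le_max_right _ _) (le_max_left _ _)) hK
  have hKr : (1:ℝ) ≤ K := by exact_mod_cast Nat.pos_of_ne_zero hK1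
  have htau : tau K ≤ θ := (hP2 K hKP2).le
  have hlim : Filter.Tendsto (fun A : ℕ => (1 + eE (A / (W * (K ^ 2 * (1 + K ^ 2))))) ^ n - 1) Filter.atTop (nhds 0) := by
    have h1 : Filter.Tendsto (fun A : ℕ => (A:ℝ) / (W * (K ^ 2 * (1 + K ^ 2)))) Filter.atTop Filter.atTop :=
      tendsto_natCast_atTop_atTop.atTop_div_const (by positivity)
    have h2 := ((eE_tendsto.comp h1).const_add 1).pow n |>.sub_const 1
    simpa using h2
  obtain ⟨A1, hA1⟩ := Filter.eventually_atTop.1 (hlim.eventually (gt_mem_nhds hθ0))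
  refine ⟨max A1 (max 1 (2 * K ^ 3)), fun c A hA => ?_⟩
  have hAA1 : A1 ≤ A := le_trans (le_max_left _ _) hA
  have hApos : 0 < A := le_trans (le_trans (le_max_left _ _) (le_max_right _ _)) hA
  have hAK : 2 * K ^ 3 ≤ A := le_trans (le_trans (le_max_right _ _) (le_max_right _ _)) hA
  have hmain := circle1 hn d hd m hm W hW0 hW c K hK1 A hApos hAK θ S θ (hA1 A hAA1).le hS (hP K hKP)
  have hcl := iK_close hn K
  rw [hI] at hcl
  set X := Real.sqrt A ^ n / A with hX
  have hX0 : 0 ≤ X := by positivity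
  set Y := ∑ k ∈ Finset.range (K + 1), sA d m c A k with hY
  have hYn : ‖Y‖ ≤ Real.sqrt W ^ n * S := by
    refine (norm_sum_le_of_le _ (fun k _ => sA_norm2 hn d hd m hm W hW0 hW c A k)).trans ?_
    rw [← Finset.mul_sum]
    gcongr
    exact hS _
  rw [hee] at hmain
  have hec : (e : ℂ) ≠ 0 := by exact_mod_cast he0.ne'
  have key : ((repS d m c A).ncard : ℂ) - ((X * (e * cZ d m * I0) : ℝ) : ℂ) * Y =
     (e:ℂ) * (((e⁻¹ : ℝ) : ℂ) * ((repS d m c A).ncard : ℂ) - ((X * cZ d m : ℝ) : ℂ) * iK n K * Y) -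
     ((e * X * cZ d m : ℝ) : ℂ) * (I0 - iK n K) * Y := by
    push_cast
    field_simp
    ring
  rw [key]
  refine (norm_sub_le _ _).trans ?_
  rw [norm_mul, norm_mul, norm_mul, Complex.norm_real, Complex.norm_real, Real.norm_of_nonneg he0.le, Real.norm_of_nonneg (by positivity)]
  have htau0 := tau_nonneg K
  calc _ ≤ e * (X * (5 * (Real.pi * θ * S + Real.pi * C * θ + C * tau K * S))) + e * X * cZ d m * tau K * (Real.sqrt W ^ n * S) := by
        gcongr
    _ ≤ e * (X * (5 * (Real.pi * θ * S + Real.pi * C * θ + C * θ * S))) + e * X * cZ d m * θ * (Real.sqrt W ^ n * S) := by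
        gcongr
    _ = B * θ * X := by rw [hB]; ring
    _ = ε * X := by rw [hθ]; field_simp
end

section
open Set

structure Gd {n : ℕ} (d : Fin n → ℕ) (m g : ℕ) (c : Fin n → ℤ) : Prop where
  hg : g ≠ 0
  hgm : g ∣ m
  hg1 : ∀ i, (g : ℤ) ∣ 2 * d i * c i
  hg2 : ∀ p : ℕ, p.Prime → p ∣ m → g * p ∣ m ∧ ∃ i, ¬ ((p ^ (g.factorization p + 1) : ℕ) : ℤ) ∣ 2 * d i * c i

theorem count1 {n : ℕ} (hn : 5 ≤ n) (d : Fin n → ℕ) (hd0 : ∀ i, d i ≠ 0) (m : ℕ) (hm : m ≠ 0) (hd : ∀ i, 2 * d i ∣ m)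
    (P : ℕ) (hP : ∀ p : ℕ, p.Prime → p ≤ P → p ∣ m)
    (hPs : ∀ t : Finset ℕ, (∀ k ∈ t, P < k) → ∑ k ∈ t, (1 / Real.sqrt k) ^ 3 ≤ 1 / 4) :
    ∃ κ : ℝ, 0 < κ ∧ ∃ A0 : ℕ, ∀ (c : Fin n → ℤ) (g : ℕ), Gd d m g c → ∀ A : ℕ, A0 ≤ A →
      ((repS d m c A).ncard : ℝ) ≤ 3 / 2 * (κ * (m * g : ℕ) * (Real.sqrt A ^ n / A)) ∧
      (((m * g : ℕ) : ℤ) ∣ (∑ i, d i * c i ^ 2) - A → 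
        1 / 2 * (κ * (m * g : ℕ) * (Real.sqrt A ^ n / A)) ≤ ((repS d m c A).ncard : ℝ)) := by
  obtain ⟨κ, hκ, h⟩ := thmA hn d hd0 m hm
  obtain ⟨K0, hK0⟩ := h (κ / 4) (by positivity)
  obtain ⟨A0, hA0⟩ := hK0 (max K0 (m * m)) (le_max_left _ _)
  refine ⟨κ, hκ, A0, fun c g hG A hA => ?_⟩
  have h1 := hA0 c A hA
  set K := max K0 (m * m) with hK
  have h2 := sA_main hn d m hm hd c A g hG.hg hG.hgm hG.hg1 hG.hg2 P hP hPs K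
  set X := Real.sqrt A ^ n / A with hX
  have hX0 : 0 ≤ X := by positivity
  set Y := ∑ k ∈ Finset.range (K + 1), sA d m c A k with hY
  set R := (repS d m c A).ncard with hR
  have hmg : (1:ℝ) ≤ (m * g : ℕ) := by
    have : 0 < m * g := Nat.mul_pos (Nat.pos_of_ne_zero hm) (Nat.pos_of_ne_zero hG.hg)
    exact_mod_cast this
  set z : ℝ := ((m * g : ℕ) : ℝ) with hz
  have hYn : ‖Y‖ ≤ z * (5 / 4) := (norm_sum_le _ _).trans h2.1
  have hsmall : κ / 4 * X ≤ 1 / 4 * (κ * z * X) := by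
    have : κ * X * 1 ≤ κ * X * z := by gcongr
    linarith
  constructor
  · have : (R : ℝ) = ‖(R:ℂ)‖ := by simp
    rw [this]
    have e : (R:ℂ) = ((R:ℂ) - ((X * κ : ℝ) : ℂ) * Y) + ((X * κ : ℝ) : ℂ) * Y := by ring
    rw [e]
    refine (norm_add_le _ _).trans ?_
    rw [norm_mul, Complex.norm_real, Real.norm_of_nonneg (by positivity)]
    have : X * κ * ‖Y‖ ≤ X * κ * (z * (5 / 4)) := by gcongr
    linarith
  · intro hdvd
    have h3 := h2.2 (le_trans (Nat.mul_le_mul_left m (Nat.le_of_dvd (Nat.pos_of_ne_zero hm) hG.hgm)) (le_max_right _ _)) hdvd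
    have h4 : ‖Y - (z:ℂ)‖ ≤ z * (1 / 4) := by
      rw [hz]; exact_mod_cast h3
    have h5 : ‖(R:ℂ) - ((X * κ : ℝ) : ℂ) * z‖ ≤ 1 / 2 * (κ * z * X) := by
      have e : (R:ℂ) - ((X * κ : ℝ) : ℂ) * z = ((R:ℂ) - ((X * κ : ℝ) : ℂ) * Y) + ((X * κ : ℝ) : ℂ) * (Y - z) := by ring
      rw [e]
      refine (norm_add_le _ _).trans ?_
      rw [norm_mul, Complex.norm_real, Real.norm_of_nonneg (show 0 ≤ X * κ by positivity)]
      have : X * κ * ‖Y - (z:ℂ)‖ ≤ X * κ * (z * (1 / 4)) := by gcongr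
      linarith
    have h6 : ‖(R:ℂ) - ((X * κ : ℝ) : ℂ) * z‖ = |(R:ℝ) - X * κ * z| := by
      rw [← Real.norm_eq_abs, ← Complex.norm_real]; push_cast; rfl
    rw [h6] at h5
    have := (abs_le.1 h5).1
    linarith
end

section
open Set

theorem Gd.mul {n : ℕ} {d : Fin n → ℕ} {m g : ℕ} {c : Fin n → ℤ} (h : Gd d m g c) {r : ℤ} (hr : IsCoprime r m) :
    Gd d m g (fun i => r * c i) where
  hg := h.hg
  hgm := h.hgm
  hg1 := fun i => by
    have := (h.hg1 i).mul_left r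
    have e : (2:ℤ) * d i * (r * c i) = r * (2 * d i * c i) := by ring
    rw [e]; exact this
  hg2 := fun p hp hpm => by
    obtain ⟨h1, i, hi⟩ := h.hg2 p hp hpm
    refine ⟨h1, i, fun hdvd => hi ?_⟩
    have e : (2:ℤ) * d i * (r * c i) = r * (2 * d i * c i) := by ring
    rw [e] at hdvd
    have hc : IsCoprime ((p ^ (g.factorization p + 1) : ℕ) : ℤ) r := by
      push_cast
      apply IsCoprime.pow_left
      exact (hr.of_isCoprime_of_dvd_right (by exact_mod_cast hpm)).symm
    exact hc.dvd_of_dvd_mul_left hdvd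

theorem repS_crude {n : ℕ} (d : Fin n → ℕ) (hd : ∀ i, d i ≠ 0) (m : ℕ) (hm : m ≠ 0) (c : Fin n → ℤ) (A : ℕ) :
    (repS d m c A).ncard ≤ (2 * A + 1) ^ n := by
  set B : Set (Fin n → ℤ) := ↑(Fintype.piFinset (fun _ : Fin n => Finset.Icc (-(A:ℤ)) A)) with hB
  have hBc : B.ncard = (2 * A + 1) ^ n := by
    rw [hB, Set.ncard_coe_finset, Fintype.card_piFinset]
    simp
    congr 1; omega
  rw [← hBc]
  apply Set.ncard_le_ncard_of_injOn (fun t i => c i + m * t i)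
  · intro t ht
    have ht : ∑ i, (d i : ℤ) * (c i + m * t i) ^ 2 = A := ht
    simp only [hB, Finset.mem_coe, Fintype.mem_piFinset, Finset.mem_Icc]
    intro i
    rw [← abs_le]
    have h1 := Finset.single_le_sum (f := fun i => (d i : ℤ) * (c i + m * t i) ^ 2) (fun i _ => by positivity) (Finset.mem_univ i)
    rw [ht] at h1
    have h2 : (1:ℤ) ≤ d i := by exact_mod_cast Nat.pos_of_ne_zero (hd i)
    have h3 : |c i + m * t i| ≤ (c i + m * t i) ^ 2 := by
      rw [← sq_abs]
      rcases (abs_nonneg (c i + m * t i)).eq_or_lt with h0 | h0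
      · rw [← h0]; norm_num
      · nlinarith
    have h4 := sq_nonneg (c i + m * t i)
    have h5 : (1:ℤ) * (c i + m * t i) ^ 2 ≤ d i * (c i + m * t i) ^ 2 := by gcongr
    linarith
  · intro t _ t' _ h
    funext i
    have := congrFun h i
    simp only at this
    have hm' : (m:ℤ) ≠ 0 := by exact_mod_cast hm
    have h2 : (m:ℤ) * t i = m * t' i := by linarith
    exact mul_left_cancel₀ hm' h2

theorem X_scale {n : ℕ} (hn : 5 ≤ n) {A p A' : ℕ} (hp : p ≠ 0) (hA' : A' ≠ 0) (h : A = p ^ 2 * A') :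
    Real.sqrt A' ^ n / A' ≤ Real.sqrt A ^ n / A * (1 / Real.sqrt p) ^ 3 := by
  have hp1 : (1:ℝ) ≤ p := by exact_mod_cast Nat.pos_of_ne_zero hp
  have hA1 : (0:ℝ) < A' := by exact_mod_cast Nat.pos_of_ne_zero hA'
  have e : Real.sqrt A = p * Real.sqrt A' := by
    rw [h]; push_cast
    rw [Real.sqrt_mul (by positivity), Real.sqrt_sq (by positivity)]
  rw [e, h]
  push_cast
  have hs1 : 1 ≤ Real.sqrt p := by rw [Real.one_le_sqrt]; exact hp1
  have e2 : (p * Real.sqrt A') ^ n / ((p:ℝ) ^ 2 * A') * (1 / Real.sqrt p) ^ 3 = (Real.sqrt A' ^ n / A') * ((p:ℝ) ^ (n - 2) / Real.sqrt p ^ 3) := by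
    have : (p:ℝ) ^ n = p ^ 2 * p ^ (n - 2) := by rw [← pow_add]; congr 1; omega
    rw [mul_pow, this]
    field_simp
  rw [e2]
  apply le_mul_of_one_le_right (by positivity)
  rw [one_le_div (by positivity)]
  calc Real.sqrt p ^ 3 ≤ (p:ℝ) ^ 3 := by
        gcongr
        rw [Real.sqrt_le_left (by linarith)]
        nlinarith
    _ ≤ (p:ℝ) ^ (n - 2) := pow_le_pow_right₀ hp1 (by omega)

theorem X_ge {n : ℕ} (hn : 5 ≤ n) {A : ℕ} (hA : A ≠ 0) : (A:ℝ) * Real.sqrt A ≤ Real.sqrt A ^ n / A := by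
  have hA1 : (1:ℝ) ≤ A := by exact_mod_cast Nat.pos_of_ne_zero hA
  rw [le_div_iff₀ (by linarith)]
  have hs1 : 1 ≤ Real.sqrt A := by rw [Real.one_le_sqrt]; exact hA1
  calc (A:ℝ) * Real.sqrt A * A = Real.sqrt A ^ 5 := by
        nth_rewrite 1 [← Real.sq_sqrt (show (0:ℝ) ≤ A by linarith)]
        nth_rewrite 3 [← Real.sq_sqrt (show (0:ℝ) ≤ A by linarith)]
        ring
    _ ≤ _ := pow_le_pow_right₀ hs1 hn

theorem count_prim {n : ℕ} (hn : 5 ≤ n) (d : Fin n → ℕ) (hd0 : ∀ i, d i ≠ 0) (m : ℕ) (hm : m ≠ 0) (hd : ∀ i, 2 * d i ∣ m)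
    (P : ℕ) (hP : ∀ p : ℕ, p.Prime → p ≤ P → p ∣ m)
    (hPs : ∀ t : Finset ℕ, (∀ k ∈ t, P < k) → ∑ k ∈ t, (1 / Real.sqrt k) ^ 3 ≤ 1 / 4) :
    ∃ A1 : ℕ, ∀ (c : Fin n → ℤ) (g : ℕ), Gd d m g c → ∀ A : ℕ, A1 ≤ A →
      ((m * g : ℕ) : ℤ) ∣ (∑ i, d i * c i ^ 2) - A → 
      ∃ t : Fin n → ℤ, ∑ i, (d i : ℤ) * (c i + m * t i) ^ 2 = A ∧
        ∀ p : ℕ, p.Prime → ¬ p ∣ m → ∃ i, ¬ (p : ℤ) ∣ c i + m * t i := by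
  obtain ⟨κ, hκ, A0, h⟩ := count1 hn d hd0 m hm hd P hP hPs
  set C1 : ℝ := (2 * A0 + 1 : ℝ) ^ n with hC1
  refine ⟨max (max A0 1) (Nat.floor (8 * C1 / κ) + 1), fun c g hG A hA hdvd => ?_⟩
  have hAA0 : A0 ≤ A := le_trans (le_trans (le_max_left _ _) (le_max_left _ _)) hA
  have hA0 : A ≠ 0 := by have := le_trans (le_trans (le_max_right _ _) (le_max_left _ _)) hA; omega
  have hAC : 8 * C1 / κ < A := by
    have h1 := le_trans (le_max_right _ _) hA
    have h2 := Nat.lt_floor_add_one (8 * C1 / κ)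
    have h3 : ((Nat.floor (8 * C1 / κ) + 1 : ℕ) : ℝ) ≤ A := by exact_mod_cast h1
    push_cast at h3
    linarith
  by_contra hcon
  push Not at hcon
  have hlow := (h c g hG A hAA0).2 hdvd
  set T := (Finset.range (Nat.sqrt A + 1)).filter (fun p => p.Prime ∧ ¬ p ∣ m ∧ p ^ 2 ∣ A) with hT
  have hbez : ∀ p : ℕ, ∃ r s : ℤ, p ∈ T → p * r = 1 + m * s := by
    intro p
    by_cases hp : p ∈ T
    · rw [hT, Finset.mem_filter] at hp
      have hc : IsCoprime (p:ℤ) m := Nat.isCoprime_iff_coprime.2 ((Nat.Prime.coprime_iff_not_dvd hp.2.1).2 hp.2.2.1)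
      obtain ⟨u, v, huv⟩ := hc
      exact ⟨u, -v, fun _ => by linarith⟩
    · exact ⟨0, 0, fun h => absurd h hp⟩
  choose r s hrs using hbez
  have hsub : repS d m c A ⊆ ⋃ p ∈ T, (fun t i => (p:ℤ) * t i + s p * c i) '' repS d m (fun i => r p * c i) (A / p ^ 2 : ℕ) := by
    intro t ht
    have ht : ∑ i, (d i : ℤ) * (c i + m * t i) ^ 2 = A := ht
    obtain ⟨p, hp, hpm, hpd⟩ := hcon t ht
    choose y hy using hpd
    have hsum : (A:ℤ) = p ^ 2 * ∑ i, (d i : ℤ) * y i ^ 2 := by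
      rw [← ht, Finset.mul_sum]
      apply Finset.sum_congr rfl
      intro i _
      rw [hy i]; ring
    have hp2 : p ^ 2 ∣ A := by
      have : ((p ^ 2 : ℕ) : ℤ) ∣ A := by rw [hsum]; push_cast; exact Dvd.intro _ rfl
      exact_mod_cast this
    have hpT : p ∈ T := by
      rw [hT, Finset.mem_filter]
      refine ⟨?_, hp, hpm, hp2⟩
      rw [Finset.mem_range, Nat.lt_succ_iff, Nat.le_sqrt']
      exact Nat.le_of_dvd (Nat.pos_of_ne_zero hA0) hp2
    have hb := hrs p hpT
    rw [Set.mem_iUnion₂]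
    refine ⟨p, hpT, fun i => r p * t i - s p * y i, ?_, ?_⟩
    · show ∑ i, (d i : ℤ) * (r p * c i + m * (r p * t i - s p * y i)) ^ 2 = (A / p ^ 2 : ℕ)
      have e : ∀ i, r p * c i + m * (r p * t i - s p * y i) = y i := by
        intro i
        have : r p * c i + m * (r p * t i - s p * y i) = r p * (c i + m * t i) - m * s p * y i := by ring
        rw [this, hy i]
        linear_combination y i * hb
      simp only [e]
      obtain ⟨A', hA'⟩ := hp2
      have hp0 : 0 < p ^ 2 := pow_pos hp.pos 2
      rw [hA', Nat.mul_div_cancel_left _ hp0]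
      rw [hA'] at hsum
      push_cast at hsum
      have : ((p:ℤ) ^ 2) ≠ 0 := by exact_mod_cast hp0.ne'
      exact (mul_left_cancel₀ this hsum).symm
    · funext i
      have hm' : (m:ℤ) ≠ 0 := by exact_mod_cast hm
      apply mul_left_cancel₀ hm'
      simp only
      linear_combination m * t i * hb + m * s p * hy i
  have hcard : ((repS d m c A).ncard : ℝ) ≤ ∑ p ∈ T, (C1 + 3 / 2 * (κ * (m * g : ℕ) * (Real.sqrt A ^ n / A)) * (1 / Real.sqrt p) ^ 3) := by
    have hfin : ∀ p, p ∈ T → A / p ^ 2 ≠ 0 := by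
      intro p hp
      rw [hT, Finset.mem_filter] at hp
      have := Nat.le_of_dvd (Nat.pos_of_ne_zero hA0) hp.2.2.2
      exact (Nat.div_pos this (pow_pos hp.2.1.pos 2)).ne'
    have hfin2 : ∀ p, p ∈ T → (repS d m (fun i => r p * c i) (A / p ^ 2 : ℕ)).Finite := fun p hp =>
      (thF_integral d hd0 m hm (fun i => r p * c i) (A / p ^ 2) (Nat.pos_of_ne_zero (hfin p hp)) 0).1
    have h1 : (repS d m c A).ncard ≤ ∑ p ∈ T, (repS d m (fun i => r p * c i) (A / p ^ 2 : ℕ)).ncard := by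
      refine (Set.ncard_le_ncard hsub ?_).trans ?_
      · apply Set.Finite.biUnion T.finite_toSet
        intro p hp
        exact (hfin2 p hp).image _
      · refine (Finset.set_ncard_biUnion_le _ _).trans ?_
        apply Finset.sum_le_sum
        intro p hp
        exact Set.ncard_image_le (hfin2 p hp)
    have h2 : ((repS d m c A).ncard : ℝ) ≤ ∑ p ∈ T, ((repS d m (fun i => r p * c i) (A / p ^ 2 : ℕ)).ncard : ℝ) := by exact_mod_cast h1
    refine h2.trans (Finset.sum_le_sum fun p hp => ?_)
    by_cases hAp : A0 ≤ A / p ^ 2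
    · have hpp := hp
      rw [hT, Finset.mem_filter] at hpp
      have hr : IsCoprime (r p) m := ⟨p, - s p, by linear_combination hrs p hp⟩
      have h3 := (h _ g (hG.mul hr) (A / p ^ 2) hAp).1
      have h4 := X_scale hn (A := A) (p := p) (A' := A / p ^ 2) hpp.2.1.ne_zero (hfin p hp) (Nat.mul_div_cancel' hpp.2.2.2).symm
      refine h3.trans ?_
      have h5 : 3 / 2 * (κ * (m * g : ℕ) * (Real.sqrt (A / p ^ 2 : ℕ) ^ n / (A / p ^ 2 : ℕ))) ≤ 3 / 2 * (κ * (m * g : ℕ) * (Real.sqrt A ^ n / A * (1 / Real.sqrt p) ^ 3)) := by gcongr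
      have : 0 ≤ C1 := by positivity
      linarith
    · push Not at hAp
      have h3 := repS_crude d hd0 m hm (fun i => r p * c i) (A / p ^ 2)
      have h4 : ((repS d m (fun i => r p * c i) (A / p ^ 2 : ℕ)).ncard : ℝ) ≤ (2 * (A / p ^ 2 : ℕ) + 1) ^ n := by exact_mod_cast h3
      have h5 : ((A / p ^ 2 : ℕ) : ℝ) ≤ A0 := by exact_mod_cast hAp.le
      have h6 : (2 * (A / p ^ 2 : ℕ) + 1 : ℝ) ^ n ≤ C1 := by rw [hC1]; gcongr
      have : 0 ≤ 3 / 2 * (κ * (m * g : ℕ) * (Real.sqrt A ^ n / A)) * (1 / Real.sqrt p) ^ 3 := by positivity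
      linarith
  rw [Finset.sum_add_distrib, ← Finset.mul_sum, Finset.sum_const, nsmul_eq_mul] at hcard
  have hz := hPs T (by
    intro p hp
    rw [hT, Finset.mem_filter] at hp
    by_contra hle
    exact hp.2.2.1 (hP p hp.2.1 (not_lt.1 hle)))
  have hTc : (T.card : ℝ) ≤ Real.sqrt A := by
    have h1 : T ⊆ Finset.Icc 1 (Nat.sqrt A) := by
      intro p hp
      rw [hT, Finset.mem_filter, Finset.mem_range] at hp
      rw [Finset.mem_Icc]
      exact ⟨hp.2.1.pos, by omega⟩
    have h2 := Finset.card_le_card h1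
    rw [Nat.card_Icc, Nat.add_sub_cancel] at h2
    calc (T.card : ℝ) ≤ (Nat.sqrt A : ℕ) := by exact_mod_cast h2
      _ ≤ Real.sqrt A := Real.nat_sqrt_le_real_sqrt
  have hXg := X_ge hn hA0
  set X := Real.sqrt A ^ n / A with hX
  have hX0 : 0 ≤ X := by positivity
  have hmg : (1:ℝ) ≤ (m * g : ℕ) := by
    have : 0 < m * g := Nat.mul_pos (Nat.pos_of_ne_zero hm) (Nat.pos_of_ne_zero hG.hg)
    exact_mod_cast this
  have hA1 : (1:ℝ) ≤ A := by exact_mod_cast Nat.pos_of_ne_zero hA0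
  have hs0 : 0 < Real.sqrt A := Real.sqrt_pos.2 (by linarith)
  have hC0 : 0 ≤ C1 := by positivity
  have i1 : 3 / 2 * (κ * (m * g : ℕ) * X) * ∑ p ∈ T, (1 / Real.sqrt p) ^ 3 ≤ 3 / 2 * (κ * (m * g : ℕ) * X) * (1 / 4) := by gcongr
  have i2 : (T.card : ℝ) * C1 ≤ Real.sqrt A * C1 := by gcongr
  have i3 : Real.sqrt A * C1 < Real.sqrt A * (κ * A / 8) := by
    apply mul_lt_mul_of_pos_left _ hs0
    rw [div_lt_iff₀ hκ] at hAC
    linarith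
  have i4 : κ * 1 * (A * Real.sqrt A) ≤ κ * (m * g : ℕ) * X := by gcongr
  linarith
end

section
open Matrix

theorem clear_den {n : ℕ} (v : Fin n → ℚ) : ∃ (k : ℚ) (w : Fin n → ℤ), k ≠ 0 ∧ ∀ j, (w j : ℚ) = k * v j := by
  refine ⟨∏ j, ((v j).den : ℚ), fun j => (v j).num * ∏ i ∈ Finset.univ.erase j, ((v i).den : ℤ), ?_, fun j => ?_⟩
  · exact Finset.prod_ne_zero_iff.2 fun j _ => by exact_mod_cast (v j).den_ne_zero
  · rw [← Finset.mul_prod_erase Finset.univ _ (Finset.mem_univ j)]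
    push_cast
    have := Rat.mul_den_eq_num (v j)
    rw [← this]; ring

theorem diag_lemma {n : ℕ} (A : Matrix (Fin n) (Fin n) ℤ) (hA : ∀ x : Fin n → ℤ, x ≠ 0 → 0 < x ⬝ᵥ A *ᵥ x) :
    ∃ (d : Fin n → ℕ) (D : ℕ) (Λ L : Matrix (Fin n) (Fin n) ℤ), (∀ i, d i ≠ 0) ∧ D ≠ 0 ∧
      L * Λ = (D : ℤ) • 1 ∧ Λ * L = (D : ℤ) • 1 ∧
      ∀ x : Fin n → ℤ, (D : ℤ) ^ 2 * (x ⬝ᵥ A *ᵥ x) = ∑ i, (d i : ℤ) * (L *ᵥ x) i ^ 2 := by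
  set S : Matrix (Fin n) (Fin n) ℤ := A + Aᵀ with hS
  have hSx : ∀ x : Fin n → ℤ, x ⬝ᵥ S *ᵥ x = 2 * (x ⬝ᵥ A *ᵥ x) := by
    intro x
    rw [hS, Matrix.add_mulVec, dotProduct_add, Matrix.mulVec_transpose, dotProduct_comm x (x ᵥ* A), ← Matrix.dotProduct_mulVec]
    ring
  set Sq : Matrix (Fin n) (Fin n) ℚ := S.map (Int.cast : ℤ → ℚ) with hSq
  have hsym : LinearMap.IsSymm (Matrix.toBilin' Sq) := by
    constructor
    intro x y
    simp only [Matrix.toBilin'_apply', RingHom.id_apply]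
    have hT : Sqᵀ = Sq := by
      ext i j; simp [hSq, hS, add_comm]
    rw [Matrix.dotProduct_mulVec, dotProduct_comm, ← Matrix.mulVec_transpose, hT]
  have : Invertible (2:ℚ) := invertibleOfNonzero two_ne_zero
  obtain ⟨v0, hv0⟩ := LinearMap.BilinForm.exists_orthogonal_basis hsym
  have hfr : Module.finrank ℚ (Fin n → ℚ) = n := by simp
  have : ∃ v : Module.Basis (Fin n) ℚ (Fin n → ℚ), ∀ i j, i ≠ j → v i ⬝ᵥ Sq *ᵥ v j = 0 := by
    refine ⟨v0.reindex (finCongr hfr), fun i j hij => ?_⟩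
    have := hv0 (i := (finCongr hfr).symm i) (j := (finCongr hfr).symm j) (by simpa using hij)
    simpa [Matrix.toBilin'_apply'] using this
  obtain ⟨v, hv⟩ := this
  choose k w hk hw using fun i => clear_den (v i)
  have hwk : ∀ i, (fun j => (w i j : ℚ)) = k i • v i := fun i => by ext j; simp [hw]
  have horth : ∀ i j, i ≠ j → w i ⬝ᵥ S *ᵥ w j = 0 := by
    intro i j hij
    have h1 : ((w i ⬝ᵥ S *ᵥ w j : ℤ) : ℚ) = (fun l => (w i l : ℚ)) ⬝ᵥ Sq *ᵥ (fun l => (w j l : ℚ)) := by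
      simp [dotProduct, mulVec, hSq]
    rw [hwk, hwk, Matrix.mulVec_smul, smul_dotProduct, dotProduct_smul, hv i j hij] at h1
    simpa using h1
  set W : Matrix (Fin n) (Fin n) ℤ := Matrix.of w with hW
  have hdet : W.det ≠ 0 := by
    intro h0
    obtain ⟨u, hu, hu0⟩ := Matrix.exists_vecMul_eq_zero_iff.2 h0
    apply hu
    have hli := v.linearIndependent
    rw [Fintype.linearIndependent_iff] at hli
    have := hli (fun i => (u i : ℚ) * k i) (by
      ext l
      have h2 := congrFun hu0 l
      simp only [vecMul, dotProduct, hW, Matrix.of_apply, Pi.zero_apply] at h2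
      have h3 : ((∑ i, u i * w i l : ℤ) : ℚ) = 0 := by rw [h2]; simp
      push_cast at h3
      simp only [hw] at h3
      simp only [Finset.sum_apply, Pi.smul_apply, smul_eq_mul, Pi.zero_apply]
      rw [← h3]; exact Finset.sum_congr rfl fun i _ => by ring)
    ext i
    have h4 := this i
    simpa [hk i] using h4
  have hw0 : ∀ i, w i ≠ 0 := by
    intro i h
    apply v.ne_zero i
    have := hwk i
    rw [h] at this
    have h5 : k i • v i = 0 := by rw [← this]; ext; simp
    exact (smul_eq_zero.1 h5).resolve_left (hk i)
  set Λ := Wᵀ with hΛ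
  have hdΛ : Λ.det ≠ 0 := by rw [hΛ, Matrix.det_transpose]; exact hdet
  set L : Matrix (Fin n) (Fin n) ℤ := Λ.det • Λ.adjugate with hL
  have hD : ((Λ.det.natAbs ^ 2 : ℕ) : ℤ) = Λ.det * Λ.det := by
    push_cast; rw [sq_abs, sq]
  have hΛL : Λ * L = ((Λ.det.natAbs ^ 2 : ℕ) : ℤ) • 1 := by
    rw [hD, hL, Matrix.mul_smul, Matrix.mul_adjugate, smul_smul]
  refine ⟨fun i => (w i ⬝ᵥ A *ᵥ w i).natAbs, Λ.det.natAbs ^ 2, Λ, L, fun i => ?_, ?_, ?_, hΛL, ?_⟩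
  · exact Int.natAbs_ne_zero.2 (hA _ (hw0 i)).ne'
  · simpa using hdΛ
  · rw [hD, hL, Matrix.smul_mul, Matrix.adjugate_mul, smul_smul]
  · intro x
    set D := Λ.det.natAbs ^ 2
    set y := L *ᵥ x with hy
    have h1 : (D : ℤ) • x = Λ *ᵥ y := by
      rw [hy, Matrix.mulVec_mulVec, hΛL, Matrix.smul_mulVec, Matrix.one_mulVec]
    have h2 : (2:ℤ) * ((D : ℤ) ^ 2 * (x ⬝ᵥ A *ᵥ x)) = (Λ *ᵥ y) ⬝ᵥ S *ᵥ (Λ *ᵥ y) := by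
      rw [← h1, Matrix.mulVec_smul, smul_dotProduct, dotProduct_smul, hSx]
      simp only [smul_eq_mul]; ring
    have h3 : Λᵀ * (S * Λ) = Matrix.diagonal (fun i => 2 * (w i ⬝ᵥ A *ᵥ w i)) := by
      ext i j
      have e : (Λᵀ * (S * Λ)) i j = w i ⬝ᵥ S *ᵥ w j := by
        simp [Matrix.mul_apply, hΛ, hW, dotProduct, mulVec]
      rw [e, Matrix.diagonal_apply]
      split_ifs with hij
      · rw [← hij, hSx]
      · exact horth i j hij
    have h4 : (Λ *ᵥ y) ⬝ᵥ S *ᵥ (Λ *ᵥ y) = y ⬝ᵥ (Λᵀ * (S * Λ)) *ᵥ y := by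
      rw [← Matrix.mulVec_mulVec, ← Matrix.mulVec_mulVec, Matrix.dotProduct_mulVec y, Matrix.vecMul_transpose]
    rw [h4, h3] at h2
    have h5 : y ⬝ᵥ (Matrix.diagonal fun i => 2 * (w i ⬝ᵥ A *ᵥ w i)) *ᵥ y
        = 2 * ∑ i, (((w i ⬝ᵥ A *ᵥ w i).natAbs : ℕ) : ℤ) * y i ^ 2 := by
      rw [Finset.mul_sum]
      change ∑ i, y i * _ = _
      refine Finset.sum_congr rfl fun i _ => ?_
      have := hA _ (hw0 i)
      have h6 : (((w i ⬝ᵥ A *ᵥ w i).natAbs : ℕ) : ℤ) = w i ⬝ᵥ A *ᵥ w i := by omega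
      rw [h6, Matrix.mulVec_diagonal]; ring
    rw [h5] at h2
    linarith
end

section
open Matrix

theorem isQ_mat {n : ℕ} (A : Matrix (Fin n) (Fin n) ℤ) :
    IsQ (fun x : Fin n → ℤ => x ⬝ᵥ A *ᵥ x) (fun x y => x ⬝ᵥ A *ᵥ y + y ⬝ᵥ A *ᵥ x) where
  add := fun x y => by
    simp only [Matrix.mulVec_add, dotProduct_add, add_dotProduct]; ring
  smul := fun t x => by
    simp only [Matrix.mulVec_smul, dotProduct_smul, smul_dotProduct, smul_eq_mul]; ring
  badd := fun x y z => by
    simp only [Matrix.mulVec_add, dotProduct_add, add_dotProduct]; ring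

theorem mat_congr {n : ℕ} (A : Matrix (Fin n) (Fin n) ℤ) {M : ℤ} {x y : Fin n → ℤ} (h : ∀ i, M ∣ x i - y i) :
    M ∣ x ⬝ᵥ A *ᵥ x - y ⬝ᵥ A *ᵥ y := by
  choose z hz using h
  have : x = y + M • z := by
    ext i; simp only [Pi.add_apply, Pi.smul_apply, smul_eq_mul]; rw [← hz]; ring
  rw [this]
  simp only [Matrix.mulVec_add, dotProduct_add, add_dotProduct, Matrix.mulVec_smul, dotProduct_smul, smul_dotProduct, smul_eq_mul]
  refine ⟨z ⬝ᵥ A *ᵥ y + (y ⬝ᵥ A *ᵥ z + M * (z ⬝ᵥ A *ᵥ z)), by ring⟩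

theorem global_prim {n : ℕ} (hn : 5 ≤ n) (A : Matrix (Fin n) (Fin n) ℤ)
    (hau : ∃ N : ℤ, ∀ m : ℤ, N ≤ m → ∃ x : Fin n → ℤ, x ⬝ᵥ A *ᵥ x = m) (M : ℕ) :
    M ≠ 0 → ∀ a : ℤ, ∃ x : Fin n → ℤ, (∀ p : ℕ, p.Prime → p ∣ M → ∃ i, ¬ (p : ℤ) ∣ x i) ∧
      (M : ℤ) ∣ x ⬝ᵥ A *ᵥ x - a := by
  induction M using Nat.recOnPosPrimePosCoprime with
  | zero => intro h; exact absurd rfl h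
  | one => 
    intro _ a
    refine ⟨0, fun p hp h => absurd (Nat.dvd_one.1 h) hp.ne_one, by simp⟩
  | prime_pow p k hp hk =>
    intro _ a
    obtain ⟨x, hx, hx2⟩ := local_lemma hp hn (isQ_mat A) (by
      obtain ⟨N, hN⟩ := hau
      intro a E
      have hpE : (1:ℤ) ≤ (p:ℤ) ^ E := one_le_pow₀ (by exact_mod_cast hp.one_lt.le)
      obtain ⟨y, hy⟩ := hN (a + (|a| + |N|) * (p:ℤ) ^ E) (by
        have := le_abs_self N
        have := neg_abs_le a
        have := abs_nonneg a
        have := abs_nonneg N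
        nlinarith)
      exact ⟨y, ⟨|a| + |N|, by rw [hy]; ring⟩⟩) a k
    refine ⟨x, fun r hr h => ?_, by exact_mod_cast hx2⟩
    rw [(Nat.prime_dvd_prime_iff_eq hr hp).1 (hr.dvd_of_dvd_pow h)]
    exact hx
  | coprime u v hu hv huv ihu ihv =>
    intro _ a
    obtain ⟨x, hx, hx2⟩ := ihu (by omega) a
    obtain ⟨y, hy, hy2⟩ := ihv (by omega) a
    have hc : IsCoprime (u:ℤ) (v:ℤ) := Nat.isCoprime_iff_coprime.2 huv
    obtain ⟨r, s, hrs⟩ := hc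
    set z : Fin n → ℤ := fun i => s * v * x i + r * u * y i with hz
    have hzx : ∀ i, (u:ℤ) ∣ z i - x i := fun i => ⟨r * (y i - x i), by
      simp only [hz]; linear_combination (x i) * hrs⟩
    have hzy : ∀ i, (v:ℤ) ∣ z i - y i := fun i => ⟨s * (x i - y i), by
      simp only [hz]; linear_combination (y i) * hrs⟩
    refine ⟨z, fun p hp h => ?_, ?_⟩
    · rcases hp.dvd_mul.1 h with h | h
      · obtain ⟨i, hi⟩ := hx p hp h
        refine ⟨i, fun h' => hi ?_⟩
        have := (Int.natCast_dvd_natCast.2 h).trans (hzx i)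
        simpa using dvd_sub h' this
      · obtain ⟨i, hi⟩ := hy p hp h
        refine ⟨i, fun h' => hi ?_⟩
        have := (Int.natCast_dvd_natCast.2 h).trans (hzy i)
        simpa using dvd_sub h' this
    · push_cast
      apply IsCoprime.mul_dvd ⟨r, s, hrs⟩
      · simpa using dvd_add (mat_congr A hzx) hx2
      · simpa using dvd_add (mat_congr A hzy) hy2
end

section
open Matrix

theorem gd_exists {n : ℕ} {d : Fin n → ℕ} (hd0 : ∀ i, d i ≠ 0) {D : ℕ} (hD : D ≠ 0)
    {Λ L : Matrix (Fin n) (Fin n) ℤ} (hΛL : Λ * L = (D : ℤ) • 1) {Z : ℕ} (hZ0 : Z ≠ 0)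
    (hZ : ∀ i, 2 * d i * D ∣ Z) {m : ℕ} (hm : m = D * Z ^ 2) (hpm : ∀ p : ℕ, p.Prime → p ∣ m → p ∣ Z)
    {x : Fin n → ℤ} (hx : ∀ p : ℕ, p.Prime → p ∣ m → ∃ j, ¬ (p : ℤ) ∣ x j) :
    ∃ g, Gd d m g (L *ᵥ x) := by
  have hm0 : m ≠ 0 := by rw [hm]; positivity
  set c := L *ᵥ x with hc
  have hDx : ∀ j, (D : ℤ) * x j = ∑ i, Λ j i * c i := by
    intro j
    have h1 : Λ *ᵥ c = (D : ℤ) • x := by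
      rw [hc, Matrix.mulVec_mulVec, hΛL, Matrix.smul_mulVec, Matrix.one_mulVec]
    have := congrFun h1 j
    simp only [Pi.smul_apply, smul_eq_mul] at this
    rw [← this]; rfl
  have key : ∀ p : ℕ, p.Prime → p ∣ m → ∃ i, ¬ ((p ^ (Z.factorization p + 1) : ℕ) : ℤ) ∣ 2 * d i * c i := by
    intro p hp hpm'
    by_contra! hcon
    obtain ⟨j, hj⟩ := hx p hp hpm'
    apply hj
    set v := Z.factorization p with hv
    set Z' := Z / p ^ v with hZ'
    have hZZ : Z = p ^ v * Z' := (Nat.ordProj_mul_ordCompl_eq_self Z p).symm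
    have hpZ' : ¬ p ∣ Z' := Nat.not_dvd_ordCompl hp hZ0
    have hi : ∀ i, (p : ℤ) * D ∣ Z' * c i := by
      intro i
      obtain ⟨z, hz⟩ := hZ i
      obtain ⟨t, ht⟩ := hcon i
      have hne : (2 * d i : ℤ) ≠ 0 := by
        have := hd0 i
        positivity
      refine ⟨z * t, mul_left_cancel₀ hne ?_⟩
      have hz1 : (p:ℤ) ^ v * Z' = 2 * d i * D * z := by
        have := hZZ.symm.trans hz
        exact_mod_cast this
      push_cast at ht
      rw [pow_succ] at ht
      linear_combination (Z':ℤ) * ht + p * t * hz1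
    have h1 : (p:ℤ) * D ∣ Z' * ((D:ℤ) * x j) := by
      rw [hDx, Finset.mul_sum]
      refine Finset.dvd_sum fun i _ => ?_
      rw [mul_left_comm]
      exact Dvd.dvd.mul_left (hi i) _
    have h2 : (D:ℤ) * p ∣ D * (Z' * x j) := by
      convert h1 using 1 <;> ring
    have h3 := (mul_dvd_mul_iff_left (by exact_mod_cast hD : (D:ℤ) ≠ 0)).1 h2
    rcases (Nat.prime_iff_prime_int.1 hp).dvd_mul.1 h3 with h | h
    · exact absurd (Int.natCast_dvd_natCast.1 h) hpZ'
    · exact h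
  set G : ℕ := Finset.univ.gcd (fun i => (2 * (d i : ℤ) * c i).natAbs) with hG
  have hGdvd : ∀ k : ℕ, k ∣ G ↔ ∀ i, (k : ℤ) ∣ 2 * (d i : ℤ) * c i := by
    intro k
    rw [hG, Finset.dvd_gcd_iff]
    simp [Int.natCast_dvd]
  have hg0 : Nat.gcd m G ≠ 0 := Nat.gcd_ne_zero_left hm0
  refine ⟨Nat.gcd m G, hg0, Nat.gcd_dvd_left _ _, (hGdvd _).1 (Nat.gcd_dvd_right _ _), ?_⟩
  intro p hp hpm'
  have hpZ := hpm p hp hpm'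
  have hv1 : 1 ≤ Z.factorization p := (hp.dvd_iff_one_le_factorization hZ0).1 hpZ
  have hpv : p ^ (Z.factorization p + 1) ∣ m := by
    have h1 : p ^ (Z.factorization p) ∣ Z := Nat.ordProj_dvd Z p
    have h2 : p ^ (Z.factorization p + 1) ∣ (p ^ (Z.factorization p)) ^ 2 := by
      rw [← pow_mul]; exact pow_dvd_pow _ (by omega)
    rw [hm]
    exact Dvd.dvd.mul_left (h2.trans (pow_dvd_pow_of_dvd h1 2)) _
  have hng : ¬ p ^ (Z.factorization p + 1) ∣ Nat.gcd m G := by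
    intro h
    obtain ⟨i, hi⟩ := key p hp hpm'
    exact hi ((hGdvd _).1 (h.trans (Nat.gcd_dvd_right _ _)) i)
  constructor
  · obtain ⟨k, hk⟩ := Nat.gcd_dvd_left m G
    have hpk : p ∣ k := by
      by_contra h
      apply hng
      have hco : Nat.Coprime (p ^ (Z.factorization p + 1)) k :=
        Nat.Coprime.pow_left _ ((Nat.Prime.coprime_iff_not_dvd hp).2 h)
      rw [hk] at hpv
      exact hco.dvd_of_dvd_mul_right hpv
    conv_rhs => rw [hk]
    exact Nat.mul_dvd_mul_left _ hpk
  · by_contra! hcon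
    have h1 := (hGdvd _).2 hcon
    have hle : (Nat.gcd m G).factorization p ≤ Z.factorization p := by
      by_contra! h
      exact hng ((hp.pow_dvd_iff_le_factorization hg0).2 h)
    have h2 : p ^ ((Nat.gcd m G).factorization p + 1) ∣ m :=
      (pow_dvd_pow _ (by omega)).trans hpv
    have h3 := Nat.dvd_gcd h2 h1
    have := (hp.pow_dvd_iff_le_factorization hg0).1 h3
    omega

theorem final_mat {n : ℕ} (hn : 5 ≤ n) (A : Matrix (Fin n) (Fin n) ℤ)
    (hA : ∀ x : Fin n → ℤ, x ≠ 0 → 0 < x ⬝ᵥ A *ᵥ x)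
    (hau : ∃ N : ℤ, ∀ m : ℤ, N ≤ m → ∃ x : Fin n → ℤ, x ⬝ᵥ A *ᵥ x = m) :
    ∃ N : ℤ, ∀ m : ℤ, N ≤ m → ∃ x : Fin n → ℤ, Finset.univ.gcd x = 1 ∧ x ⬝ᵥ A *ᵥ x = m := by
  obtain ⟨d, D, Λ, L, hd0, hD, hLΛ, hΛL, hQ⟩ := diag_lemma A hA
  obtain ⟨P, hP⟩ := zz_tail (1 / 4) (by norm_num)
  set Z : ℕ := 2 * (∏ i, d i) * D * P.factorial with hZdef
  have hZ0 : Z ≠ 0 := by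
    have h1 : ∏ i, d i ≠ 0 := Finset.prod_ne_zero_iff.2 fun i _ => hd0 i
    have h2 := P.factorial_ne_zero
    positivity
  have hZ : ∀ i, 2 * d i * D ∣ Z := by
    intro i
    apply Dvd.dvd.mul_right
    apply Nat.mul_dvd_mul_right
    apply Nat.mul_dvd_mul_left
    exact Finset.dvd_prod_of_mem d (Finset.mem_univ i)
  have hDZ : D ∣ Z := ⟨2 * (∏ i, d i) * P.factorial, by rw [hZdef]; ring⟩
  set m : ℕ := D * Z ^ 2 with hm
  have hm0 : m ≠ 0 := by positivity
  have hZm : Z ∣ m := ⟨D * Z, by rw [hm]; ring⟩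
  have hpm : ∀ p : ℕ, p.Prime → p ∣ m → p ∣ Z := by
    intro p hp h
    rcases hp.dvd_mul.1 h with h | h
    · exact h.trans hDZ
    · exact hp.dvd_of_dvd_pow h
  obtain ⟨A1, hA1⟩ := count_prim hn d hd0 m hm0
    (fun i => ((Dvd.intro D rfl).trans (hZ i)).trans hZm) P
    (fun p hp hpP => (((hp.dvd_factorial).2 hpP).trans (Dvd.intro_left _ rfl)).trans hZm) (hP P le_rfl)
  refine ⟨A1, fun a ha => ?_⟩
  have ha0 : 0 ≤ a := le_trans (by positivity) ha
  lift a to ℕ using ha0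
  have ha' : A1 ≤ a := by exact_mod_cast ha
  obtain ⟨x0, hx0, hx0Q⟩ := global_prim hn A hau (m ^ 2) (by positivity) a
  have hx0' : ∀ p : ℕ, p.Prime → p ∣ m → ∃ j, ¬ (p : ℤ) ∣ x0 j :=
    fun p hp h => hx0 p hp (h.trans (Dvd.intro_left m (by ring)))
  obtain ⟨g, hg⟩ := gd_exists hd0 hD hΛL hZ0 hZ hm hpm hx0'
  obtain ⟨t, ht, htp⟩ := hA1 (L *ᵥ x0) g hg (D ^ 2 * a)
    (ha'.trans (Nat.le_mul_of_pos_left _ (by positivity))) (by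
      rw [← hQ]
      push_cast
      rw [← mul_sub]
      apply Dvd.dvd.mul_left
      refine dvd_trans ?_ hx0Q
      have : m * g ∣ m ^ 2 := by rw [sq]; exact Nat.mul_dvd_mul_left _ hg.hgm
      exact_mod_cast this)
  set x : Fin n → ℤ := x0 + ((Z ^ 2 : ℕ) : ℤ) • (Λ *ᵥ t) with hx
  have hLx : ∀ i, (L *ᵥ x) i = (L *ᵥ x0) i + m * t i := by
    intro i
    rw [hx, Matrix.mulVec_add, Matrix.mulVec_smul, Matrix.mulVec_mulVec, hLΛ, Matrix.smul_mulVec, Matrix.one_mulVec]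
    simp only [Pi.add_apply, Pi.smul_apply, smul_eq_mul, hm]
    push_cast; ring
  have hxQ : x ⬝ᵥ A *ᵥ x = a := by
    have h1 := hQ x
    simp only [hLx] at h1
    rw [ht] at h1
    push_cast at h1
    have hD' : (D:ℤ) ^ 2 ≠ 0 := by positivity
    exact mul_left_cancel₀ hD' h1
  refine ⟨x, ?_, hxQ⟩
  have hprim : ∀ p : ℕ, p.Prime → ¬ ∀ j, (p : ℤ) ∣ x j := by
    intro p hp hall
    by_cases h : p ∣ m
    · obtain ⟨j, hj⟩ := hx0' p hp h
      apply hj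
      have h1 : (p:ℤ) ∣ ((Z ^ 2 : ℕ) : ℤ) :=
        Int.natCast_dvd_natCast.2 ((hpm p hp h).trans (dvd_pow_self Z two_ne_zero))
      have h2 := hall j
      simp only [hx, Pi.add_apply, Pi.smul_apply, smul_eq_mul] at h2
      exact (dvd_add_left (h1.mul_right _)).1 h2
    · obtain ⟨i, hi⟩ := htp p hp h
      apply hi
      rw [← hLx]
      change (p : ℤ) ∣ ∑ j, L i j * x j
      exact Finset.dvd_sum fun j _ => (hall j).mul_left _
  have hu : IsUnit (Finset.univ.gcd x) := by
    rw [Int.isUnit_iff_natAbs_eq]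
    by_contra hne
    obtain ⟨p, hp, hpd⟩ := Nat.exists_prime_and_dvd hne
    apply hprim p hp
    intro j
    exact (Int.natCast_dvd.2 hpd).trans (Finset.gcd_dvd (Finset.mem_univ j))
  have h1 := Finset.normalize_gcd (s := Finset.univ) (f := x)
  rw [← h1]
  exact normalize_eq_one.2 hu
end

/-- A positive definite integral quadratic form in `n ≥ 5` variables which is
almost universal is almost primitively universal. -/
theorem stmt_1 {n : ℕ} (hn : 5 ≤ n) (a : Fin n → Fin n → ℤ)
    (hpos : ∀ x : Fin n → ℝ, x ≠ 0 →
      0 < ∑ i : Fin n, ∑ j ∈ Finset.Ici i, (a i j : ℝ) * x i * x j)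
    (hau : ∃ N : ℤ, ∀ m : ℤ, N ≤ m → ∃ x : Fin n → ℤ,
      ∑ i : Fin n, ∑ j ∈ Finset.Ici i, a i j * x i * x j = m) :
    ∃ N' : ℤ, ∀ m : ℤ, N' ≤ m → ∃ x : Fin n → ℤ,
      Finset.univ.gcd x = 1 ∧
      ∑ i : Fin n, ∑ j ∈ Finset.Ici i, a i j * x i * x j = m := by
  set A : Matrix (Fin n) (Fin n) ℤ := Matrix.of fun i j => if i ≤ j then a i j else 0 with hA
  have hAx : ∀ x : Fin n → ℤ, ∑ i : Fin n, ∑ j ∈ Finset.Ici i, a i j * x i * x j = dotProduct x (Matrix.mulVec A x) := by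
    intro x
    simp only [dotProduct, Matrix.mulVec, hA, Matrix.of_apply]
    refine Finset.sum_congr rfl fun i _ => ?_
    have : Finset.Ici i = Finset.univ.filter (fun j => i ≤ j) := by ext; simp
    rw [this, Finset.sum_filter, Finset.mul_sum]
    refine Finset.sum_congr rfl fun j _ => ?_
    split_ifs <;> ring
  simp only [hAx] at hau ⊢
  refine final_mat hn A (fun x hx => ?_) hau
  rw [← hAx]
  have := hpos (fun i => (x i : ℝ)) (fun h => hx (by
    ext i
    have := congrFun h i
    simpa using this))
  exact_mod_cast this
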